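/- arXiv:2002.09185 — 2 statements merged into one kernel-verified Lean document; each statement's English description precedes it below -/
import Mathlib

section
/- For every b > 0, T > 0, H > 0, every boundary influx h ∈ C([0,T]) with h(t) > 0 for all t ∈ [0,T], and every initial state u₀ ∈ C([0,b]) with 0 ≤ u₀(x) ≤ H(b−x) for 0 ≤ x ≤ b, there exists a classical solution (s, u) of the one-phase Stefan problem with data (b, u₀, h) on [0,T]. -/
open Set MeasureTheory Real

noncomputable section

/-- The space-time domain `Q_{s,T} = {(x,t) : 0 < x < s(t), 0 < t < T}`. -/
def stefanQ (T : ℝ) (s : ℝ → ℝ) : Set (ℝ × ℝ) :=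
  {p : ℝ × ℝ | 0 < p.1 ∧ p.1 < s p.2 ∧ 0 < p.2 ∧ p.2 < T}

/-- A classical solution `(s, u)` of the one-phase Stefan problem with data `(b, u₀, h)`
on `[0,T]`. -/
structure IsStefanSolution (b T : ℝ) (u₀ h : ℝ → ℝ) (s : ℝ → ℝ) (u : ℝ → ℝ → ℝ) : Prop where
  s_pos : ∀ t ∈ Icc (0:ℝ) T, 0 < s t
  s_init : s 0 = b
  s_lipschitz : ∃ L : NNReal, LipschitzOnWith L s (Icc 0 T)
  s_diff : ∀ t ∈ Ioc (0:ℝ) T, HasDerivAt s (deriv s t) t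
  s_deriv_cont : ContinuousOn (deriv s) (Ioc 0 T)
  u_cont : ContinuousOn (fun p : ℝ × ℝ => u p.1 p.2) (closure (stefanQ T s))
  u_x : ∀ x t, (x, t) ∈ stefanQ T s →
    HasDerivAt (fun y => u y t) (deriv (fun y => u y t) x) x
  u_xx : ∀ x t, (x, t) ∈ stefanQ T s →
    HasDerivAt (fun y => deriv (fun z => u z t) y)
      (deriv (fun y => deriv (fun z => u z t) y) x) x
  heat : ∀ x t, (x, t) ∈ stefanQ T s →
    HasDerivAt (fun τ => u x τ) (deriv (fun y => deriv (fun z => u z t) y) x) t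
  flux : ∀ t ∈ Ioo (0:ℝ) T, deriv (fun y => u y t) 0 = -(h t)
  init : ∀ x ∈ Ioo (0:ℝ) b, u x 0 = u₀ x
  stefan_cond : ∀ t ∈ Ioo (0:ℝ) T, deriv (fun y => u y t) (s t) = -(deriv s t)
  front_zero : ∀ t ∈ Ioo (0:ℝ) T, u (s t) t = 0

/-- The `W^{1,∞}` norm of `s` on `[0,T]`: `max(sup |s|, ess sup |s'|)`. -/
def W1inf (T : ℝ) (s : ℝ → ℝ) : ℝ :=
  max (sSup ((fun t => |s t|) '' Icc (0:ℝ) T))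
    (essSup (fun t => |deriv s t|) (volume.restrict (Icc (0:ℝ) T)))

/-- The heat kernel `K(x,ξ;t,τ)`. -/
def Kker (x ξ t τ : ℝ) : ℝ :=
  (2 * Real.sqrt (π * (t - τ)))⁻¹ * Real.exp (-(x - ξ)^2 / (4 * (t - τ)))

/-- The Neumann function `N(x,ξ;t,τ) = K(x,ξ;t,τ) + K(-x,ξ;t,τ)`. -/
def Nker (x ξ t τ : ℝ) : ℝ := Kker x ξ t τ + Kker (-x) ξ t τ

/-- The Abel operator `A₀ g (t) = (1/√π) ∫₀ᵗ g(τ)/√(t-τ) dτ`. -/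
def abelOp (g : ℝ → ℝ) (t : ℝ) : ℝ :=
  (Real.sqrt π)⁻¹ * ∫ τ in (0:ℝ)..t, g τ / Real.sqrt (t - τ)

/-- The heat kernel, extended by zero to nonpositive times. -/
def heatK (z r : ℝ) : ℝ := (2 * √(π * r))⁻¹ * exp (-z ^ 2 / (4 * r))

/-- The first space derivative of the heat kernel. -/
def heatKx (z r : ℝ) : ℝ := -z / (2 * r) * heatK z r

/-- The second space derivative of the heat kernel. -/
def heatKxx (z r : ℝ) : ℝ := (z ^ 2 / (4 * r ^ 2) - 1 / (2 * r)) * heatK z r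

lemma heatK_of_nonpos (z : ℝ) {r : ℝ} (hr : r ≤ 0) : heatK z r = 0 := by
  have : √(π * r) = 0 := Real.sqrt_eq_zero_of_nonpos (by nlinarith [Real.pi_pos])
  simp [heatK, this]

lemma heatKx_of_nonpos (z : ℝ) {r : ℝ} (hr : r ≤ 0) : heatKx z r = 0 := by
  simp [heatKx, heatK_of_nonpos z hr]

lemma heatKxx_of_nonpos (z : ℝ) {r : ℝ} (hr : r ≤ 0) : heatKxx z r = 0 := by
  simp [heatKxx, heatK_of_nonpos z hr]

lemma heatKx_zero_left (r : ℝ) : heatKx 0 r = 0 := by simp [heatKx]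

lemma heatKx_neg (z r : ℝ) : heatKx (-z) r = -heatKx z r := by
  simp [heatKx, heatK]; ring

lemma heatK_nonneg (z r : ℝ) : 0 ≤ heatK z r := by
  unfold heatK; positivity

@[fun_prop]
lemma measurable_heatK : Measurable (fun p : ℝ × ℝ => heatK p.1 p.2) := by
  unfold heatK; fun_prop

@[fun_prop]
lemma measurable_heatKx : Measurable (fun p : ℝ × ℝ => heatKx p.1 p.2) := by
  unfold heatKx heatK; fun_prop

@[fun_prop]
lemma measurable_heatKxx : Measurable (fun p : ℝ × ℝ => heatKxx p.1 p.2) := by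
  unfold heatKxx heatK; fun_prop

lemma hasDerivAt_heatK (z r : ℝ) : HasDerivAt (fun y => heatK y r) (heatKx z r) z := by
  rcases le_or_gt r 0 with hr | hr
  · simp only [heatK_of_nonpos _ hr, heatKx_of_nonpos _ hr]
    exact hasDerivAt_const _ _
  · unfold heatKx heatK
    have h1 : HasDerivAt (fun y : ℝ => -y ^ 2 / (4 * r)) (-(2 * z) / (4 * r)) z := by
      simpa using ((hasDerivAt_pow 2 z).neg.div_const (4 * r))
    refine (h1.exp.const_mul ((2 * √(π * r))⁻¹)).congr_deriv ?_
    field_simp; ring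

lemma hasDerivAt_heatKx (z r : ℝ) : HasDerivAt (fun y => heatKx y r) (heatKxx z r) z := by
  unfold heatKx
  have h1 : HasDerivAt (fun y : ℝ => -y / (2 * r)) (-1 / (2 * r)) z :=
    (hasDerivAt_id z).neg.div_const _
  refine (h1.mul (hasDerivAt_heatK z r)).congr_deriv ?_
  unfold heatKxx heatKx
  rcases eq_or_ne r 0 with rfl | hr
  · simp
  · field_simp; ring

lemma hasDerivAt_heatK_time_pos (z : ℝ) {r : ℝ} (hr : 0 < r) :
    HasDerivAt (fun q => heatK z q) (heatKxx z r) r := by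
  unfold heatKxx heatK
  have hpr : 0 < π * r := by positivity
  have h1 : HasDerivAt (fun q : ℝ => -z ^ 2 / (4 * q)) (z ^ 2 / (4 * r ^ 2)) r := by
    have := (((hasDerivAt_id r).const_mul (4 : ℝ)).fun_inv (by simp; positivity)).const_mul (-z ^ 2)
    simp only [id, mul_one] at this
    refine this.congr_deriv ?_
    field_simp
  have h2 : HasDerivAt (fun q : ℝ => (2 * √(π * q))⁻¹) (-(1 / (2 * r)) * (2 * √(π * r))⁻¹) r := by
    have h3 := (((hasDerivAt_id r).const_mul π).sqrt (by simp; positivity)).const_mul (2 : ℝ)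
    have h4 := h3.fun_inv (by simp; positivity)
    simp only [id, mul_one] at h4
    refine h4.congr_deriv ?_
    have hs : √(π * r) ^ 2 = π * r := Real.sq_sqrt hpr.le
    have hs0 : √(π * r) ≠ 0 := by positivity
    field_simp
    rw [hs]
  refine (h2.mul h1.exp).congr_deriv ?_
  ring

lemma heatK_eq {z r : ℝ} (hr : 0 < r) :
    heatK z r = (2 * √π)⁻¹ * r ^ (-(1 / 2) : ℝ) * exp (-z ^ 2 / (4 * r)) := by
  unfold heatK
  rw [Real.sqrt_mul Real.pi_pos.le, Real.rpow_neg hr.le, ← Real.sqrt_eq_rpow]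
  rw [← mul_assoc, mul_inv]

lemma inv_two_sqrt_pi_le : (2 * √π)⁻¹ ≤ 1 / 2 := by
  have : (1 : ℝ) ≤ √π := Real.one_le_sqrt.mpr (by linarith [Real.pi_gt_three])
  rw [mul_inv, one_div]
  have := inv_le_one_of_one_le₀ this
  linarith [inv_nonneg.mpr (Real.sqrt_nonneg π)]

lemma heatK_le {z r : ℝ} (hr : 0 < r) :
    heatK z r ≤ (1 / 2) * r ^ (-(1 / 2) : ℝ) * exp (-z ^ 2 / (4 * r)) := by
  rw [heatK_eq hr]
  gcongr
  exact inv_two_sqrt_pi_le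

lemma heatK_le_rpow {z r : ℝ} (hr : 0 < r) : heatK z r ≤ r ^ (-(1 / 2) : ℝ) := by
  have h1 : exp (-z ^ 2 / (4 * r)) ≤ 1 := Real.exp_le_one_iff.mpr (by
    rw [neg_div]; exact neg_nonpos.mpr (by positivity))
  have h2 : 0 < r ^ (-(1 / 2) : ℝ) := by positivity
  have := heatK_le (z := z) hr
  nlinarith

lemma abs_heatKxx_le {z r : ℝ} (hr : 0 < r) :
    |heatKxx z r| ≤ r ^ (-(3 / 2) : ℝ) * exp (-z ^ 2 / (8 * r)) := by
  set y := z ^ 2 / (8 * r) with hy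
  have hy0 : 0 ≤ y := by positivity
  have e1 : exp (-z ^ 2 / (4 * r)) = exp (-y) * exp (-y) := by
    rw [← Real.exp_add]; congr 1; rw [hy]; field_simp; ring
  have e2 : -z ^ 2 / (8 * r) = -y := by rw [hy]; ring
  have e3 : r ^ (-(3 / 2) : ℝ) = r⁻¹ * r ^ (-(1 / 2) : ℝ) := by
    rw [← Real.rpow_neg_one, ← Real.rpow_add hr]; norm_num
  have e4 : z ^ 2 / (4 * r ^ 2) - 1 / (2 * r) = r⁻¹ * (2 * y - 1 / 2) := by
    rw [hy]; field_simp; ring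
  have h5 : |2 * y - 1 / 2| * exp (-y) ≤ 2 := by
    have : y + 1 ≤ exp y := Real.add_one_le_exp y
    have h6 : |2 * y - 1 / 2| ≤ 2 * exp y := by
      rw [abs_le]; constructor <;> nlinarith
    calc _ ≤ 2 * exp y * exp (-y) := by gcongr
      _ = 2 := by rw [mul_assoc, ← Real.exp_add]; simp
  have hk := heatK_le (z := z) hr
  rw [heatKxx, e4, abs_mul, abs_mul, abs_of_pos (inv_pos.mpr hr), abs_of_nonneg (heatK_nonneg _ _),
    e2, e3]
  rw [e1] at hk
  have hp : 0 < r ^ (-(1 / 2) : ℝ) := by positivity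
  calc r⁻¹ * |2 * y - 1 / 2| * heatK z r
      ≤ r⁻¹ * |2 * y - 1 / 2| * (1 / 2 * r ^ (-(1 / 2) : ℝ) * (exp (-y) * exp (-y))) := by gcongr
    _ = r⁻¹ * r ^ (-(1 / 2) : ℝ) * exp (-y) * (1 / 2 * (|2 * y - 1 / 2| * exp (-y))) := by ring
    _ ≤ r⁻¹ * r ^ (-(1 / 2) : ℝ) * exp (-y) * (1 / 2 * 2) := by gcongr
    _ = _ := by ring

lemma abs_heatKxx_le_rpow {z r : ℝ} (hr : 0 < r) : |heatKxx z r| ≤ r ^ (-(3 / 2) : ℝ) := by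
  refine (abs_heatKxx_le hr).trans (mul_le_of_le_one_right (by positivity) ?_)
  exact Real.exp_le_one_iff.mpr (by rw [neg_div]; exact neg_nonpos.mpr (by positivity))

lemma abs_heatKx_sub_le (z₁ z₂ : ℝ) {r : ℝ} (hr : 0 < r) :
    |heatKx z₁ r - heatKx z₂ r| ≤ r ^ (-(3 / 2) : ℝ) * |z₁ - z₂| := by
  have := Convex.norm_image_sub_le_of_norm_hasDerivWithin_le (s := univ) (x := z₂) (y := z₁)
    (f := fun y => heatKx y r) (f' := fun y => heatKxx y r) (C := r ^ (-(3 / 2) : ℝ))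
    (fun x _ => (hasDerivAt_heatKx x r).hasDerivWithinAt)
    (fun x _ => by simpa using abs_heatKxx_le_rpow hr) convex_univ trivial trivial
  simpa using this

lemma abs_heatKx_le_rpow (z : ℝ) {r : ℝ} (hr : 0 < r) :
    |heatKx z r| ≤ r ^ (-(3 / 2) : ℝ) * |z| := by
  simpa [heatKx_zero_left] using abs_heatKx_sub_le z 0 hr

lemma abs_heatKx_le {z r : ℝ} (hr : 0 < r) :
    |heatKx z r| ≤ r⁻¹ * exp (-z ^ 2 / (8 * r)) := by
  set q := √r with hq
  have hq0 : 0 < q := Real.sqrt_pos.mpr hr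
  have hqr : r = q ^ 2 := (Real.sq_sqrt hr.le).symm
  set v := |z| / q with hv
  have hv0 : 0 ≤ v := by positivity
  have ez : |z| = v * q := by rw [hv]; field_simp
  have ez2 : z ^ 2 = v ^ 2 * r := by rw [← sq_abs, ez, hqr]; ring
  have e1 : exp (-z ^ 2 / (4 * r)) = exp (-(v ^ 2 / 8)) * exp (-(v ^ 2 / 8)) := by
    rw [← Real.exp_add]; congr 1; rw [ez2]; field_simp; ring
  have e2 : exp (-z ^ 2 / (8 * r)) = exp (-(v ^ 2 / 8)) := by
    congr 1; rw [ez2]; field_simp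
  have e3 : r ^ (-(1 / 2) : ℝ) = q⁻¹ := by
    rw [Real.rpow_neg hr.le, ← Real.sqrt_eq_rpow]
  have h5 : v * exp (-(v ^ 2 / 8)) ≤ 2 := by
    have := Real.add_one_le_exp (v ^ 2 / 8)
    have h6 : v ≤ 2 * exp (v ^ 2 / 8) := by nlinarith [sq_nonneg (v - 2)]
    calc _ ≤ 2 * exp (v ^ 2 / 8) * exp (-(v ^ 2 / 8)) := by gcongr
      _ = 2 := by rw [mul_assoc, ← Real.exp_add]; simp
  have hk := heatK_le (z := z) hr
  rw [e1, e3] at hk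
  rw [heatKx, abs_mul, abs_of_nonneg (heatK_nonneg _ _), abs_div, abs_neg,
    abs_of_pos (by positivity : 0 < 2 * r), ez, e2]
  calc v * q / (2 * r) * heatK z r
      ≤ v * q / (2 * r) * (1 / 2 * q⁻¹ * (exp (-(v ^ 2 / 8)) * exp (-(v ^ 2 / 8)))) := by gcongr
    _ = r⁻¹ * exp (-(v ^ 2 / 8)) * (1 / 4 * (v * exp (-(v ^ 2 / 8)))) := by field_simp; ring
    _ ≤ r⁻¹ * exp (-(v ^ 2 / 8)) * (1 / 4 * 2) := by gcongr
    _ ≤ r⁻¹ * exp (-(v ^ 2 / 8)) := by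
      have : 0 < r⁻¹ * exp (-(v ^ 2 / 8)) := by positivity
      linarith

lemma rpow_neg_le_one_add {r a : ℝ} (hr : 0 < r) (ha : 0 ≤ a) (ha2 : a ≤ 2) :
    r ^ (-a) ≤ 1 + (r ^ 2)⁻¹ := by
  have h2 : r ^ (-2 : ℝ) = (r ^ 2)⁻¹ := by
    rw [Real.rpow_neg hr.le]; norm_num
  have h3 : 0 < (r ^ 2)⁻¹ := by positivity
  rcases le_total r 1 with h | h
  · have : r ^ (-a) ≤ r ^ (-2 : ℝ) := Real.rpow_le_rpow_of_exponent_ge hr h (by linarith)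
    linarith
  · have := Real.rpow_le_one_of_one_le_of_nonpos h (by linarith : -a ≤ 0)
    linarith

lemma exp_neg_sq_div_le {z r : ℝ} (hr : 0 < r) (hz : z ≠ 0) (n : ℕ) :
    exp (-z ^ 2 / (8 * r)) ≤ n.factorial * (8 * r / z ^ 2) ^ n := by
  have hy : 0 < z ^ 2 / (8 * r) := by positivity
  have h := Real.pow_div_factorial_le_exp _ hy.le n
  rw [neg_div, Real.exp_neg]
  have hf : (0 : ℝ) < n.factorial := by exact_mod_cast n.factorial_pos
  calc (exp (z ^ 2 / (8 * r)))⁻¹ ≤ ((z ^ 2 / (8 * r)) ^ n / n.factorial)⁻¹ := by gcongr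
    _ = _ := by rw [inv_div, div_eq_mul_inv, ← inv_pow, inv_div]

/-- A common Gaussian majorant for the heat kernel and its first two derivatives. -/
lemma heatK_bounds {z r : ℝ} (hr : 0 < r) :
    |heatK z r| ≤ (1 + (r ^ 2)⁻¹) * exp (-z ^ 2 / (8 * r)) ∧
    |heatKx z r| ≤ (1 + (r ^ 2)⁻¹) * exp (-z ^ 2 / (8 * r)) ∧
    |heatKxx z r| ≤ (1 + (r ^ 2)⁻¹) * exp (-z ^ 2 / (8 * r)) := by
  refine ⟨?_, ?_, ?_⟩
  · rw [abs_of_nonneg (heatK_nonneg _ _)]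
    refine (heatK_le hr).trans ?_
    have h1 := rpow_neg_le_one_add hr (a := 1 / 2) (by norm_num) (by norm_num)
    have h2 : exp (-z ^ 2 / (4 * r)) ≤ exp (-z ^ 2 / (8 * r)) := by
      apply Real.exp_le_exp.mpr
      rw [neg_div, neg_div]
      apply neg_le_neg
      gcongr
      norm_num
    have h3 : 0 < r ^ (-(1 / 2) : ℝ) := by positivity
    calc 1 / 2 * r ^ (-(1 / 2) : ℝ) * exp (-z ^ 2 / (4 * r))
        ≤ r ^ (-(1 / 2) : ℝ) * exp (-z ^ 2 / (8 * r)) := by gcongr; linarith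
      _ ≤ _ := by gcongr
  · refine (abs_heatKx_le hr).trans ?_
    have h1 := rpow_neg_le_one_add hr (a := 1) (by norm_num) (by norm_num)
    rw [Real.rpow_neg_one] at h1
    gcongr
  · refine (abs_heatKxx_le hr).trans ?_
    have h1 := rpow_neg_le_one_add hr (a := 3 / 2) (by norm_num) (by norm_num)
    gcongr

lemma one_add_inv_sq_mul_exp_le {δ z r : ℝ} (hδ : 0 < δ) (hr : 0 < r) (h : δ ≤ |z| ∨ δ ≤ |r|) :
    (1 + (r ^ 2)⁻¹) * exp (-z ^ 2 / (8 * r)) ≤ 1 + 128 / δ ^ 4 + (δ ^ 2)⁻¹ := by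
  have hexp : exp (-z ^ 2 / (8 * r)) ≤ 1 :=
    Real.exp_le_one_iff.mpr (by rw [neg_div]; exact neg_nonpos.mpr (by positivity))
  rcases h with h | h
  · have hz : z ≠ 0 := by
      intro h0; simp [h0] at h; linarith
    have h2 := exp_neg_sq_div_le hr hz 2
    have hz2 : δ ^ 4 ≤ z ^ 4 := by
      have : z ^ 4 = |z| ^ 4 := by rw [← abs_pow]; exact (abs_of_nonneg (by positivity)).symm
      rw [this]; gcongr
    have h3 : (r ^ 2)⁻¹ * exp (-z ^ 2 / (8 * r)) ≤ 128 / δ ^ 4 := by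
      calc (r ^ 2)⁻¹ * exp (-z ^ 2 / (8 * r))
          ≤ (r ^ 2)⁻¹ * ((2 : ℕ).factorial * (8 * r / z ^ 2) ^ 2) := by gcongr
        _ = 128 / z ^ 4 := by simp only [Nat.factorial]; field_simp; norm_num
        _ ≤ 128 / δ ^ 4 := by gcongr
    have : 0 < (δ ^ 2)⁻¹ := by positivity
    nlinarith
  · rw [abs_of_pos hr] at h
    have h3 : (r ^ 2)⁻¹ ≤ (δ ^ 2)⁻¹ := by gcongr
    have h4 : 0 < (r ^ 2)⁻¹ := by positivity
    have : 0 < 128 / δ ^ 4 := by positivity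
    nlinarith [Real.exp_pos (-z ^ 2 / (8 * r))]

/-- The heat kernel and its derivatives are bounded away from the origin. -/
lemma exists_heatK_bound {δ : ℝ} (hδ : 0 < δ) : ∃ C, 0 ≤ C ∧ ∀ z r, (δ ≤ |z| ∨ δ ≤ |r|) →
    |heatK z r| ≤ C ∧ |heatKx z r| ≤ C ∧ |heatKxx z r| ≤ C := by
  have hC : 0 ≤ 1 + 128 / δ ^ 4 + (δ ^ 2)⁻¹ := by positivity
  refine ⟨_, hC, fun z r h => ?_⟩
  rcases le_or_gt r 0 with hr | hr
  · simpa [heatK_of_nonpos _ hr, heatKx_of_nonpos _ hr, heatKxx_of_nonpos _ hr] using hC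
  · have h1 := one_add_inv_sq_mul_exp_le hδ hr h
    have h2 := heatK_bounds (z := z) hr
    exact ⟨h2.1.trans h1, h2.2.1.trans h1, h2.2.2.trans h1⟩

lemma hasDerivAt_heatK_time {z r : ℝ} (h : z ≠ 0 ∨ r ≠ 0) :
    HasDerivAt (fun q => heatK z q) (heatKxx z r) r := by
  rcases lt_trichotomy r 0 with hr | hr | hr
  · rw [heatKxx_of_nonpos _ hr.le]
    refine (hasDerivAt_const r (0 : ℝ)).congr_of_eventuallyEq ?_
    filter_upwards [Iio_mem_nhds hr] with q hq
    exact heatK_of_nonpos _ (le_of_lt hq)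
  · subst hr
    have hz : z ≠ 0 := by simpa using h
    rw [heatKxx_of_nonpos _ le_rfl, hasDerivAt_iff_isLittleO_nhds_zero]
    have hO : (fun q : ℝ => heatK z q) =O[nhds 0] fun q : ℝ => q ^ 2 := by
      refine Asymptotics.IsBigO.of_bound (2 * ((4 : ℕ).factorial * (8 / z ^ 2) ^ 4)) ?_
      filter_upwards [Iio_mem_nhds (zero_lt_one' ℝ)] with q hq
      rcases le_or_gt q 0 with hq0 | hq0
      · rw [heatK_of_nonpos _ hq0]; simp; positivity
      · have hq1 : q < 1 := hq
        have h1 := (heatK_bounds (z := z) hq0).1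
        have h2 := exp_neg_sq_div_le hq0 hz 4
        have h3 : 1 + (q ^ 2)⁻¹ ≤ 2 * (q ^ 2)⁻¹ := by
          have : 1 ≤ (q ^ 2)⁻¹ := (one_le_inv₀ (by positivity)).mpr (by nlinarith)
          linarith
        rw [Real.norm_eq_abs, Real.norm_eq_abs, abs_of_pos (by positivity : 0 < q ^ 2)]
        calc |heatK z q| ≤ _ := h1
          _ ≤ 2 * (q ^ 2)⁻¹ * ((4 : ℕ).factorial * (8 * q / z ^ 2) ^ 4) := by gcongr
          _ = 2 * ((4 : ℕ).factorial * (8 / z ^ 2) ^ 4) * q ^ 2 := by field_simp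
    have ho : (fun q : ℝ => q ^ 2) =o[nhds 0] fun q : ℝ => q := by
      simpa using Asymptotics.isLittleO_pow_pow (𝕜 := ℝ) (show 1 < 2 by norm_num)
    simpa [heatK_of_nonpos z le_rfl] using hO.trans_isLittleO ho
  · exact hasDerivAt_heatK_time_pos z hr

/-- The superposition with density `f` of translates of the kernel `κ` to `(p a, q a)`. -/
def sourcePot (κ : ℝ → ℝ → ℝ) (f p q : ℝ → ℝ) (x t : ℝ) : ℝ :=
  ∫ a, f a * κ (x - p a) (t - q a)

/-- The point `(x, t)` has positive distance from all sources `(p a, q a)`. -/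
def IsAway (p q : ℝ → ℝ) (x t : ℝ) : Prop :=
  ∃ δ > 0, ∀ a, δ ≤ |x - p a| ∨ δ ≤ |t - q a|

lemma isAway_curve {γ : ℝ → ℝ} (hγ : Continuous γ) {x t : ℝ} (h : x ≠ γ t) :
    IsAway γ (fun τ => τ) x t := by
  have hd : 0 < |x - γ t| / 2 := by
    have := abs_pos.mpr (sub_ne_zero.mpr h); positivity
  obtain ⟨η, hη, hη2⟩ := Metric.continuous_iff.mp hγ t _ hd
  refine ⟨min η (|x - γ t| / 2), lt_min hη hd, fun a => ?_⟩
  by_cases ha : |t - a| < η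
  · left
    have h1 := hη2 a (by rwa [Real.dist_eq, abs_sub_comm])
    rw [Real.dist_eq] at h1
    have h2 := abs_sub_abs_le_abs_sub (x - γ t) (γ a - γ t)
    have h3 : x - γ t - (γ a - γ t) = x - γ a := by ring
    rw [h3] at h2
    exact (min_le_right _ _).trans (by linarith)
  · right
    exact (min_le_left _ _).trans (not_lt.mp ha)

lemma isAway_pos {p : ℝ → ℝ} {x t : ℝ} (ht : 0 < t) : IsAway p (fun _ => 0) x t :=
  ⟨t, ht, fun a => Or.inr (by simp [abs_of_pos ht])⟩

lemma integrable_mul_kernel {κ : ℝ → ℝ → ℝ} (hκ : Measurable (fun p : ℝ × ℝ => κ p.1 p.2))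
    {f p q : ℝ → ℝ} (hf : Integrable f) (hp : Measurable p) (hq : Measurable q) {x t C : ℝ}
    (hC : ∀ a, |κ (x - p a) (t - q a)| ≤ C) :
    Integrable (fun a => f a * κ (x - p a) (t - q a)) := by
  refine hf.mul_bdd (c := C) ?_ (Filter.Eventually.of_forall hC)
  exact (hκ.comp (f := fun a => (x - p a, t - q a)) (by fun_prop)).aestronglyMeasurable

lemma hasDerivAt_sourcePot_space {κ κ' : ℝ → ℝ → ℝ}
    (hκ : Measurable (fun p : ℝ × ℝ => κ p.1 p.2))
    (hκ' : Measurable (fun p : ℝ × ℝ => κ' p.1 p.2))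
    (hbd : ∀ δ > 0, ∃ C, ∀ z r, (δ ≤ |z| ∨ δ ≤ |r|) → |κ z r| ≤ C ∧ |κ' z r| ≤ C)
    (hd : ∀ z r, HasDerivAt (fun y => κ y r) (κ' z r) z)
    {f p q : ℝ → ℝ} (hf : Integrable f) (hp : Measurable p) (hq : Measurable q) {x t : ℝ}
    (h : IsAway p q x t) :
    HasDerivAt (fun y => sourcePot κ f p q y t) (sourcePot κ' f p q x t) x := by
  obtain ⟨δ, hδ, hδ2⟩ := h
  obtain ⟨C, hC⟩ := hbd (δ / 2) (by positivity)
  have key : ∀ y ∈ Metric.ball x (δ / 2), ∀ a, δ / 2 ≤ |y - p a| ∨ δ / 2 ≤ |t - q a| := by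
    intro y hy a
    rcases hδ2 a with h1 | h1
    · left
      rw [Metric.mem_ball, Real.dist_eq] at hy
      have := abs_sub_abs_le_abs_sub (x - p a) (x - y)
      rw [show x - p a - (x - y) = y - p a by ring, abs_sub_comm x y] at this
      linarith
    · right; linarith
  have hx : x ∈ Metric.ball x (δ / 2) := Metric.mem_ball_self (by positivity)
  refine (hasDerivAt_integral_of_dominated_loc_of_deriv_le (s := Metric.ball x (δ / 2))
    (bound := fun a => |f a| * C)
    (F := fun y a => f a * κ (y - p a) (t - q a)) (F' := fun y a => f a * κ' (y - p a) (t - q a))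
    (Metric.ball_mem_nhds x (by positivity)) ?_ ?_ ?_ ?_ ?_ ?_).2
  · refine Filter.Eventually.of_forall fun y => hf.aestronglyMeasurable.mul ?_
    exact (hκ.comp (f := fun a => (y - p a, t - q a)) (by fun_prop)).aestronglyMeasurable
  · exact integrable_mul_kernel hκ hf hp hq fun a => (hC _ _ (key x hx a)).1
  · refine hf.aestronglyMeasurable.mul ?_
    exact (hκ'.comp (f := fun a => (x - p a, t - q a)) (by fun_prop)).aestronglyMeasurable
  · refine Filter.Eventually.of_forall fun a y hy => ?_
    rw [norm_mul]
    exact mul_le_mul_of_nonneg_left (hC _ _ (key y hy a)).2 (abs_nonneg _)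
  · exact hf.abs.mul_const C
  · refine Filter.Eventually.of_forall fun a y _ => ?_
    exact ((hd (y - p a) (t - q a)).comp_sub_const y (p a)).const_mul (f a)

lemma hasDerivAt_sourcePot_heatK {f p q : ℝ → ℝ} (hf : Integrable f) (hp : Measurable p)
    (hq : Measurable q) {x t : ℝ} (h : IsAway p q x t) :
    HasDerivAt (fun y => sourcePot heatK f p q y t) (sourcePot heatKx f p q x t) x := by
  refine hasDerivAt_sourcePot_space measurable_heatK measurable_heatKx ?_ hasDerivAt_heatK hf hp hq h
  intro δ hδ
  obtain ⟨C, _, hC⟩ := exists_heatK_bound hδ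
  exact ⟨C, fun z r h => ⟨(hC z r h).1, (hC z r h).2.1⟩⟩

lemma hasDerivAt_sourcePot_heatKx {f p q : ℝ → ℝ} (hf : Integrable f) (hp : Measurable p)
    (hq : Measurable q) {x t : ℝ} (h : IsAway p q x t) :
    HasDerivAt (fun y => sourcePot heatKx f p q y t) (sourcePot heatKxx f p q x t) x := by
  refine hasDerivAt_sourcePot_space measurable_heatKx measurable_heatKxx ?_ hasDerivAt_heatKx
    hf hp hq h
  intro δ hδ
  obtain ⟨C, _, hC⟩ := exists_heatK_bound hδ
  exact ⟨C, fun z r h => ⟨(hC z r h).2.1, (hC z r h).2.2⟩⟩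

lemma hasDerivAt_sourcePot_time {f p q : ℝ → ℝ} (hf : Integrable f) (hp : Measurable p)
    (hq : Measurable q) {x t : ℝ} (h : IsAway p q x t) :
    HasDerivAt (fun τ => sourcePot heatK f p q x τ) (sourcePot heatKxx f p q x t) t := by
  obtain ⟨δ, hδ, hδ2⟩ := h
  obtain ⟨C, _, hC⟩ := exists_heatK_bound (show 0 < δ / 2 by positivity)
  have key : ∀ y ∈ Metric.ball t (δ / 2), ∀ a, δ / 2 ≤ |x - p a| ∨ δ / 2 ≤ |y - q a| := by
    intro y hy a
    rcases hδ2 a with h1 | h1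
    · left; linarith
    · right
      rw [Metric.mem_ball, Real.dist_eq] at hy
      have := abs_sub_abs_le_abs_sub (t - q a) (t - y)
      rw [show t - q a - (t - y) = y - q a by ring, abs_sub_comm t y] at this
      linarith
  have hx : t ∈ Metric.ball t (δ / 2) := Metric.mem_ball_self (by positivity)
  refine (hasDerivAt_integral_of_dominated_loc_of_deriv_le (s := Metric.ball t (δ / 2))
    (bound := fun a => |f a| * C)
    (F := fun y a => f a * heatK (x - p a) (y - q a))
    (F' := fun y a => f a * heatKxx (x - p a) (y - q a))
    (Metric.ball_mem_nhds t (by positivity)) ?_ ?_ ?_ ?_ ?_ ?_).2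
  · refine Filter.Eventually.of_forall fun y => hf.aestronglyMeasurable.mul ?_
    exact (measurable_heatK.comp (f := fun a => (x - p a, y - q a)) (by fun_prop)).aestronglyMeasurable
  · exact integrable_mul_kernel measurable_heatK hf hp hq fun a => (hC _ _ (key t hx a)).1
  · refine hf.aestronglyMeasurable.mul ?_
    exact (measurable_heatKxx.comp (f := fun a => (x - p a, t - q a))
      (by fun_prop)).aestronglyMeasurable
  · refine Filter.Eventually.of_forall fun a y hy => ?_
    rw [norm_mul]
    exact mul_le_mul_of_nonneg_left (hC _ _ (key y hy a)).2.2 (abs_nonneg _)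
  · exact hf.abs.mul_const C
  · refine Filter.Eventually.of_forall fun a y hy => ?_
    have hne : x - p a ≠ 0 ∨ y - q a ≠ 0 := by
      rcases key y hy a with h1 | h1
      · left; intro h0; rw [h0, abs_zero] at h1; linarith
      · right; intro h0; rw [h0, abs_zero] at h1; linarith
    exact ((hasDerivAt_heatK_time hne).comp_sub_const y (q a)).const_mul (f a)

/-- A bounded measurable source density on `(0, S]`, continuous there and vanishing elsewhere. -/
structure IsDensity (S R : ℝ) (f : ℝ → ℝ) : Prop where
  measurable : Measurable f
  bound : ∀ t, |f t| ≤ R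
  supp : ∀ t, t ∉ Ioc 0 S → f t = 0
  cont : ContinuousOn f (Ioc 0 S)

namespace IsDensity

variable {S R : ℝ} {f : ℝ → ℝ}

lemma nonneg (hf : IsDensity S R f) : 0 ≤ R := (abs_nonneg _).trans (hf.bound 0)

lemma integrable (hf : IsDensity S R f) : Integrable f := by
  have h1 : Integrable ((Ioc 0 S).indicator fun _ => R) :=
    (integrable_indicator_iff measurableSet_Ioc).mpr (integrableOn_const (by simp))
  refine h1.mono' hf.measurable.aestronglyMeasurable (Filter.Eventually.of_forall fun t => ?_)
  by_cases ht : t ∈ Ioc 0 S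
  · simpa [ht] using hf.bound t
  · simp [ht, hf.supp t ht]

lemma continuousAt (hf : IsDensity S R f) {t : ℝ} (h0 : 0 < t) (h1 : t < S) : ContinuousAt f t :=
  hf.cont.continuousAt (Ioc_mem_nhds h0 h1)

end IsDensity

/-- In terms of the elapsed time, a time-dependent source potential is a convolution. -/
lemma sourcePot_eq_elapsed (κ : ℝ → ℝ → ℝ) (f γ : ℝ → ℝ) (x t : ℝ) :
    sourcePot κ f γ (fun τ => τ) x t = ∫ r, f (t - r) * κ (x - γ (t - r)) r := by
  have := integral_sub_left_eq_self (fun τ => f τ * κ (x - γ τ) (t - τ)) volume t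
  rw [sourcePot, ← this]
  simp

lemma integrable_rpow_majorant {S C a : ℝ} (ha : -1 < a) :
    Integrable ((Ioc 0 S).indicator fun r : ℝ => C * r ^ a) := by
  rw [integrable_indicator_iff measurableSet_Ioc]
  rcases le_or_gt S 0 with hS | hS
  · simp [Ioc_eq_empty (not_lt.mpr hS)]
  · have := (intervalIntegral.intervalIntegrable_rpow' (a := 0) (b := S) ha).const_mul C
    rwa [intervalIntegrable_iff_integrableOn_Ioc_of_le hS.le] at this

lemma abs_density_mul_le {S R C a : ℝ} {f : ℝ → ℝ} (hf : IsDensity S R f) {κ : ℝ → ℝ → ℝ}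
    (hκ0 : ∀ z r, r ≤ 0 → κ z r = 0) {t r z : ℝ} (ht : t ≤ S)
    (hb : 0 < r → r < t → |κ z r| ≤ C * r ^ a) (hC : 0 ≤ C) :
    |f (t - r) * κ z r| ≤ (Ioc 0 S).indicator (fun r : ℝ => R * C * r ^ a) r := by
  have hR := hf.nonneg
  have h0 : 0 ≤ (Ioc 0 S).indicator (fun r : ℝ => R * C * r ^ a) r :=
    indicator_nonneg (fun q hq => by have := hq.1; positivity) r
  rcases le_or_gt r 0 with hr | hr
  · simpa [hκ0 z r hr] using h0
  rcases le_or_gt t r with hrt | hrt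
  · rw [hf.supp (t - r) (fun h => by linarith [h.1])]; simpa using h0
  have hmem : r ∈ Ioc 0 S := ⟨hr, by linarith⟩
  rw [indicator_of_mem hmem, abs_mul, mul_assoc]
  exact mul_le_mul (hf.bound _) (hb hr hrt) (abs_nonneg _) hR

/-- Continuity of an integral of a density against a weakly singular kernel. -/
lemma continuousOn_density_integral {X : Type*} [TopologicalSpace X] [FirstCountableTopology X]
    {S R C : ℝ} {f : ℝ → ℝ} (hf : IsDensity S R f) {κ : ℝ → ℝ → ℝ}
    (hκ : Measurable (fun p : ℝ × ℝ => κ p.1 p.2)) (hκ0 : ∀ z r, r ≤ 0 → κ z r = 0)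
    (hκc : ∀ r, Continuous fun z => κ z r) {D : Set X} {θ : X → ℝ} {ζ : X → ℝ → ℝ}
    (hθ : ContinuousOn θ D) (hθS : ∀ p ∈ D, θ p ≤ S)
    (hζ : ∀ r, ContinuousOn (fun p => ζ p r) D) (hζm : ∀ p ∈ D, Measurable (ζ p)) (hC : 0 ≤ C)
    (hb : ∀ p ∈ D, ∀ r, 0 < r → r < θ p → |κ (ζ p r) r| ≤ C * r ^ (-(1 / 2) : ℝ)) :
    ContinuousOn (fun p => ∫ r, f (θ p - r) * κ (ζ p r) r) D := by
  intro p₀ hp₀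
  have hD : ∀ᶠ p in nhdsWithin p₀ D, p ∈ D := eventually_mem_nhdsWithin
  refine continuousWithinAt_of_dominated
    (bound := (Ioc 0 S).indicator fun r : ℝ => R * C * r ^ (-(1 / 2) : ℝ)) ?_ ?_ ?_ ?_
  · filter_upwards [hD] with p hp
    have h1 : Measurable fun r => f (θ p - r) := hf.measurable.comp (by fun_prop)
    have h2 : Measurable fun r => κ (ζ p r) r :=
      hκ.comp (f := fun r => (ζ p r, r)) ((hζm p hp).prodMk measurable_id)
    exact (h1.mul h2).aestronglyMeasurable
  · filter_upwards [hD] with p hp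
    exact Filter.Eventually.of_forall fun r => abs_density_mul_le hf hκ0 (hθS p hp) (hb p hp r) hC
  · exact integrable_rpow_majorant (by norm_num)
  · have hne : ∀ᵐ r : ℝ, r ≠ θ p₀ := by
      simp [ae_iff, measure_singleton]
    filter_upwards [hne] with r hr
    rcases le_or_gt r 0 with hr0 | hr0
    · simp only [hκ0 _ r hr0, mul_zero]
      exact continuousWithinAt_const
    have hκζ : ContinuousWithinAt (fun p => κ (ζ p r) r) D p₀ :=
      (hκc r).continuousAt.comp_continuousWithinAt (hζ r p₀ hp₀)
    rcases lt_or_gt_of_ne hr with h | h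
    · refine ContinuousWithinAt.mul ?_ hκζ
      have hc := hf.continuousAt (t := θ p₀ - r) (by linarith) (by linarith [hθS p₀ hp₀])
      exact ContinuousAt.comp_continuousWithinAt (f := fun p => θ p - r) hc
        ((hθ p₀ hp₀).sub continuousWithinAt_const)
    · have hz : ∀ᶠ p in nhdsWithin p₀ D, f (θ p - r) * κ (ζ p r) r = 0 := by
        filter_upwards [(hθ p₀ hp₀).eventually (Iio_mem_nhds h)] with p hp
        have hp' : θ p < r := hp
        rw [hf.supp _ (fun h => by linarith [h.1]), zero_mul]
      refine ContinuousWithinAt.congr_of_eventuallyEq (f := fun _ => (0 : ℝ))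
        continuousWithinAt_const hz ?_
      rw [hf.supp _ (fun h' => by linarith [h'.1]), zero_mul]

lemma continuousOn_sourcePot_heatK {S R : ℝ} {f γ : ℝ → ℝ} (hf : IsDensity S R f)
    (hγ : Continuous γ) :
    ContinuousOn (fun p : ℝ × ℝ => sourcePot heatK f γ (fun τ => τ) p.1 p.2) {p | p.2 ≤ S} := by
  simp only [sourcePot_eq_elapsed]
  refine continuousOn_density_integral (C := 1) (θ := fun p : ℝ × ℝ => p.2)
    (ζ := fun p r => p.1 - γ (p.2 - r)) hf measurable_heatK (fun z r => heatK_of_nonpos z)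
    (fun r => continuous_iff_continuousAt.mpr fun z => (hasDerivAt_heatK z r).continuousAt)
    (by fun_prop) (fun p hp => hp) (fun r => by fun_prop) (fun p _ => by fun_prop) zero_le_one ?_
  intro p _ r hr _
  rw [abs_of_nonneg (heatK_nonneg _ _), one_mul]
  exact heatK_le_rpow hr

lemma exists_bound_sourcePot_heatK {S R : ℝ} {f : ℝ → ℝ} (γ : ℝ → ℝ) (hf : IsDensity S R f) :
    ∃ C, ∀ x t, t ≤ S → |sourcePot heatK f γ (fun τ => τ) x t| ≤ C := by
  refine ⟨∫ r, (Ioc 0 S).indicator (fun r : ℝ => R * 1 * r ^ (-(1 / 2) : ℝ)) r, fun x t ht => ?_⟩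
  rw [sourcePot_eq_elapsed, ← Real.norm_eq_abs]
  refine norm_integral_le_of_norm_le (integrable_rpow_majorant (by norm_num))
    (Filter.Eventually.of_forall fun r => ?_)
  refine abs_density_mul_le hf (fun z r => heatK_of_nonpos z) ht (fun hr _ => ?_) zero_le_one
  rw [abs_of_nonneg (heatK_nonneg _ _), one_mul]
  exact heatK_le_rpow hr

lemma sourcePot_heatK_zero_time {S R : ℝ} {f : ℝ → ℝ} (γ : ℝ → ℝ) (hf : IsDensity S R f) (x : ℝ) :
    sourcePot heatK f γ (fun τ => τ) x 0 = 0 := by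
  rw [sourcePot]
  refine integral_eq_zero_of_ae (Filter.Eventually.of_forall fun τ => ?_)
  rcases le_or_gt τ 0 with h | h
  · simp [hf.supp τ (fun h' => by linarith [h'.1])]
  · simp [heatK_of_nonpos _ (show -τ ≤ 0 by linarith)]

lemma kernel_change_of_variable {z y d : ℝ} (hz : 0 < z) (hy : 0 < y) :
    (|(-2 : ℝ)| * y ^ ((-2 : ℝ) - 1)) * ((z ^ 2 / 4) * (z / (2 * ((z ^ 2 / 4) * y ^ (-2 : ℝ))) *
      heatK (z + d) ((z ^ 2 / 4) * y ^ (-2 : ℝ)))) =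
    (√π)⁻¹ * exp (-(y ^ 2 * (1 + d / z) ^ 2)) := by
  have h2 : y ^ (-2 : ℝ) = (y ^ 2)⁻¹ := by
    rw [Real.rpow_neg hy.le]; norm_num
  have h3 : y ^ ((-2 : ℝ) - 1) = (y ^ 3)⁻¹ := by
    rw [show (-2 : ℝ) - 1 = -(3 : ℝ) by norm_num, Real.rpow_neg hy.le]; norm_num
  have h4 : √(π * (z ^ 2 / 4 * (y ^ 2)⁻¹)) = √π * (z / (2 * y)) := by
    rw [Real.sqrt_mul Real.pi_pos.le]
    congr 1
    rw [show z ^ 2 / 4 * (y ^ 2)⁻¹ = (z / (2 * y)) ^ 2 by field_simp; ring]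
    exact Real.sqrt_sq (by positivity)
  rw [heatK, h2, h3, h4]
  have h5 : -(z + d) ^ 2 / (4 * (z ^ 2 / 4 * (y ^ 2)⁻¹)) = -(y ^ 2 * (1 + d / z) ^ 2) := by
    field_simp
  rw [h5, abs_neg, abs_two]
  have hs : √π ≠ 0 := by positivity
  field_simp

lemma integral_Ioi_change_of_variable (G : ℝ → ℝ) {c : ℝ} (hc : 0 < c) :
    ∫ y in Ioi (0 : ℝ), (|(-2 : ℝ)| * y ^ ((-2 : ℝ) - 1)) * (c * G (c * y ^ (-2 : ℝ))) =
      ∫ r in Ioi (0 : ℝ), G r := by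
  have h1 := integral_comp_rpow_Ioi (fun q => c * G (c * q)) (p := -2) (by norm_num)
  have h2 := integral_comp_mul_left_Ioi' G 0 hc
  simp only [smul_eq_mul, mul_zero] at h1 h2
  rw [h1, integral_const_mul, h2]

lemma tendsto_singular_part {S R Λ : ℝ} {f Δ : ℝ → ℝ} (hf : IsDensity S R f) (hΔm : Measurable Δ)
    (hΔ : ∀ r, |Δ r| ≤ Λ * |r|) {t : ℝ} (ht : t ∈ Ioc 0 S) :
    Filter.Tendsto (fun z => ∫ r in Ioi (0 : ℝ), f (t - r) * (z / (2 * r) * heatK (z + Δ r) r))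
      (nhdsWithin 0 (Ioi 0)) (nhds (f t / 2)) := by
  have hR := hf.nonneg
  have hΛ : 0 ≤ Λ := by simpa using (abs_nonneg _).trans (hΔ 1)
  set ρ : ℝ → ℝ → ℝ := fun z y => z ^ 2 / 4 * y ^ (-2 : ℝ) with hρ
  have hρe : ∀ z y, 0 < y → ρ z y = z ^ 2 / (4 * y ^ 2) := by
    intro z y hy
    simp only [hρ]
    rw [Real.rpow_neg hy.le]
    norm_num
    field_simp
  have hpos : ∀ᶠ z : ℝ in nhdsWithin 0 (Ioi 0), 0 < z := eventually_mem_nhdsWithin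
  have hcv : ∀ᶠ z : ℝ in nhdsWithin 0 (Ioi 0),
      ∫ y in Ioi (0 : ℝ), f (t - ρ z y) * ((√π)⁻¹ * exp (-(y ^ 2 * (1 + Δ (ρ z y) / z) ^ 2))) =
      ∫ r in Ioi (0 : ℝ), f (t - r) * (z / (2 * r) * heatK (z + Δ r) r) := by
    filter_upwards [hpos] with z hz
    rw [← integral_Ioi_change_of_variable (fun r => f (t - r) * (z / (2 * r) * heatK (z + Δ r) r))
      (show 0 < z ^ 2 / 4 by positivity)]
    refine setIntegral_congr_fun measurableSet_Ioi fun y hy => ?_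
    rw [← kernel_change_of_variable hz hy]
    ring
  refine Filter.Tendsto.congr' hcv ?_
  have hlim : ∫ y in Ioi (0 : ℝ), f t * ((√π)⁻¹ * exp (-(y ^ 2 * (1 + 0) ^ 2))) = f t / 2 := by
    have := integral_gaussian_Ioi 1
    simp only [add_zero, one_pow, mul_one]
    simp only [neg_mul, one_mul, div_one] at this
    rw [integral_const_mul, integral_const_mul, this]
    have hs : √π ≠ 0 := by positivity
    field_simp
  rw [← hlim]
  refine tendsto_integral_filter_of_dominated_convergence
    (fun y => R * ((√π)⁻¹ * (exp (Λ ^ 2 * S / 4) * exp (-(1 / 2) * y ^ 2)))) ?_ ?_ ?_ ?_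
  · refine Filter.Eventually.of_forall fun z => Measurable.aestronglyMeasurable ?_
    have h1 : Measurable fun y => ρ z y := by simp only [hρ]; fun_prop
    have h2 : Measurable fun y => f (t - ρ z y) := hf.measurable.comp (by fun_prop)
    have h3 : Measurable fun y => Δ (ρ z y) := hΔm.comp h1
    have h4 : Measurable fun y => (√π)⁻¹ * exp (-(y ^ 2 * (1 + Δ (ρ z y) / z) ^ 2)) := by
      fun_prop
    exact h2.mul h4
  · filter_upwards [hpos] with z hz
    refine (ae_restrict_mem measurableSet_Ioi).mono fun y hy => ?_
    have hy0 : 0 < y := hy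
    rw [Real.norm_eq_abs, abs_mul]
    by_cases hr : ρ z y < t
    · have hρ0 : 0 < ρ z y := by rw [hρe z y hy0]; positivity
      refine mul_le_mul (hf.bound _) ?_ (abs_nonneg _) hR
      rw [abs_of_nonneg (by positivity), ← Real.exp_add]
      refine mul_le_mul_of_nonneg_left (Real.exp_le_exp.mpr ?_) (by positivity)
      set e := Δ (ρ z y) / z with he
      have h1 : e ^ 2 ≤ Λ ^ 2 * (ρ z y) ^ 2 / z ^ 2 := by
        rw [he, div_pow, ← mul_pow, ← sq_abs (Δ _)]
        have := hΔ (ρ z y)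
        rw [abs_of_pos hρ0] at this
        gcongr
      have h2 : y ^ 2 * (Λ ^ 2 * (ρ z y) ^ 2 / z ^ 2) = Λ ^ 2 * ρ z y / 4 := by
        rw [hρe z y hy0]; field_simp
      have h3 : y ^ 2 * e ^ 2 ≤ Λ ^ 2 * S / 4 := by
        calc y ^ 2 * e ^ 2 ≤ y ^ 2 * (Λ ^ 2 * (ρ z y) ^ 2 / z ^ 2) := by gcongr
          _ = Λ ^ 2 * ρ z y / 4 := h2
          _ ≤ Λ ^ 2 * S / 4 := by gcongr; linarith [ht.2]
      nlinarith [mul_nonneg (sq_nonneg y) (sq_nonneg (1 + 2 * e))]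
    · rw [hf.supp _ (fun h => by linarith [h.1])]
      simp only [abs_zero, zero_mul]
      positivity
  · exact (((integrable_exp_neg_mul_sq (by norm_num)).const_mul _).const_mul _).const_mul _ |>.integrableOn
  · refine (ae_restrict_mem measurableSet_Ioi).mono fun y hy => ?_
    have hy0 : 0 < y := hy
    have hz0 : Filter.Tendsto (fun z : ℝ => z) (nhdsWithin 0 (Ioi 0)) (nhds 0) :=
      Filter.tendsto_id.mono_left nhdsWithin_le_nhds
    have hρlim : Filter.Tendsto (fun z => ρ z y) (nhdsWithin 0 (Ioi 0)) (nhds 0) := by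
      have := ((hz0.pow 2).div_const 4).mul_const (y ^ (-2 : ℝ))
      simpa only [ne_eq, OfNat.ofNat_ne_zero, not_false_eq_true, zero_pow, zero_div, zero_mul]
        using this
    refine Filter.Tendsto.mul ?_ ?_
    · have hc := hf.cont t ht
      refine hc.tendsto.comp (tendsto_nhdsWithin_iff.mpr ⟨by simpa using hρlim.const_sub t, ?_⟩)
      filter_upwards [hρlim.eventually (Iio_mem_nhds ht.1), hpos] with z hz1 hz2
      have : 0 < ρ z y := by rw [hρe z y hy0]; positivity
      have h1 : ρ z y < t := hz1
      exact ⟨by linarith, by linarith [ht.2]⟩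
    · have he : Filter.Tendsto (fun z => Δ (ρ z y) / z) (nhdsWithin 0 (Ioi 0)) (nhds 0) := by
        have hb : Filter.Tendsto (fun z : ℝ => Λ * (z / (4 * y ^ 2))) (nhdsWithin 0 (Ioi 0))
            (nhds 0) := by simpa using (hz0.div_const (4 * y ^ 2)).const_mul Λ
        refine squeeze_zero_norm' ?_ hb
        filter_upwards [hpos] with z hz
        have h1 := hΔ (ρ z y)
        rw [abs_of_pos (show 0 < ρ z y by rw [hρe z y hy0]; positivity), hρe z y hy0] at h1
        rw [Real.norm_eq_abs, abs_div, abs_of_pos hz, hρe z y hy0, div_le_iff₀ hz]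
        calc _ ≤ _ := h1
          _ = _ := by ring
      have : Continuous fun e : ℝ => (√π)⁻¹ * exp (-(y ^ 2 * (1 + e) ^ 2)) := by fun_prop
      exact (this.tendsto 0).comp he

lemma tendsto_regular_part {S R Λ : ℝ} {f Δ : ℝ → ℝ} (hf : IsDensity S R f) (hΔm : Measurable Δ)
    (hΔ : ∀ r, |Δ r| ≤ Λ * |r|) {t : ℝ} (ht : t ≤ S) :
    (∀ z, Integrable fun r => f (t - r) * (Δ r / (2 * r) * heatK (z + Δ r) r)) ∧
    Filter.Tendsto (fun z => ∫ r, f (t - r) * (Δ r / (2 * r) * heatK (z + Δ r) r))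
      (nhds 0) (nhds (-∫ r, f (t - r) * heatKx (Δ r) r)) := by
  have hΛ : 0 ≤ Λ := by simpa using (abs_nonneg _).trans (hΔ 1)
  have hbound : ∀ z r, |f (t - r) * (Δ r / (2 * r) * heatK (z + Δ r) r)| ≤
      (Ioc 0 S).indicator (fun r : ℝ => R * (Λ / 2) * r ^ (-(1 / 2) : ℝ)) r := by
    intro z r
    refine abs_density_mul_le hf (κ := fun z r => Δ r / (2 * r) * heatK (z + Δ r) r) ?_ ht ?_
      (by positivity)
    · intro z r hr; simp [heatK_of_nonpos _ hr]
    · intro hr _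
      have h1 := hΔ r
      rw [abs_of_pos hr] at h1
      rw [abs_mul, abs_of_nonneg (heatK_nonneg _ _), abs_div, abs_of_pos (show 0 < 2 * r by positivity)]
      refine mul_le_mul ?_ (heatK_le_rpow hr) (heatK_nonneg _ _) (by positivity)
      rw [div_le_iff₀ (by positivity)]
      linarith
  have hmeas : ∀ z, Measurable fun r => f (t - r) * (Δ r / (2 * r) * heatK (z + Δ r) r) := by
    intro z
    have h1 : Measurable fun r => f (t - r) := hf.measurable.comp (by fun_prop)
    have h2 : Measurable fun r => heatK (z + Δ r) r :=
      measurable_heatK.comp (f := fun r => (z + Δ r, r)) (by fun_prop)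
    have h3 : Measurable fun r => Δ r / (2 * r) := by fun_prop
    exact h1.mul (h3.mul h2)
  have hmaj := integrable_rpow_majorant (S := S) (C := R * (Λ / 2)) (a := -(1 / 2)) (by norm_num)
  refine ⟨fun z => hmaj.mono' (hmeas z).aestronglyMeasurable
    (Filter.Eventually.of_forall (hbound z)), ?_⟩
  have hlim : -∫ r, f (t - r) * heatKx (Δ r) r =
      ∫ r, f (t - r) * (Δ r / (2 * r) * heatK (0 + Δ r) r) := by
    rw [← integral_neg]
    congr 1
    ext r
    rw [heatKx, zero_add]; ring
  rw [hlim]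
  refine tendsto_integral_filter_of_dominated_convergence _
    (Filter.Eventually.of_forall fun z => (hmeas z).aestronglyMeasurable)
    (Filter.Eventually.of_forall fun z => Filter.Eventually.of_forall (hbound z)) hmaj
    (Filter.Eventually.of_forall fun r => ?_)
  have hc : Continuous fun z => heatK z r :=
    continuous_iff_continuousAt.mpr fun z => (hasDerivAt_heatK z r).continuousAt
  have : Continuous fun z => f (t - r) * (Δ r / (2 * r) * heatK (z + Δ r) r) := by fun_prop
  exact this.tendsto 0

/-- Jump relation, from the right, for the space derivative of a single layer heat potential. -/
lemma tendsto_sourcePot_heatKx_right {S R Λ : ℝ} {f γ : ℝ → ℝ} (hf : IsDensity S R f)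
    (hγ : ∀ a b, |γ a - γ b| ≤ Λ * |a - b|) {t : ℝ} (ht : t ∈ Ioc 0 S) :
    Filter.Tendsto (fun x => sourcePot heatKx f γ (fun τ => τ) x t) (nhdsWithin (γ t) (Ioi (γ t)))
      (nhds (-(f t / 2) + sourcePot heatKx f γ (fun τ => τ) (γ t) t)) := by
  have hΛ : 0 ≤ Λ := by simpa using (abs_nonneg _).trans (hγ 1 0)
  have hγc : Continuous γ := (LipschitzWith.of_dist_le' hγ).continuous
  set Δ : ℝ → ℝ := fun r => γ t - γ (t - r) with hΔdef
  have hΔm : Measurable Δ := by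
    have : Continuous Δ := by fun_prop
    exact this.measurable
  have hΔ : ∀ r, |Δ r| ≤ Λ * |r| := fun r => by simpa using hγ t (t - r)
  have h1 := tendsto_singular_part hf hΔm hΔ ht
  obtain ⟨h2i, h2⟩ := tendsto_regular_part hf hΔm hΔ ht.2
  have hshift : Filter.Tendsto (fun x => x - γ t) (nhdsWithin (γ t) (Ioi (γ t)))
      (nhdsWithin 0 (Ioi 0)) := by
    refine tendsto_nhdsWithin_iff.mpr ⟨?_, ?_⟩
    · have : Continuous fun x => x - γ t := by fun_prop
      simpa using (this.tendsto (γ t)).mono_left nhdsWithin_le_nhds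
    · filter_upwards [eventually_mem_nhdsWithin] with x hx
      exact sub_pos.mpr (mem_Ioi.mp hx)
  have h3 := (h1.comp hshift).neg.add ((h2.comp (hshift.mono_right nhdsWithin_le_nhds)).neg)
  have e0 : ∫ r, f (t - r) * heatKx (Δ r) r = sourcePot heatKx f γ (fun τ => τ) (γ t) t := by
    rw [sourcePot_eq_elapsed]
  rw [e0, neg_neg] at h3
  refine h3.congr' ?_
  filter_upwards [eventually_mem_nhdsWithin] with x hx
  have hx0 : γ t < x := hx
  simp only [Function.comp]
  obtain ⟨δ, hδ, hδ2⟩ := isAway_curve hγc hx0.ne'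
  obtain ⟨C, _, hC⟩ := exists_heatK_bound hδ
  have hfull : Integrable fun r => f (t - r) * heatKx (x - γ t + Δ r) r := by
    have := (integrable_mul_kernel measurable_heatKx hf.integrable hγc.measurable measurable_id
      (x := x) (t := t) (fun a => (hC _ _ (hδ2 a)).2.1)).comp_sub_left t
    refine this.congr (Filter.Eventually.of_forall fun r => ?_)
    simp [hΔdef]
  rw [sourcePot_eq_elapsed]
  have e1 : ∫ r in Ioi (0 : ℝ), f (t - r) * ((x - γ t) / (2 * r) * heatK (x - γ t + Δ r) r) =
      ∫ r, f (t - r) * ((x - γ t) / (2 * r) * heatK (x - γ t + Δ r) r) := by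
    refine setIntegral_eq_integral_of_forall_compl_eq_zero fun r hr => ?_
    rw [heatK_of_nonpos _ (not_lt.mp hr)]; simp
  have e2 : ∫ r, f (t - r) * ((x - γ t) / (2 * r) * heatK (x - γ t + Δ r) r) =
      -(∫ r, f (t - r) * heatKx (x - γ t + Δ r) r) -
        ∫ r, f (t - r) * (Δ r / (2 * r) * heatK (x - γ t + Δ r) r) := by
    rw [← integral_neg]
    refine Eq.trans ?_ (integral_sub hfull.neg (h2i _))
    congr 1
    ext r
    simp only [heatKx]; ring
  rw [e1, e2, neg_sub, sub_neg_eq_add]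
  have e3 : ∀ r, x - γ t + Δ r = x - γ (t - r) := fun r => by simp [hΔdef]
  simp only [e3]
  ring

lemma sourcePot_heatKx_neg (f γ q : ℝ → ℝ) (x t : ℝ) :
    sourcePot heatKx f (fun a => -γ a) q (-x) t = -sourcePot heatKx f γ q x t := by
  rw [sourcePot, sourcePot, ← integral_neg]
  congr 1
  ext a
  rw [show -x - -γ a = -(x - γ a) by ring, heatKx_neg]
  ring

/-- Jump relation, from the left, for the space derivative of a single layer heat potential. -/
lemma tendsto_sourcePot_heatKx_left {S R Λ : ℝ} {f γ : ℝ → ℝ} (hf : IsDensity S R f)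
    (hγ : ∀ a b, |γ a - γ b| ≤ Λ * |a - b|) {t : ℝ} (ht : t ∈ Ioc 0 S) :
    Filter.Tendsto (fun x => sourcePot heatKx f γ (fun τ => τ) x t) (nhdsWithin (γ t) (Iio (γ t)))
      (nhds (f t / 2 + sourcePot heatKx f γ (fun τ => τ) (γ t) t)) := by
  have h := tendsto_sourcePot_heatKx_right (γ := fun a => -γ a) hf (Λ := Λ)
    (fun a b => by rw [neg_sub_neg, abs_sub_comm]; exact hγ a b) ht
  have hneg : Filter.Tendsto (fun x : ℝ => -x) (nhdsWithin (γ t) (Iio (γ t)))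
      (nhdsWithin (-γ t) (Ioi (-γ t))) := by
    refine tendsto_nhdsWithin_iff.mpr ⟨?_, ?_⟩
    · exact (continuous_neg.tendsto (γ t)).mono_left nhdsWithin_le_nhds
    · filter_upwards [eventually_mem_nhdsWithin] with x hx
      exact neg_lt_neg (mem_Iio.mp hx)
  have h2 := (h.comp hneg).neg
  simp only [Function.comp_def, sourcePot_heatKx_neg, neg_neg, neg_add] at h2
  exact h2

/-- The bounded solution of the heat equation on the line with initial value `g`. -/
def heatExt (g : ℝ → ℝ) (x t : ℝ) : ℝ :=
  ∫ y, (√π)⁻¹ * exp (-y ^ 2) * g (x - 2 * √t * y)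

lemma integrable_gaussian_density : Integrable fun y : ℝ => (√π)⁻¹ * exp (-y ^ 2) := by
  simpa using (integrable_exp_neg_mul_sq one_pos).const_mul (√π)⁻¹

lemma integral_gaussian_density : ∫ y : ℝ, (√π)⁻¹ * exp (-y ^ 2) = 1 := by
  have := integral_gaussian 1
  simp only [neg_mul, one_mul, div_one] at this
  rw [integral_const_mul, this]
  exact inv_mul_cancel₀ (by positivity)

lemma continuous_heatExt {g : ℝ → ℝ} (hg : Continuous g) {B : ℝ} (hB : ∀ x, |g x| ≤ B) :
    Continuous fun p : ℝ × ℝ => heatExt g p.1 p.2 := by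
  refine continuous_of_dominated (bound := fun y => (√π)⁻¹ * exp (-y ^ 2) * B) ?_ ?_ ?_ ?_
  · intro p
    have : Continuous fun y => (√π)⁻¹ * exp (-y ^ 2) * g (p.1 - 2 * √p.2 * y) := by fun_prop
    exact this.aestronglyMeasurable
  · refine fun p => Filter.Eventually.of_forall fun y => ?_
    rw [norm_mul, Real.norm_of_nonneg (show 0 ≤ (√π)⁻¹ * exp (-y ^ 2) by positivity)]
    exact mul_le_mul_of_nonneg_left (hB _) (by positivity)
  · exact integrable_gaussian_density.mul_const B
  · exact Filter.Eventually.of_forall fun y => by fun_prop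

lemma abs_heatExt_le {g : ℝ → ℝ} {B : ℝ} (hB : ∀ x, |g x| ≤ B) (x t : ℝ) :
    |heatExt g x t| ≤ B := by
  have h : ∫ y, (√π)⁻¹ * exp (-y ^ 2) * B = B := by
    rw [integral_mul_const, integral_gaussian_density, one_mul]
  rw [← h, ← Real.norm_eq_abs]
  refine norm_integral_le_of_norm_le (integrable_gaussian_density.mul_const B)
    (Filter.Eventually.of_forall fun y => ?_)
  rw [norm_mul, Real.norm_of_nonneg (show 0 ≤ (√π)⁻¹ * exp (-y ^ 2) by positivity)]
  exact mul_le_mul_of_nonneg_left (hB _) (by positivity)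

lemma heatExt_of_nonpos (g : ℝ → ℝ) (x : ℝ) {t : ℝ} (ht : t ≤ 0) : heatExt g x t = g x := by
  simp only [heatExt, Real.sqrt_eq_zero_of_nonpos ht, mul_zero, zero_mul, sub_zero]
  rw [integral_mul_const, integral_gaussian_density, one_mul]

lemma heatExt_eq_sourcePot (g : ℝ → ℝ) (x : ℝ) {t : ℝ} (ht : 0 < t) :
    heatExt g x t = sourcePot heatK g (fun a => a) (fun _ => 0) x t := by
  have hs : 0 < 2 * √t := by positivity
  have h1 := integral_sub_left_eq_self (fun a => g a * heatK (x - a) (t - 0)) volume x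
  have h2 := Measure.integral_comp_mul_left (fun z => g (x - z) * heatK (x - (x - z)) (t - 0)) (2 * √t)
  rw [sourcePot, ← h1, heatExt]
  have h3 : ∫ y, (√π)⁻¹ * exp (-y ^ 2) * g (x - 2 * √t * y) =
      2 * √t * ∫ y, g (x - 2 * √t * y) * heatK (x - (x - 2 * √t * y)) (t - 0) := by
    rw [← integral_const_mul]
    congr 1
    ext y
    have hq : √t ^ 2 = t := Real.sq_sqrt ht.le
    rw [sub_sub_cancel, sub_zero, heatK, Real.sqrt_mul Real.pi_pos.le]
    have : -(2 * √t * y) ^ 2 / (4 * t) = -y ^ 2 := by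
      rw [mul_pow, mul_pow, hq]; field_simp; ring
    rw [this]
    field_simp
  rw [h3, h2, abs_of_pos (by positivity), smul_eq_mul, ← mul_assoc, mul_inv_cancel₀ hs.ne', one_mul]

lemma continuousOn_sourcePot_heatKx_initial {g p : ℝ → ℝ} (hg : Integrable g) (hp : Measurable p) :
    ContinuousOn (fun q : ℝ × ℝ => sourcePot heatKx g p (fun _ => 0) q.1 q.2) {q | 0 < q.2} := by
  intro q₀ hq₀
  have hq : 0 < q₀.2 := hq₀
  obtain ⟨C, _, hC⟩ := exists_heatK_bound (show 0 < q₀.2 / 2 by positivity)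
  have hev : ∀ᶠ q : ℝ × ℝ in nhds q₀, q₀.2 / 2 < q.2 :=
    continuous_snd.continuousAt.eventually (Ioi_mem_nhds (by linarith))
  refine ContinuousAt.continuousWithinAt ?_
  refine continuousAt_of_dominated (bound := fun a => |g a| * C) ?_ ?_ (hg.abs.mul_const C) ?_
  · refine Filter.Eventually.of_forall fun q => hg.aestronglyMeasurable.mul ?_
    exact (measurable_heatKx.comp (f := fun a => (q.1 - p a, q.2 - 0))
      (by fun_prop)).aestronglyMeasurable
  · filter_upwards [hev] with q hq
    refine Filter.Eventually.of_forall fun a => ?_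
    rw [norm_mul]
    refine mul_le_mul_of_nonneg_left (hC _ _ (Or.inr ?_)).2.1 (abs_nonneg _)
    rw [sub_zero]
    exact hq.le.trans (le_abs_self _)
  · refine Filter.Eventually.of_forall fun a => ContinuousAt.mul continuousAt_const ?_
    have h1 : ContinuousAt (fun q : ℝ × ℝ => -(q.1 - p a) / (2 * (q.2 - 0)) *
        ((2 * √(π * (q.2 - 0)))⁻¹ * exp (-(q.1 - p a) ^ 2 / (4 * (q.2 - 0))))) q₀ := by
      have e1 : (2 * √(π * (q₀.2 - 0))) ≠ 0 := by rw [sub_zero]; positivity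
      have e2 : 2 * (q₀.2 - 0) ≠ 0 := by rw [sub_zero]; positivity
      have e3 : 4 * (q₀.2 - 0) ≠ 0 := by rw [sub_zero]; positivity
      fun_prop (disch := assumption)
    exact h1

lemma sourcePot_heatKx_even {g : ℝ → ℝ} (hg : ∀ x, g (-x) = g x) (t : ℝ) :
    sourcePot heatKx g (fun a => a) (fun _ => 0) 0 t = 0 := by
  have h1 := integral_neg_eq_self (fun a => g a * heatKx (0 - a) (t - 0)) volume
  have h2 : ∀ a, g (-a) * heatKx (0 - -a) (t - 0) = -(g a * heatKx (0 - a) (t - 0)) := by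
    intro a
    rw [hg, show (0 : ℝ) - -a = -(0 - a) by ring, heatKx_neg]; ring
  simp only [h2] at h1
  rw [integral_neg] at h1
  rw [sourcePot]
  linarith

lemma abs_sourcePot_heatKxx_initial_le {g : ℝ → ℝ} {b H : ℝ} (hg : ∀ x, |g x| ≤ H * |x - b|)
    {x t : ℝ} (ht : 0 < t) :
    |sourcePot heatKxx g (fun a => a) (fun _ => 0) x t| ≤
      H * (4 * √t + |x - b|) * t ^ (-(3 / 2) : ℝ) * √(16 * π * t) := by
  have hH : 0 ≤ H := by
    have := (abs_nonneg _).trans (hg (b + 1)); simpa using this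
  have hst : 0 < √t := Real.sqrt_pos.mpr ht
  have hst2 : √t ^ 2 = t := Real.sq_sqrt ht.le
  have hG := integral_gaussian (1 / (16 * t))
  have hGi := integrable_exp_neg_mul_sq (show 0 < 1 / (16 * t) by positivity)
  have e1 : √(16 * π * t) = √(π / (1 / (16 * t))) := by congr 1; field_simp
  rw [e1, ← hG, ← integral_const_mul,
    ← integral_sub_left_eq_self _ volume x, sourcePot, ← Real.norm_eq_abs]
  refine norm_integral_le_of_norm_le ((hGi.const_mul _).comp_sub_left x)
    (Filter.Eventually.of_forall fun a => ?_)
  set z := x - a with hz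
  rw [Real.norm_eq_abs, abs_mul, sub_zero]
  have k1 := abs_heatKxx_le (z := z) ht
  have k2 : |g a| ≤ H * (|z| + |x - b|) := by
    refine (hg a).trans (mul_le_mul_of_nonneg_left ?_ hH)
    have : a - b = -z + (x - b) := by rw [hz]; ring
    rw [this]
    exact (abs_add_le _ _).trans (by rw [abs_neg])
  have k3 : |z| * exp (-z ^ 2 / (8 * t)) ≤ 4 * √t * exp (-(1 / (16 * t)) * z ^ 2) := by
    have : |z| / (4 * √t) ≤ exp (z ^ 2 / (16 * t)) := by
      have h1 := Real.add_one_le_exp (z ^ 2 / (16 * t))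
      have h2 : z ^ 2 / (16 * t) = (|z| / (4 * √t)) ^ 2 := by
        rw [div_pow, mul_pow, hst2, sq_abs]; norm_num
      rw [h2] at h1 ⊢
      nlinarith [sq_nonneg (|z| / (4 * √t) - 1)]
    rw [div_le_iff₀ (by positivity)] at this
    calc |z| * exp (-z ^ 2 / (8 * t)) ≤ (exp (z ^ 2 / (16 * t)) * (4 * √t)) * exp (-z ^ 2 / (8 * t)) := by
          gcongr
      _ = 4 * √t * (exp (z ^ 2 / (16 * t)) * exp (-z ^ 2 / (8 * t))) := by ring
      _ = _ := by
          rw [← Real.exp_add]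
          congr 2
          field_simp
          ring
  have k4 : exp (-z ^ 2 / (8 * t)) ≤ exp (-(1 / (16 * t)) * z ^ 2) := by
    refine Real.exp_le_exp.mpr ?_
    rw [neg_div, neg_mul, neg_le_neg_iff, div_mul_eq_mul_div, one_mul]
    gcongr
    norm_num
  calc |g a| * |heatKxx z t|
      ≤ (H * (|z| + |x - b|)) * (t ^ (-(3 / 2) : ℝ) * exp (-z ^ 2 / (8 * t))) := by gcongr
    _ = H * t ^ (-(3 / 2) : ℝ) * (|z| * exp (-z ^ 2 / (8 * t)) + |x - b| * exp (-z ^ 2 / (8 * t))) := by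
        ring
    _ ≤ H * t ^ (-(3 / 2) : ℝ) * (4 * √t * exp (-(1 / (16 * t)) * z ^ 2) +
          |x - b| * exp (-(1 / (16 * t)) * z ^ 2)) := by gcongr
    _ = _ := by ring

/-- Near the endpoint `b`, where the datum vanishes linearly, the space derivative of its heat
extension is Lipschitz with constant of order `t ^ (-1/2)`. -/
lemma exists_lipschitz_sourcePot_heatKx_initial {g : ℝ → ℝ} (hgi : Integrable g) {b H M S : ℝ}
    (hM : 0 ≤ M) (hg : ∀ x, |g x| ≤ H * |x - b|) :
    ∃ C, 0 ≤ C ∧ ∀ x y t, 0 < t → t ≤ S → |x - b| ≤ M * t → |y - b| ≤ M * t →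
      |sourcePot heatKx g (fun a => a) (fun _ => 0) x t -
        sourcePot heatKx g (fun a => a) (fun _ => 0) y t| ≤ C * t ^ (-(1 / 2) : ℝ) * |x - y| := by
  have hH : 0 ≤ H := by
    have := (abs_nonneg _).trans (hg (b + 1)); simpa using this
  refine ⟨H * (4 + M * √S) * √(16 * π), by positivity, fun x y t ht htS hx hy => ?_⟩
  have hst : 0 < √t := Real.sqrt_pos.mpr ht
  have hst2 : √t * √t = t := Real.mul_self_sqrt ht.le
  have hr1 : t ^ (-(3 / 2) : ℝ) * t = t ^ (-(1 / 2) : ℝ) := by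
    conv_lhs => rw [← Real.rpow_one t]
    rw [← Real.rpow_mul ht.le, ← Real.rpow_add ht]; norm_num
  have key : ∀ w ∈ Metric.closedBall b (M * t),
      ‖sourcePot heatKxx g (fun a => a) (fun _ => 0) w t‖ ≤
        H * (4 + M * √S) * √(16 * π) * t ^ (-(1 / 2) : ℝ) := by
    intro w hw
    rw [Metric.mem_closedBall, Real.dist_eq] at hw
    refine (abs_sourcePot_heatKxx_initial_le hg ht).trans ?_
    rw [Real.sqrt_mul (by positivity) t]
    have h1 : 4 * √t + |w - b| ≤ (4 + M * √S) * √t := by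
      have : |w - b| ≤ M * √S * √t := by
        refine hw.trans ?_
        rw [mul_assoc]
        refine mul_le_mul_of_nonneg_left ?_ hM
        calc t = √t * √t := hst2.symm
          _ ≤ √S * √t := by gcongr
      nlinarith
    calc H * (4 * √t + |w - b|) * t ^ (-(3 / 2) : ℝ) * (√(16 * π) * √t)
        ≤ H * ((4 + M * √S) * √t) * t ^ (-(3 / 2) : ℝ) * (√(16 * π) * √t) := by gcongr
      _ = H * (4 + M * √S) * √(16 * π) * (t ^ (-(3 / 2) : ℝ) * (√t * √t)) := by ring
      _ = _ := by rw [hst2, hr1]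
  have := (convex_closedBall b (M * t)).norm_image_sub_le_of_norm_hasDerivWithin_le
    (f := fun y => sourcePot heatKx g (fun a => a) (fun _ => 0) y t)
    (fun w _ => (hasDerivAt_sourcePot_heatKx hgi measurable_id measurable_const
      (isAway_pos ht)).hasDerivWithinAt) key
    (show y ∈ Metric.closedBall b (M * t) by rwa [Metric.mem_closedBall, Real.dist_eq])
    (show x ∈ Metric.closedBall b (M * t) by rwa [Metric.mem_closedBall, Real.dist_eq])
  simpa only [Real.norm_eq_abs] using this

/-- Candidate speeds of the free boundary. -/
structure IsSpeed (S M : ℝ) (w : ℝ → ℝ) : Prop where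
  density : IsDensity S M w
  nonneg : ∀ t, 0 ≤ w t

lemma IsSpeed.of_tendsto {S M : ℝ} {f : ℕ → ℝ → ℝ} {w : ℝ → ℝ} (hf : ∀ n, IsSpeed S M (f n))
    (hw : ∀ t, Filter.Tendsto (fun n => f n t) Filter.atTop (nhds (w t)))
    (hu : TendstoUniformlyOn f w Filter.atTop (Ioc 0 S)) : IsSpeed S M w where
  density :=
    { measurable := measurable_of_tendsto_metrizable (fun n => (hf n).density.measurable)
        (tendsto_pi_nhds.mpr hw)
      bound := fun t => le_of_tendsto' (hw t).abs fun n => (hf n).density.bound t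
      supp := fun t ht => tendsto_nhds_unique (hw t)
        (tendsto_const_nhds.congr fun n => ((hf n).density.supp t ht).symm)
      cont := hu.continuousOn (Filter.Eventually.of_forall fun n => (hf n).density.cont).frequently }
  nonneg := fun t => ge_of_tendsto' (hw t) fun n => (hf n).nonneg t

/-- The contraction principle for maps of speeds, in an exponentially weighted norm. -/
lemma exists_speed_fixedPoint {S M l : ℝ} (hM : 0 ≤ M) (hl : 0 ≤ l)
    {A : (ℝ → ℝ) → ℝ → ℝ} (hA : ∀ w, IsSpeed S M w → IsSpeed S M (A w))
    (hc : ∀ w₁ w₂ D, IsSpeed S M w₁ → IsSpeed S M w₂ → 0 ≤ D →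
      (∀ t, |w₁ t - w₂ t| ≤ D * exp (l * t)) → ∀ t, |A w₁ t - A w₂ t| ≤ D / 2 * exp (l * t)) :
    ∃ w, IsSpeed S M w ∧ A w = w := by
  set f : ℕ → ℝ → ℝ := fun n => A^[n] (fun _ => 0) with hf
  have f0 : IsSpeed S M (f 0) :=
    ⟨⟨measurable_const, by simp [hf, hM], by simp [hf], continuousOn_const⟩, by simp [hf]⟩
  have fs : ∀ n, f (n + 1) = A (f n) := fun n => Function.iterate_succ_apply' _ _ _
  have hfn : ∀ n, IsSpeed S M (f n) := by
    intro n
    induction n with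
    | zero => exact f0
    | succ n ih => rw [fs]; exact hA _ ih
  have step : ∀ n t, |f n t - f (n + 1) t| ≤ M * (1 / 2) ^ n * exp (l * t) := by
    intro n
    induction n with
    | zero =>
      intro t
      by_cases ht : t ∈ Ioc 0 S
      · have h1 := (hfn 1).density.bound t
        have h2 : 1 ≤ exp (l * t) := Real.one_le_exp (mul_nonneg hl ht.1.le)
        have h3 : f 0 t = 0 := by simp [hf]
        rw [h3, zero_sub, abs_neg, pow_zero, mul_one]
        exact h1.trans (le_mul_of_one_le_right hM h2)
      · rw [(hfn 0).density.supp t ht, (hfn 1).density.supp t ht, sub_self, abs_zero]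
        positivity
    | succ n ih =>
      intro t
      have := hc (f n) (f (n + 1)) _ (hfn n) (hfn (n + 1)) (by positivity) ih t
      rw [← fs, ← fs] at this
      refine this.trans (le_of_eq ?_)
      rw [pow_succ]; ring
  have step' : ∀ t n, dist (f n t) (f (n + 1) t) ≤ M * exp (l * t) * (1 / 2) ^ n := by
    intro t n
    rw [Real.dist_eq]
    exact (step n t).trans (le_of_eq (by ring))
  have hlim : ∀ t, ∃ y, Filter.Tendsto (fun n => f n t) Filter.atTop (nhds y) := fun t =>
    cauchySeq_tendsto_of_complete (cauchySeq_of_le_geometric (1 / 2) _ (by norm_num) (step' t))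
  choose w hw using hlim
  have hdist : ∀ n t, |f n t - w t| ≤ (2 * M * (1 / 2) ^ n) * exp (l * t) := by
    intro n t
    have := dist_le_of_le_geometric_of_tendsto (1 / 2) _ (by norm_num) (step' t) (hw t) n
    rw [Real.dist_eq] at this
    refine this.trans (le_of_eq ?_)
    norm_num
    ring
  have hgeo : ∀ c : ℝ, Filter.Tendsto (fun n : ℕ => c * (1 / 2 : ℝ) ^ n) Filter.atTop (nhds 0) := by
    intro c
    simpa using (tendsto_pow_atTop_nhds_zero_of_lt_one (r := (1 / 2 : ℝ)) (by norm_num)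
      (by norm_num)).const_mul c
  have hu : TendstoUniformlyOn f w Filter.atTop (Ioc 0 S) := by
    rw [Metric.tendstoUniformlyOn_iff]
    intro ε hε
    filter_upwards [(hgeo (2 * M * exp (l * S))).eventually (Iio_mem_nhds hε)] with n hn t ht
    rw [dist_comm, Real.dist_eq]
    refine (hdist n t).trans_lt (lt_of_le_of_lt ?_ hn)
    have : exp (l * t) ≤ exp (l * S) :=
      Real.exp_le_exp.mpr (mul_le_mul_of_nonneg_left ht.2 hl)
    calc 2 * M * (1 / 2) ^ n * exp (l * t) ≤ 2 * M * (1 / 2) ^ n * exp (l * S) := by gcongr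
      _ = _ := by ring
  have hws : IsSpeed S M w := IsSpeed.of_tendsto hfn hw hu
  refine ⟨w, hws, funext fun t => ?_⟩
  have h1 : Filter.Tendsto (fun n => f (n + 1) t) Filter.atTop (nhds (A w t)) := by
    rw [tendsto_iff_dist_tendsto_zero]
    refine squeeze_zero (fun _ => dist_nonneg) (fun n => ?_) (hgeo (M * exp (l * t)))
    have := hc (f n) w _ (hfn n) hws (by positivity) (hdist n) t
    rw [← fs] at this
    rw [Real.dist_eq]
    exact this.trans (le_of_eq (by ring))
  exact tendsto_nhds_unique h1 ((hw t).comp (Filter.tendsto_add_atTop_nat 1))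

/-- The curve that starts at `b` and moves with speed `w`. -/
def front (b : ℝ) (w : ℝ → ℝ) (t : ℝ) : ℝ := b + ∫ τ in (0 : ℝ)..t, w τ

section front

variable {b S M : ℝ} {w : ℝ → ℝ}

lemma IsSpeed.intervalIntegrable (hw : IsSpeed S M w) (a c : ℝ) :
    IntervalIntegrable w volume a c := hw.density.integrable.intervalIntegrable

lemma IsSpeed.front_sub (hw : IsSpeed S M w) (b t₁ t₂ : ℝ) :
    front b w t₁ - front b w t₂ = ∫ τ in t₂..t₁, w τ := by
  have := intervalIntegral.integral_interval_sub_left (hw.intervalIntegrable 0 t₁)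
    (hw.intervalIntegrable 0 t₂)
  rw [front, front, ← this]; ring

lemma IsSpeed.front_lipschitz (hw : IsSpeed S M w) (b t₁ t₂ : ℝ) :
    |front b w t₁ - front b w t₂| ≤ M * |t₁ - t₂| := by
  rw [hw.front_sub]
  rw [← Real.norm_eq_abs (∫ τ in t₂..t₁, w τ)]
  refine intervalIntegral.norm_integral_le_of_norm_le_const fun τ _ => ?_
  exact hw.density.bound τ

lemma IsSpeed.continuous_front (hw : IsSpeed S M w) (b : ℝ) : Continuous (front b w) :=
  (LipschitzWith.of_dist_le' (hw.front_lipschitz b)).continuous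

lemma IsSpeed.monotone_front (hw : IsSpeed S M w) (b : ℝ) : Monotone (front b w) := by
  intro t₁ t₂ h
  have := hw.front_sub b t₂ t₁
  have h2 : 0 ≤ ∫ τ in t₁..t₂, w τ := intervalIntegral.integral_nonneg h fun τ _ => hw.nonneg τ
  linarith

lemma front_zero (b : ℝ) (w : ℝ → ℝ) : front b w 0 = b := by simp [front]

lemma IsSpeed.front_of_nonpos (hw : IsSpeed S M w) (b : ℝ) {t : ℝ} (ht : t ≤ 0) :
    front b w t = b := by
  rw [front, intervalIntegral.integral_zero_ae, add_zero]
  refine Filter.Eventually.of_forall fun τ hτ => hw.density.supp τ fun h => ?_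
  rw [uIoc_of_ge ht] at hτ
  linarith [hτ.2, h.1]

lemma IsSpeed.le_front (hw : IsSpeed S M w) (b t : ℝ) : b ≤ front b w t := by
  rcases le_total t 0 with h | h
  · exact (hw.front_of_nonpos b h).ge
  · have := hw.monotone_front b h
    rwa [front_zero] at this

lemma IsSpeed.front_le (hw : IsSpeed S M w) (b : ℝ) {t : ℝ} (ht : 0 ≤ t) :
    |front b w t - b| ≤ M * t := by
  have := hw.front_lipschitz b t 0
  rwa [front_zero, sub_zero, abs_of_nonneg ht] at this

lemma IsSpeed.hasDerivAt_front (hw : IsSpeed S M w) (b : ℝ) {t : ℝ} (ht : t ∈ Ioo 0 S) :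
    HasDerivAt (front b w) (w t) t :=
  (intervalIntegral.integral_hasDerivAt_right (hw.intervalIntegrable 0 t)
    (hw.density.measurable.stronglyMeasurable.stronglyMeasurableAtFilter)
    (hw.density.continuousAt ht.1 ht.2)).const_add b

end front

lemma exp_neg_le_rpow {x : ℝ} (hx : 0 < x) : exp (-x) ≤ x ^ (-(1 / 4) : ℝ) := by
  rw [Real.exp_neg, Real.rpow_neg hx.le]
  refine inv_anti₀ (by positivity) ?_
  have h1 := Real.add_one_le_exp x
  rcases le_total x 1 with h | h
  · have := Real.rpow_le_one hx.le h (show (0 : ℝ) ≤ 1 / 4 by norm_num)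
    linarith
  · have := Real.rpow_le_rpow_of_exponent_le h (show (1 / 4 : ℝ) ≤ 1 by norm_num)
    rw [Real.rpow_one] at this
    linarith

lemma one_sub_exp_neg_le_rpow {x : ℝ} (hx : 0 < x) : 1 - exp (-x) ≤ x ^ (3 / 4 : ℝ) := by
  have h1 := Real.add_one_le_exp (-x)
  have h2 := Real.exp_pos (-x)
  rcases le_total x 1 with h | h
  · have := Real.rpow_le_rpow_of_exponent_ge hx h (show (3 / 4 : ℝ) ≤ 1 by norm_num)
    rw [Real.rpow_one] at this
    linarith
  · have := Real.one_le_rpow h (show (0 : ℝ) ≤ 3 / 4 by norm_num)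
    linarith

lemma pow_four_mul_rpow {m r : ℝ} (hm : 0 < m) (hr : 0 < r) (a : ℝ) :
    (m ^ 4 * r) ^ (a / 4) = m ^ a * r ^ (a / 4) := by
  rw [Real.mul_rpow (by positivity) hr.le, ← Real.rpow_natCast, ← Real.rpow_mul hm.le]
  congr 2
  push_cast
  ring

/-- Backward values of a weighted difference of speeds are weakly singular with small factor. -/
lemma weighted_sub_le {w₁ w₂ : ℝ → ℝ} {D m : ℝ} (hD : 0 ≤ D) (hm : 0 < m)
    (h : ∀ t, |w₁ t - w₂ t| ≤ D * exp (m ^ 4 * t)) (t : ℝ) {r : ℝ} (hr : 0 < r) :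
    |w₁ (t - r) - w₂ (t - r)| ≤ D * exp (m ^ 4 * t) / m * r ^ (-(1 / 4) : ℝ) := by
  have h1 := exp_neg_le_rpow (show 0 < m ^ 4 * r by positivity)
  have h2 := pow_four_mul_rpow hm hr (-1)
  rw [Real.rpow_neg_one, neg_div] at h2
  rw [h2] at h1
  refine (h (t - r)).trans ?_
  rw [show m ^ 4 * (t - r) = m ^ 4 * t + -(m ^ 4 * r) by ring, Real.exp_add]
  calc D * (exp (m ^ 4 * t) * exp (-(m ^ 4 * r)))
      ≤ D * (exp (m ^ 4 * t) * (m⁻¹ * r ^ (-(1 / 4) : ℝ))) := by gcongr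
    _ = _ := by ring

/-- Increments of a weighted difference of fronts are Hölder continuous with small factor. -/
lemma front_increment_sub_le {S M b : ℝ} {w₁ w₂ : ℝ → ℝ} (hw₁ : IsSpeed S M w₁)
    (hw₂ : IsSpeed S M w₂) {D m : ℝ} (hD : 0 ≤ D) (hm : 0 < m)
    (h : ∀ t, |w₁ t - w₂ t| ≤ D * exp (m ^ 4 * t)) (t : ℝ) {r : ℝ} (hr : 0 < r) :
    |(front b w₁ t - front b w₁ (t - r)) - (front b w₂ t - front b w₂ (t - r))| ≤
      D * exp (m ^ 4 * t) / m * r ^ (3 / 4 : ℝ) := by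
  have hm4 : 0 < m ^ 4 := by positivity
  rw [hw₁.front_sub, hw₂.front_sub,
    ← intervalIntegral.integral_sub (hw₁.intervalIntegrable _ _) (hw₂.intervalIntegrable _ _)]
  have hexp : Continuous fun τ => D * exp (m ^ 4 * τ) := by fun_prop
  have h1 : |∫ τ in (t - r)..t, (w₁ τ - w₂ τ)| ≤ ∫ τ in (t - r)..t, D * exp (m ^ 4 * τ) := by
    rw [← Real.norm_eq_abs (∫ τ in (t - r)..t, (w₁ τ - w₂ τ))]
    refine intervalIntegral.norm_integral_le_of_norm_le (by linarith)
      (Filter.Eventually.of_forall fun τ _ => ?_) (hexp.intervalIntegrable _ _)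
    exact h τ
  refine h1.trans ?_
  rw [intervalIntegral.integral_const_mul, intervalIntegral.integral_comp_mul_left (fun x => exp x) hm4.ne',
    integral_exp, smul_eq_mul]
  have h2 := one_sub_exp_neg_le_rpow (show 0 < m ^ 4 * r by positivity)
  have h3 := pow_four_mul_rpow hm hr 3
  rw [h3, show m ^ (3 : ℝ) = m ^ 3 by norm_cast] at h2
  rw [show m ^ 4 * (t - r) = m ^ 4 * t + -(m ^ 4 * r) by ring, Real.exp_add]
  calc D * ((m ^ 4)⁻¹ * (exp (m ^ 4 * t) - exp (m ^ 4 * t) * exp (-(m ^ 4 * r))))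
      = D * exp (m ^ 4 * t) * (m ^ 4)⁻¹ * (1 - exp (-(m ^ 4 * r))) := by ring
    _ ≤ D * exp (m ^ 4 * t) * (m ^ 4)⁻¹ * (m ^ 3 * r ^ (3 / 4 : ℝ)) := by gcongr
    _ = _ := by field_simp

lemma abs_density_integral_sub_le {S R C η t : ℝ} {f₁ f₂ ζ₁ ζ₂ : ℝ → ℝ} {κ : ℝ → ℝ → ℝ}
    (hf₁ : IsDensity S R f₁) (hf₂ : IsDensity S R f₂)
    (hκ : Measurable (fun p : ℝ × ℝ => κ p.1 p.2)) (hκ0 : ∀ z r, r ≤ 0 → κ z r = 0)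
    (hζ₁ : Measurable ζ₁) (hζ₂ : Measurable ζ₂) (ht : t ≤ S) (hC : 0 ≤ C) (hη : 0 ≤ η)
    (h₁ : ∀ r, 0 < r → r < t → |κ (ζ₁ r) r| ≤ C * r ^ (-(1 / 2) : ℝ))
    (h₂ : ∀ r, 0 < r → r < t → |κ (ζ₂ r) r| ≤ C * r ^ (-(1 / 2) : ℝ))
    (hdf : ∀ r, 0 < r → r < t → |f₁ (t - r) - f₂ (t - r)| ≤ η * r ^ (-(1 / 4) : ℝ))
    (hdκ : ∀ r, 0 < r → r < t → |κ (ζ₁ r) r - κ (ζ₂ r) r| ≤ C * η * r ^ (-(3 / 4) : ℝ)) :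
    |(∫ r, f₁ (t - r) * κ (ζ₁ r) r) - ∫ r, f₂ (t - r) * κ (ζ₂ r) r| ≤
      η * ((1 + R) * C * ∫ r, (Ioc 0 S).indicator (fun r : ℝ => 1 * r ^ (-(3 / 4) : ℝ)) r) := by
  have hR := hf₁.nonneg
  have hmaj : ∀ {f ζ : ℝ → ℝ}, IsDensity S R f → Measurable ζ →
      (∀ r, 0 < r → r < t → |κ (ζ r) r| ≤ C * r ^ (-(1 / 2) : ℝ)) →
      Integrable fun r => f (t - r) * κ (ζ r) r := by
    intro f ζ hf hζ hb
    refine (integrable_rpow_majorant (S := S) (C := R * C) (a := -(1 / 2)) (by norm_num)).mono' ?_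
      (Filter.Eventually.of_forall fun r => abs_density_mul_le hf hκ0 ht (hb r) hC)
    have m1 : Measurable fun r => f (t - r) := hf.measurable.comp (by fun_prop)
    have m2 : Measurable fun r => κ (ζ r) r :=
      hκ.comp (f := fun r => (ζ r, r)) (hζ.prodMk measurable_id)
    exact (m1.mul m2).aestronglyMeasurable
  rw [← integral_sub (hmaj hf₁ hζ₁ h₁) (hmaj hf₂ hζ₂ h₂), ← mul_assoc, ← integral_const_mul,
    ← Real.norm_eq_abs]
  refine norm_integral_le_of_norm_le
    ((integrable_rpow_majorant (S := S) (C := 1) (a := -(3 / 4)) (by norm_num)).const_mul _)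
    (Filter.Eventually.of_forall fun r => ?_)
  have hnn : 0 ≤ η * ((1 + R) * C) *
      (Ioc 0 S).indicator (fun r : ℝ => 1 * r ^ (-(3 / 4) : ℝ)) r :=
    mul_nonneg (by positivity) (indicator_nonneg (fun q hq => by have := hq.1; positivity) r)
  rw [Real.norm_eq_abs]
  rcases le_or_gt r 0 with hr | hr
  · simpa [hκ0 _ r hr] using hnn
  rcases le_or_gt t r with hrt | hrt
  · rw [hf₁.supp (t - r) (fun h => by linarith [h.1]), hf₂.supp (t - r) (fun h => by linarith [h.1])]
    simpa using hnn
  rw [indicator_of_mem (show r ∈ Ioc 0 S from ⟨hr, by linarith⟩)]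
  have e : f₁ (t - r) * κ (ζ₁ r) r - f₂ (t - r) * κ (ζ₂ r) r =
      (f₁ (t - r) - f₂ (t - r)) * κ (ζ₁ r) r + f₂ (t - r) * (κ (ζ₁ r) r - κ (ζ₂ r) r) := by ring
  have er : r ^ (-(1 / 4) : ℝ) * r ^ (-(1 / 2) : ℝ) = r ^ (-(3 / 4) : ℝ) := by
    rw [← Real.rpow_add hr]; norm_num
  rw [e]
  calc |(f₁ (t - r) - f₂ (t - r)) * κ (ζ₁ r) r + f₂ (t - r) * (κ (ζ₁ r) r - κ (ζ₂ r) r)|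
      ≤ |f₁ (t - r) - f₂ (t - r)| * |κ (ζ₁ r) r| +
          |f₂ (t - r)| * |κ (ζ₁ r) r - κ (ζ₂ r) r| := by
        refine (abs_add_le _ _).trans (by rw [abs_mul, abs_mul])
    _ ≤ (η * r ^ (-(1 / 4) : ℝ)) * (C * r ^ (-(1 / 2) : ℝ)) +
          R * (C * η * r ^ (-(3 / 4) : ℝ)) := by
        gcongr
        · exact hdf r hr hrt
        · exact h₁ r hr hrt
        · exact hf₂.bound _
        · exact hdκ r hr hrt
    _ = η * C * (r ^ (-(1 / 4) : ℝ) * r ^ (-(1 / 2) : ℝ)) + R * (C * η * r ^ (-(3 / 4) : ℝ)) := by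
        ring
    _ = _ := by rw [er]; ring

/-- The flux through the curve `front b w` of sources of density `w` on this curve and on its
reflection, reduced by the flux generated by the initial datum `g` and by sources `k` at `0`. -/
def frontFlux (b : ℝ) (g k w : ℝ → ℝ) (t : ℝ) : ℝ :=
  sourcePot heatKx w (front b w) (fun τ => τ) (front b w t) t +
    sourcePot heatKx w (fun τ => -front b w τ) (fun τ => τ) (front b w t) t -
    sourcePot heatKx g (fun a => a) (fun _ => 0) (front b w t) t -
    sourcePot heatKx k (fun _ => 0) (fun τ => τ) (front b w t) t

lemma continuous_heatKx (r : ℝ) : Continuous fun z => heatKx z r :=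
  continuous_iff_continuousAt.mpr fun z => (hasDerivAt_heatKx z r).continuousAt

lemma le_mul_rpow_neg {S r C a : ℝ} (hr : 0 < r) (hrS : r ≤ S) (hC : 0 ≤ C) (ha : 0 ≤ a) :
    C ≤ C * S ^ a * r ^ (-a) := by
  have hS : 0 < S := hr.trans_le hrS
  have h1 : r ^ a ≤ S ^ a := Real.rpow_le_rpow hr.le hrS ha
  have h2 : r ^ a * r ^ (-a) = 1 := by rw [← Real.rpow_add hr]; simp
  calc C = C * (r ^ a * r ^ (-a)) := by rw [h2, mul_one]
    _ ≤ C * (S ^ a * r ^ (-a)) := by gcongr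
    _ = _ := by ring

lemma abs_heatKx_le_of_le {M r z : ℝ} (hr : 0 < r) (hz : |z| ≤ M * r) :
    |heatKx z r| ≤ M * r ^ (-(1 / 2) : ℝ) := by
  refine (abs_heatKx_le_rpow z hr).trans ?_
  have hr1 : r ^ (-(3 / 2) : ℝ) * r = r ^ (-(1 / 2) : ℝ) := by
    conv_lhs => rw [← Real.rpow_one r]
    rw [← Real.rpow_mul hr.le, ← Real.rpow_add hr]; norm_num
  calc r ^ (-(3 / 2) : ℝ) * |z| ≤ r ^ (-(3 / 2) : ℝ) * (M * r) := by gcongr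
    _ = M * (r ^ (-(3 / 2) : ℝ) * r) := by ring
    _ = _ := by rw [hr1]

lemma abs_heatKx_front_le {S M b : ℝ} {w : ℝ → ℝ} (hw : IsSpeed S M w) (t : ℝ) {r : ℝ}
    (hr : 0 < r) : |heatKx (front b w t - front b w (t - r)) r| ≤ M * r ^ (-(1 / 2) : ℝ) := by
  refine abs_heatKx_le_of_le hr ((hw.front_lipschitz b _ _).trans (le_of_eq ?_))
  rw [sub_sub_cancel, abs_of_pos hr]

lemma abs_heatKx_le_of_far {S C b : ℝ} (hC0 : 0 ≤ C)
    (hC : ∀ z r, (b ≤ |z| ∨ b ≤ |r|) → |heatK z r| ≤ C ∧ |heatKx z r| ≤ C ∧ |heatKxx z r| ≤ C)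
    {z r : ℝ} (hz : b ≤ z) (hr : 0 < r) (hrS : r ≤ S) :
    |heatKx z r| ≤ C * S ^ (1 / 2 : ℝ) * r ^ (-(1 / 2) : ℝ) :=
  (hC z r (Or.inl (hz.trans (le_abs_self z)))).2.1.trans
    (le_mul_rpow_neg hr hrS hC0 (by norm_num))

lemma abs_heatKx_sub_le_of_far {C b : ℝ}
    (hC : ∀ z r, (b ≤ |z| ∨ b ≤ |r|) → |heatK z r| ≤ C ∧ |heatKx z r| ≤ C ∧ |heatKxx z r| ≤ C)
    {z₁ z₂ r : ℝ} (h₁ : b ≤ z₁) (h₂ : b ≤ z₂) :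
    |heatKx z₁ r - heatKx z₂ r| ≤ C * |z₁ - z₂| := by
  have := (convex_Ici b).norm_image_sub_le_of_norm_hasDerivWithin_le
    (f := fun z => heatKx z r) (f' := fun z => heatKxx z r) (C := C)
    (fun z _ => (hasDerivAt_heatKx z r).hasDerivWithinAt)
    (fun z hz => (hC z r (Or.inl ((mem_Ici.mp hz).trans (le_abs_self z)))).2.2)
    (mem_Ici.mpr h₂) (mem_Ici.mpr h₁)
  simpa only [Real.norm_eq_abs] using this

lemma continuousOn_frontFlux {S M B b : ℝ} (hb : 0 < b) {g k w : ℝ → ℝ} (hg : Integrable g)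
    (hk : IsDensity S B k) (hw : IsSpeed S M w) : ContinuousOn (frontFlux b g k w) (Ioc 0 S) := by
  obtain ⟨C, hC0, hC⟩ := exists_heatK_bound hb
  have hs := hw.continuous_front b
  have hbs := hw.le_front b
  rcases lt_or_ge S 0 with hS | hS
  · rw [Ioc_eq_empty (by linarith)]
    exact continuousOn_empty _
  unfold frontFlux
  simp only [sourcePot_eq_elapsed _ _ (front b w), sourcePot_eq_elapsed _ _ (fun τ => -front b w τ),
    sourcePot_eq_elapsed _ _ (fun _ => 0) _]
  refine ((ContinuousOn.add ?_ ?_).sub ?_).sub ?_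
  · exact continuousOn_density_integral (C := M) (θ := fun t => t)
      (ζ := fun t r => front b w t - front b w (t - r)) hw.density measurable_heatKx
      (fun z r => heatKx_of_nonpos z) continuous_heatKx (by fun_prop) (fun t ht => ht.2)
      (fun r => by fun_prop) (fun t _ => by fun_prop) hw.density.nonneg
      (fun t _ r hr _ => abs_heatKx_front_le hw t hr)
  · refine continuousOn_density_integral (C := C * S ^ (1 / 2 : ℝ)) (θ := fun t => t)
      (ζ := fun t r => front b w t - -front b w (t - r)) hw.density measurable_heatKx
      (fun z r => heatKx_of_nonpos z) continuous_heatKx (by fun_prop) (fun t ht => ht.2)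
      (fun r => by fun_prop) (fun t _ => by fun_prop) (by positivity) ?_
    intro t ht r hr hrt
    exact abs_heatKx_le_of_far hC0 hC (by linarith [hbs t, hbs (t - r)]) hr (by linarith [ht.2])
  · refine (continuousOn_sourcePot_heatKx_initial hg measurable_id).comp
      (f := fun t => (front b w t, t)) (by fun_prop) fun t ht => ht.1
  · refine continuousOn_density_integral (C := C * S ^ (1 / 2 : ℝ)) (θ := fun t => t)
      (ζ := fun t r => front b w t - 0) hk measurable_heatKx
      (fun z r => heatKx_of_nonpos z) continuous_heatKx (by fun_prop) (fun t ht => ht.2)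
      (fun r => by fun_prop) (fun t _ => by fun_prop) (by positivity) ?_
    intro t ht r hr hrt
    exact abs_heatKx_le_of_far hC0 hC (by linarith [hbs t]) hr (by linarith [ht.2])

set_option maxHeartbeats 1000000 in
/-- The flux depends on the speed in a contractive way, in exponentially weighted norms. -/
lemma exists_frontFlux_sub_le {S M B H b : ℝ} (hb : 0 < b) {g k : ℝ → ℝ} (hg : Integrable g)
    (hgb : ∀ x, |g x| ≤ H * |x - b|) (hk : IsDensity S B k) (hM : 0 ≤ M) :
    ∃ K, 0 ≤ K ∧ ∀ w₁ w₂ D m, IsSpeed S M w₁ → IsSpeed S M w₂ → 0 ≤ D → 0 < m →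
      (∀ t, |w₁ t - w₂ t| ≤ D * exp (m ^ 4 * t)) → ∀ t ∈ Ioc 0 S,
        |frontFlux b g k w₁ t - frontFlux b g k w₂ t| ≤ D * exp (m ^ 4 * t) / m * K := by
  obtain ⟨C, hC0, hC⟩ := exists_heatK_bound hb
  obtain ⟨C₁, hC₁0, hC₁⟩ := exists_lipschitz_sourcePot_heatKx_initial (S := S) hg hM hgb
  set J : ℝ := ∫ r, (Ioc 0 S).indicator (fun r : ℝ => 1 * r ^ (-(3 / 4) : ℝ)) r
  have hJ : 0 ≤ J := integral_nonneg fun r =>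
    indicator_nonneg (fun q hq => by have := hq.1; positivity) r
  have hB := hk.nonneg
  rcases lt_or_ge S 0 with hS | hS
  · exact ⟨0, le_rfl, fun _ _ _ _ _ _ _ _ _ t ht => by linarith [ht.1, ht.2]⟩
  set C₂ : ℝ := C * S ^ (1 / 2 : ℝ) + C * (2 * S ^ (3 / 4 : ℝ)) * S ^ (3 / 4 : ℝ) with hC₂
  have hC₂0 : 0 ≤ C₂ := by positivity
  refine ⟨(1 + M) * (M + 1) * J + (1 + M) * C₂ * J + C₁ * S ^ (1 / 4 : ℝ) + (1 + B) * C₂ * J,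
    by positivity, ?_⟩
  intro w₁ w₂ D m hw₁ hw₂ hD hm h t ht
  set η := D * exp (m ^ 4 * t) / m with hη
  have hη0 : 0 ≤ η := by positivity
  have hs₁ := hw₁.continuous_front b
  have hs₂ := hw₂.continuous_front b
  have hb₁ := hw₁.le_front b
  have hb₂ := hw₂.le_front b
  have hdw : ∀ r, 0 < r → r < t → |w₁ (t - r) - w₂ (t - r)| ≤ η * r ^ (-(1 / 4) : ℝ) :=
    fun r hr _ => weighted_sub_le hD hm h t hr
  have hinc := fun r (hr : 0 < r) => front_increment_sub_le (b := b) hw₁ hw₂ hD hm h t hr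
  have hst : |front b w₁ t - front b w₂ t| ≤ η * t ^ (3 / 4 : ℝ) := by
    have := hinc t ht.1
    rwa [sub_self, front_zero, front_zero, sub_sub_sub_cancel_right] at this
  have hS1 : ∀ r, 0 < r → r ≤ S → r ^ (3 / 4 : ℝ) ≤ S ^ (3 / 4 : ℝ) := fun r hr hrS =>
    Real.rpow_le_rpow hr.le hrS (by norm_num)
  have hstS : |front b w₁ t - front b w₂ t| ≤ η * S ^ (3 / 4 : ℝ) :=
    hst.trans (mul_le_mul_of_nonneg_left (hS1 t ht.1 ht.2) hη0)
  have hst2 : ∀ r, 0 < r → r < t → |front b w₁ (t - r) - front b w₂ (t - r)| ≤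
      2 * (η * S ^ (3 / 4 : ℝ)) - |front b w₁ t - front b w₂ t| := by
    intro r hr hrt
    have hq : 0 < t - r := by linarith
    have h1 := front_increment_sub_le (b := b) hw₁ hw₂ hD hm h (t - r) hq
    rw [sub_self, front_zero, front_zero, sub_sub_sub_cancel_right] at h1
    have h2 : D * exp (m ^ 4 * (t - r)) / m ≤ η := by
      rw [hη]
      gcongr
      linarith
    have h3 : |front b w₁ (t - r) - front b w₂ (t - r)| ≤ η * S ^ (3 / 4 : ℝ) :=
      h1.trans (mul_le_mul h2 (hS1 _ hq (by linarith [ht.2])) (by positivity) hη0)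
    linarith
  have hfar : ∀ {z r : ℝ}, b ≤ z → 0 < r → r < t → |heatKx z r| ≤ C₂ * r ^ (-(1 / 2) : ℝ) := by
    intro z r hz hr hrt
    refine (abs_heatKx_le_of_far hC0 hC hz hr (by linarith [ht.2] : r ≤ S)).trans ?_
    gcongr
    exact le_add_of_nonneg_right (by positivity)
  have hfard : ∀ {z₁ z₂ r : ℝ}, b ≤ z₁ → b ≤ z₂ → 0 < r → r < t →
      |z₁ - z₂| ≤ 2 * (η * S ^ (3 / 4 : ℝ)) →
      |heatKx z₁ r - heatKx z₂ r| ≤ C₂ * η * r ^ (-(3 / 4) : ℝ) := by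
    intro z₁ z₂ r h₁ h₂ hr hrt hz
    refine (abs_heatKx_sub_le_of_far hC h₁ h₂).trans ?_
    calc C * |z₁ - z₂| ≤ C * (2 * (η * S ^ (3 / 4 : ℝ))) := by gcongr
      _ ≤ C * (2 * (η * S ^ (3 / 4 : ℝ))) * S ^ (3 / 4 : ℝ) * r ^ (-(3 / 4) : ℝ) :=
        le_mul_rpow_neg hr (by linarith [ht.2]) (by positivity) (by norm_num)
      _ = C * (2 * S ^ (3 / 4 : ℝ)) * S ^ (3 / 4 : ℝ) * η * r ^ (-(3 / 4) : ℝ) := by ring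
      _ ≤ C₂ * η * r ^ (-(3 / 4) : ℝ) := by
        gcongr
        exact le_add_of_nonneg_left (by positivity)
  have T1 := abs_density_integral_sub_le (C := M + 1) (η := η) (t := t)
    (ζ₁ := fun r => front b w₁ t - front b w₁ (t - r))
    (ζ₂ := fun r => front b w₂ t - front b w₂ (t - r)) hw₁.density hw₂.density measurable_heatKx
    (fun z r => heatKx_of_nonpos z) (by fun_prop) (by fun_prop) ht.2 (by positivity) hη0
    (fun r hr _ => (abs_heatKx_front_le hw₁ t hr).trans (by gcongr; linarith))
    (fun r hr _ => (abs_heatKx_front_le hw₂ t hr).trans (by gcongr; linarith)) hdw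
    (by
      intro r hr _
      refine (abs_heatKx_sub_le _ _ hr).trans ?_
      have e : r ^ (-(3 / 2) : ℝ) * r ^ (3 / 4 : ℝ) = r ^ (-(3 / 4) : ℝ) := by
        rw [← Real.rpow_add hr]; norm_num
      calc _ ≤ r ^ (-(3 / 2) : ℝ) * (η * r ^ (3 / 4 : ℝ)) := by
            gcongr
            exact hinc r hr
        _ = 1 * η * (r ^ (-(3 / 2) : ℝ) * r ^ (3 / 4 : ℝ)) := by ring
        _ ≤ (M + 1) * η * (r ^ (-(3 / 2) : ℝ) * r ^ (3 / 4 : ℝ)) := by gcongr; linarith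
        _ = _ := by rw [e])
  have T2 := abs_density_integral_sub_le (C := C₂) (η := η) (t := t)
    (ζ₁ := fun r => front b w₁ t - -front b w₁ (t - r))
    (ζ₂ := fun r => front b w₂ t - -front b w₂ (t - r)) hw₁.density hw₂.density measurable_heatKx
    (fun z r => heatKx_of_nonpos z) (by fun_prop) (by fun_prop) ht.2 hC₂0 hη0
    (fun r hr hrt => hfar (by linarith [hb₁ t, hb₁ (t - r)]) hr hrt)
    (fun r hr hrt => hfar (by linarith [hb₂ t, hb₂ (t - r)]) hr hrt) hdw
    (by
      intro r hr hrt
      refine hfard (by linarith [hb₁ t, hb₁ (t - r)]) (by linarith [hb₂ t, hb₂ (t - r)]) hr hrt ?_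
      have e : front b w₁ t - -front b w₁ (t - r) - (front b w₂ t - -front b w₂ (t - r)) =
        (front b w₁ t - front b w₂ t) + (front b w₁ (t - r) - front b w₂ (t - r)) := by ring
      rw [e]
      refine (abs_add_le _ _).trans ?_
      linarith [hst2 r hr hrt])
  have T4 := abs_density_integral_sub_le (C := C₂) (η := η) (t := t)
    (ζ₁ := fun r => front b w₁ t - 0)
    (ζ₂ := fun r => front b w₂ t - 0) hk hk measurable_heatKx
    (fun z r => heatKx_of_nonpos z) (by fun_prop) (by fun_prop) ht.2 hC₂0 hη0
    (fun r hr hrt => hfar (by linarith [hb₁ t]) hr hrt)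
    (fun r hr hrt => hfar (by linarith [hb₂ t]) hr hrt)
    (fun r hr _ => by rw [sub_self, abs_zero]; positivity)
    (by
      intro r hr hrt
      refine hfard (by linarith [hb₁ t]) (by linarith [hb₂ t]) hr hrt ?_
      rw [sub_sub_sub_cancel_right]
      have : 0 ≤ η * S ^ (3 / 4 : ℝ) := by positivity
      linarith)
  have T3 := hC₁ (front b w₁ t) (front b w₂ t) t ht.1 ht.2 (hw₁.front_le b ht.1.le)
    (hw₂.front_le b ht.1.le)
  have T3' : C₁ * t ^ (-(1 / 2) : ℝ) * |front b w₁ t - front b w₂ t| ≤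
      η * (C₁ * S ^ (1 / 4 : ℝ)) := by
    have e : t ^ (-(1 / 2) : ℝ) * t ^ (3 / 4 : ℝ) = t ^ (1 / 4 : ℝ) := by
      rw [← Real.rpow_add ht.1]; norm_num
    have hpos := ht.1
    calc _ ≤ C₁ * t ^ (-(1 / 2) : ℝ) * (η * t ^ (3 / 4 : ℝ)) := by gcongr
      _ = η * (C₁ * (t ^ (-(1 / 2) : ℝ) * t ^ (3 / 4 : ℝ))) := by ring
      _ ≤ _ := by
        rw [e]
        gcongr
        exact ht.2
  unfold frontFlux
  simp only [sourcePot_eq_elapsed _ _ (front b _), sourcePot_eq_elapsed _ _ (fun τ => -front b _ τ),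
    sourcePot_eq_elapsed _ _ (fun _ => 0) _]
  have hsum : ∀ a₁ a₂ b₁ b₂ c₁ c₂ d₁ d₂ : ℝ, |a₁ + b₁ - c₁ - d₁ - (a₂ + b₂ - c₂ - d₂)| ≤
      |a₁ - a₂| + |b₁ - b₂| + |c₁ - c₂| + |d₁ - d₂| := by
    intro a₁ a₂ b₁ b₂ c₁ c₂ d₁ d₂
    rw [show a₁ + b₁ - c₁ - d₁ - (a₂ + b₂ - c₂ - d₂) =
      (a₁ - a₂) + (b₁ - b₂) - (c₁ - c₂) - (d₁ - d₂) by ring]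
    refine (abs_sub _ _).trans (add_le_add_left ((abs_sub _ _).trans ?_) _)
    exact add_le_add_left (abs_add_le _ _) _
  refine (hsum _ _ _ _ _ _ _ _).trans
    ((add_le_add (add_le_add (add_le_add T1 T2) (T3.trans T3')) T4).trans (le_of_eq ?_))
  ring

/-- The update map for the speed of the free boundary, truncated to `[0, M]`. -/
def speedMap (b S M : ℝ) (g k w : ℝ → ℝ) : ℝ → ℝ :=
  (Ioc 0 S).indicator fun t => max 0 (min M (2 * frontFlux b g k w t))

lemma isSpeed_speedMap {S M B b : ℝ} (hM : 0 ≤ M) (hb : 0 < b) {g k w : ℝ → ℝ} (hg : Integrable g)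
    (hk : IsDensity S B k) (hw : IsSpeed S M w) : IsSpeed S M (speedMap b S M g k w) := by
  have hc : ContinuousOn (fun t => max 0 (min M (2 * frontFlux b g k w t))) (Ioc 0 S) := by
    have := continuousOn_frontFlux hb hg hk hw
    fun_prop
  have h0 : ∀ t, 0 ≤ speedMap b S M g k w t := fun t =>
    indicator_nonneg (fun _ _ => le_max_left _ _) t
  refine ⟨⟨?_, fun t => ?_, fun t ht => indicator_of_notMem ht _, ?_⟩, h0⟩
  · rw [speedMap, ← piecewise_eq_indicator]
    exact hc.measurable_piecewise continuousOn_const measurableSet_Ioc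
  · rw [abs_of_nonneg (h0 t)]
    by_cases ht : t ∈ Ioc 0 S
    · rw [speedMap, indicator_of_mem ht]
      exact max_le hM (min_le_left _ _)
    · rw [speedMap, indicator_of_notMem ht]
      exact hM
  · exact hc.congr fun t ht => indicator_of_mem ht _

lemma exists_speedMap_fixedPoint {S M B H b : ℝ} (hb : 0 < b) {g k : ℝ → ℝ} (hg : Integrable g)
    (hgb : ∀ x, |g x| ≤ H * |x - b|) (hk : IsDensity S B k) (hM : 0 ≤ M) :
    ∃ w, IsSpeed S M w ∧ speedMap b S M g k w = w := by
  obtain ⟨K, hK0, hK⟩ := exists_frontFlux_sub_le (S := S) hb hg hgb hk hM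
  have hm : 0 < 4 * K + 1 := by positivity
  refine exists_speed_fixedPoint (l := (4 * K + 1) ^ 4) hM (by positivity)
    (fun w hw => isSpeed_speedMap hM hb hg hk hw) ?_
  intro w₁ w₂ D hw₁ hw₂ hD h t
  by_cases ht : t ∈ Ioc 0 S
  · simp only [speedMap, indicator_of_mem ht]
    have h1 := hK w₁ w₂ D _ hw₁ hw₂ hD hm h t ht
    have h2 : ∀ x y : ℝ, |max 0 (min M x) - max 0 (min M y)| ≤ |x - y| := by
      intro x y
      have e1 := abs_max_sub_max_le_abs (min M x) (min M y) 0
      have e2 := abs_min_sub_min_le_max M x M y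
      rw [sub_self, abs_zero, max_eq_right (abs_nonneg _)] at e2
      rw [max_comm 0, max_comm 0]
      exact e1.trans e2
    refine (h2 _ _).trans ?_
    rw [← mul_sub, abs_mul, abs_two]
    refine (mul_le_mul_of_nonneg_left h1 zero_le_two).trans ?_
    have h3 : 2 * (K / (4 * K + 1)) ≤ 1 / 2 := by
      rw [← mul_div_assoc, div_le_div_iff₀ hm two_pos]; linarith
    have h4 : 0 ≤ D * exp ((4 * K + 1) ^ 4 * t) := by positivity
    calc 2 * (D * exp ((4 * K + 1) ^ 4 * t) / (4 * K + 1) * K)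
        = D * exp ((4 * K + 1) ^ 4 * t) * (2 * (K / (4 * K + 1))) := by ring
      _ ≤ D * exp ((4 * K + 1) ^ 4 * t) * (1 / 2) := mul_le_mul_of_nonneg_left h3 h4
      _ = _ := by ring
  · simp only [speedMap, indicator_of_notMem ht, sub_self, abs_zero]
    positivity

lemma nonneg_of_hasDerivAt_isLocalMin {f f' : ℝ → ℝ} {x c : ℝ}
    (hf : ∀ᶠ y in nhds x, HasDerivAt f (f' y) y) (hf' : HasDerivAt f' c x)
    (hmin : IsLocalMin f x) : 0 ≤ c := by
  by_contra! hc
  have hd : deriv f =ᶠ[nhds x] f' := hf.mono fun y hy => hy.deriv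
  have h2 : deriv (deriv f) x = c := by rw [hd.deriv_eq, hf'.deriv]
  have hmax := isLocalMax_of_deriv_deriv_neg (by rw [h2]; exact hc) hmin.deriv_eq_zero
    hf.self_of_nhds.continuousAt
  have heq : f =ᶠ[nhds x] fun _ => f x := by
    filter_upwards [hmin, hmax] with y h1 h2 using le_antisymm h2 h1
  have h3 : deriv (deriv f) x = 0 := by
    rw [heq.deriv.deriv_eq]; simp
  linarith

lemma nonneg_of_hasDerivWithinAt_Ici {f : ℝ → ℝ} {x a : ℝ}
    (hf : HasDerivWithinAt f a (Ici x) x) (h : ∀ᶠ y in nhdsWithin x (Ioi x), f x ≤ f y) :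
    0 ≤ a := by
  have h1 := (hasDerivWithinAt_iff_tendsto_slope' (by simp)).mp hf.Ioi_of_Ici
  refine ge_of_tendsto h1 ?_
  filter_upwards [h, eventually_mem_nhdsWithin] with y hy hxy
  rw [slope_def_field]
  exact div_nonneg (by linarith) (sub_nonneg.mpr (le_of_lt hxy))

lemma nonpos_of_hasDerivWithinAt_Iic {f : ℝ → ℝ} {x a : ℝ}
    (hf : HasDerivWithinAt f a (Iic x) x) (h : ∀ᶠ y in nhdsWithin x (Iio x), f x ≤ f y) :
    a ≤ 0 := by
  have h1 := (hasDerivWithinAt_iff_tendsto_slope' (by simp)).mp hf.Iio_of_Iic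
  refine le_of_tendsto h1 ?_
  filter_upwards [h, eventually_mem_nhdsWithin] with y hy hxy
  rw [slope_def_field]
  exact div_nonpos_of_nonneg_of_nonpos (by linarith) (sub_nonpos.mpr (le_of_lt hxy))

/-- `v_t - v_xx = d` at the point `(x, t)`. -/
def HasHeatDefect (v : ℝ → ℝ → ℝ) (d x t : ℝ) : Prop :=
  ∃ (p : ℝ → ℝ) (q r : ℝ), (∀ᶠ y in nhds x, HasDerivAt (fun y => v y t) (p y) y) ∧
    HasDerivAt p q x ∧ HasDerivAt (fun τ => v x τ) r t ∧ r - q = d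

lemma HasHeatDefect.add {v₁ v₂ : ℝ → ℝ → ℝ} {d₁ d₂ x t : ℝ} (h₁ : HasHeatDefect v₁ d₁ x t)
    (h₂ : HasHeatDefect v₂ d₂ x t) :
    HasHeatDefect (fun x t => v₁ x t + v₂ x t) (d₁ + d₂) x t := by
  obtain ⟨p₁, q₁, r₁, a₁, b₁, c₁, rfl⟩ := h₁
  obtain ⟨p₂, q₂, r₂, a₂, b₂, c₂, rfl⟩ := h₂
  refine ⟨fun y => p₁ y + p₂ y, q₁ + q₂, r₁ + r₂, ?_, b₁.add b₂, c₁.add c₂, by ring⟩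
  filter_upwards [a₁, a₂] with y h1 h2 using h1.add h2

lemma HasHeatDefect.const_mul {v : ℝ → ℝ → ℝ} {d x t : ℝ} (h : HasHeatDefect v d x t) (c : ℝ) :
    HasHeatDefect (fun x t => c * v x t) (c * d) x t := by
  obtain ⟨p, q, r, a₁, b₁, c₁, rfl⟩ := h
  refine ⟨fun y => c * p y, c * q, c * r, ?_, b₁.const_mul c, c₁.const_mul c, by ring⟩
  filter_upwards [a₁] with y h1 using h1.const_mul c

/-- Minimum principle for strict supersolutions of the heat equation which are smooth off a curve
and have no minimum on that curve. -/
lemma nonneg_of_strict_supersolution {X T : ℝ} {s : ℝ → ℝ} {Z : ℝ → ℝ → ℝ}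
    (hc : ContinuousOn (fun p : ℝ × ℝ => Z p.1 p.2) (Icc 0 X ×ˢ Icc 0 T))
    (hinit : ∀ x ∈ Icc 0 X, 0 ≤ Z x 0) (hend : ∀ t ∈ Icc 0 T, 0 ≤ Z X t)
    (hflux : ∀ t ∈ Ioc 0 T, ∃ a < 0, HasDerivWithinAt (fun y => Z y t) a (Ici 0) 0)
    (hheat : ∀ t ∈ Ioc 0 T, ∀ x ∈ Ioo 0 X, x ≠ s t → ∃ d > 0, HasHeatDefect Z d x t)
    (hs : ∀ t ∈ Ioc 0 T, ∃ a c, HasDerivWithinAt (fun y => Z y t) a (Iic (s t)) (s t) ∧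
      HasDerivWithinAt (fun y => Z y t) c (Ici (s t)) (s t) ∧ (0 ≤ c → 0 < a)) :
    ∀ x ∈ Icc 0 X, ∀ t ∈ Icc 0 T, 0 ≤ Z x t := by
  intro x hx t ht
  obtain ⟨⟨x₀, t₀⟩, hm, hmin⟩ := (isCompact_Icc.prod isCompact_Icc).exists_isMinOn
    ⟨(x, t), ⟨hx, ht⟩⟩ hc
  have hmin' : ∀ y ∈ Icc 0 X, ∀ τ ∈ Icc 0 T, Z x₀ t₀ ≤ Z y τ := fun y hy τ hτ =>
    hmin (show (y, τ) ∈ Icc 0 X ×ˢ Icc 0 T from ⟨hy, hτ⟩)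
  obtain ⟨hx₀, ht₀⟩ : x₀ ∈ Icc 0 X ∧ t₀ ∈ Icc 0 T := hm
  by_contra! hneg
  have hneg₀ : Z x₀ t₀ < 0 := (hmin' x hx t ht).trans_lt hneg
  have ht₀pos : 0 < t₀ := by
    rcases ht₀.1.eq_or_lt with h | h
    · rw [← h] at hneg₀
      linarith [hinit x₀ hx₀]
    · exact h
  have hx₀X : x₀ < X := by
    rcases hx₀.2.eq_or_lt with h | h
    · rw [h] at hneg₀
      linarith [hend t₀ ht₀]
    · exact h
  have ht₀' : t₀ ∈ Ioc 0 T := ⟨ht₀pos, ht₀.2⟩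
  have hright : ∀ᶠ y in nhdsWithin x₀ (Ioi x₀), Z x₀ t₀ ≤ Z y t₀ := by
    filter_upwards [Ioo_mem_nhdsGT hx₀X] with y hy
    exact hmin' y ⟨hx₀.1.trans hy.1.le, hy.2.le⟩ t₀ ht₀
  rcases hx₀.1.eq_or_lt with h0 | h0
  · obtain ⟨a, ha, hd⟩ := hflux t₀ ht₀'
    rw [h0] at hd
    linarith [nonneg_of_hasDerivWithinAt_Ici hd hright]
  have hleft : ∀ᶠ y in nhdsWithin x₀ (Iio x₀), Z x₀ t₀ ≤ Z y t₀ := by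
    filter_upwards [Ioo_mem_nhdsLT h0] with y hy
    exact hmin' y ⟨hy.1.le, (hy.2.trans hx₀X).le⟩ t₀ ht₀
  by_cases hxs : x₀ = s t₀
  · obtain ⟨a, c, hda, hdc, hac⟩ := hs t₀ ht₀'
    rw [← hxs] at hda hdc
    linarith [nonpos_of_hasDerivWithinAt_Iic hda hleft,
      hac (nonneg_of_hasDerivWithinAt_Ici hdc hright)]
  · obtain ⟨d, hd, p, q, r, h1, h2, h3, h4⟩ := hheat t₀ ht₀' x₀ ⟨h0, hx₀X⟩ hxs
    have hloc : IsLocalMin (fun y => Z y t₀) x₀ := by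
      filter_upwards [Icc_mem_nhds h0 hx₀X] with y hy using hmin' y hy t₀ ht₀
    have hq := nonneg_of_hasDerivAt_isLocalMin h1 h2 hloc
    have hr : r ≤ 0 := by
      refine nonpos_of_hasDerivWithinAt_Iic h3.hasDerivWithinAt ?_
      filter_upwards [Ioo_mem_nhdsLT ht₀pos] with τ hτ
      exact hmin' x₀ hx₀ τ ⟨hτ.1.le, hτ.2.le.trans ht₀.2⟩
    linarith

/-- The spatial profile of the barrier. -/
def barrierProfile (y : ℝ) : ℝ := 1 - max y 0 + max y 0 ^ 2

lemma barrierProfile_of_nonpos {y : ℝ} (hy : y ≤ 0) : barrierProfile y = 1 := by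
  simp [barrierProfile, hy]

lemma barrierProfile_of_nonneg {y : ℝ} (hy : 0 ≤ y) : barrierProfile y = 1 - y + y ^ 2 := by
  simp [barrierProfile, hy]

lemma le_barrierProfile (y : ℝ) : y ≤ barrierProfile y := by
  rw [barrierProfile]
  nlinarith [le_max_left y 0, sq_nonneg (max y 0 - 1)]

lemma barrierProfile_pos (y : ℝ) : 0 < barrierProfile y := by
  rw [barrierProfile]
  nlinarith [sq_nonneg (2 * max y 0 - 1)]

/-- A barrier which grows at infinity and has a concave kink at the curve `s`. -/
def barrier (C : ℝ) (s : ℝ → ℝ) (x t : ℝ) : ℝ := exp (C * t) * barrierProfile (x - s t)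

lemma continuous_barrier (C : ℝ) {s : ℝ → ℝ} (hs : Continuous s) :
    Continuous fun p : ℝ × ℝ => barrier C s p.1 p.2 := by
  unfold barrier barrierProfile
  fun_prop

lemma hasHeatDefect_barrier_of_lt {C x t σ : ℝ} {s : ℝ → ℝ} (hs : HasDerivAt s σ t)
    (hx : x < s t) : HasHeatDefect (barrier C s) (C * exp (C * t)) x t := by
  refine ⟨fun _ => 0, 0, C * exp (C * t), ?_, hasDerivAt_const _ _, ?_, by ring⟩
  · filter_upwards [Iio_mem_nhds hx] with y hy
    refine (hasDerivAt_const y (exp (C * t) * 1)).congr_of_eventuallyEq ?_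
    filter_upwards [Iio_mem_nhds hy] with z hz
    rw [barrier, barrierProfile_of_nonpos (sub_nonpos.mpr (le_of_lt hz))]
  · have h1 : HasDerivAt (fun τ => exp (C * τ) * 1) (C * exp (C * t)) t := by
      refine (((hasDerivAt_id' t).const_mul C).exp.mul_const 1).congr_deriv ?_
      ring
    refine h1.congr_of_eventuallyEq ?_
    filter_upwards [hs.continuousAt.eventually (Ioi_mem_nhds hx)] with τ hτ
    rw [barrier, barrierProfile_of_nonpos (sub_nonpos.mpr (le_of_lt hτ))]

lemma hasHeatDefect_barrier_of_gt {C x t σ : ℝ} {s : ℝ → ℝ} (hs : HasDerivAt s σ t)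
    (hx : s t < x) : HasHeatDefect (barrier C s) (exp (C * t) *
      (C * (1 - (x - s t) + (x - s t) ^ 2) - σ * (2 * (x - s t) - 1) - 2)) x t := by
  refine ⟨fun y => exp (C * t) * (2 * (y - s t) - 1), exp (C * t) * 2,
    exp (C * t) * (C * (1 - (x - s t) + (x - s t) ^ 2) - σ * (2 * (x - s t) - 1)), ?_, ?_, ?_,
    by ring⟩
  · filter_upwards [Ioi_mem_nhds hx] with y hy
    have h1 : HasDerivAt (fun z => exp (C * t) * (1 - (z - s t) + (z - s t) ^ 2))
        (exp (C * t) * (2 * (y - s t) - 1)) y := by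
      have h2 := (hasDerivAt_id' y).sub_const (s t)
      refine (((h2.const_sub 1).add (h2.pow 2)).const_mul (exp (C * t))).congr_deriv ?_
      norm_num
      ring
    refine h1.congr_of_eventuallyEq ?_
    filter_upwards [Ioi_mem_nhds hy] with z hz
    rw [barrier, barrierProfile_of_nonneg (sub_nonneg.mpr (le_of_lt hz))]
  · have h2 := (hasDerivAt_id' x).sub_const (s t)
    refine (((h2.const_mul 2).sub_const 1).const_mul (exp (C * t))).congr_deriv ?_
    norm_num
  · have h1 : HasDerivAt (fun τ => exp (C * τ) * (1 - (x - s τ) + (x - s τ) ^ 2))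
        (exp (C * t) * (C * (1 - (x - s t) + (x - s t) ^ 2) - σ * (2 * (x - s t) - 1))) t := by
      have h2 := hs.const_sub x
      refine (((hasDerivAt_id' t).const_mul C).exp.mul ((h2.const_sub 1).add (h2.pow 2))).congr_deriv ?_
      simp
      ring
    refine h1.congr_of_eventuallyEq ?_
    filter_upwards [hs.continuousAt.eventually (Iio_mem_nhds hx)] with τ hτ
    rw [barrier, barrierProfile_of_nonneg (sub_nonneg.mpr (le_of_lt hτ))]

lemma hasDerivWithinAt_barrier_left (C : ℝ) (s : ℝ → ℝ) (t : ℝ) :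
    HasDerivWithinAt (fun y => barrier C s y t) 0 (Iic (s t)) (s t) := by
  refine (hasDerivWithinAt_const _ _ (exp (C * t) * 1)).congr_of_mem (fun y hy => ?_) self_mem_Iic
  rw [barrier, barrierProfile_of_nonpos (sub_nonpos.mpr hy)]

lemma hasDerivWithinAt_barrier_right (C : ℝ) (s : ℝ → ℝ) (t : ℝ) :
    HasDerivWithinAt (fun y => barrier C s y t) (-exp (C * t)) (Ici (s t)) (s t) := by
  have h1 : HasDerivAt (fun z => exp (C * t) * (1 - (z - s t) + (z - s t) ^ 2))
      (-exp (C * t)) (s t) := by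
    have h2 := (hasDerivAt_id' (s t)).sub_const (s t)
    refine (((h2.const_sub 1).add (h2.pow 2)).const_mul (exp (C * t))).congr_deriv ?_
    norm_num
  refine h1.hasDerivWithinAt.congr_of_mem (fun y hy => ?_) self_mem_Ici
  rw [barrier, barrierProfile_of_nonneg (sub_nonneg.mpr hy)]

lemma exists_hasHeatDefect_barrier {M x t σ : ℝ} {s : ℝ → ℝ} (hs : HasDerivAt s σ t)
    (h0 : 0 ≤ σ) (hM : σ ≤ M) (hx : x ≠ s t) :
    ∃ d > 0, HasHeatDefect (barrier (2 * M + 3) s) d x t := by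
  rcases lt_or_gt_of_ne hx with h | h
  · exact ⟨_, mul_pos (by linarith) (exp_pos _), hasHeatDefect_barrier_of_lt hs h⟩
  · refine ⟨_, mul_pos (exp_pos _) ?_, hasHeatDefect_barrier_of_gt hs h⟩
    set y := x - s t
    have h1 : 2 * y - 1 ≤ 2 * (1 - y + y ^ 2) - 1 := by nlinarith [sq_nonneg (y - 1)]
    have h2 : σ * (2 * y - 1) ≤ σ * (2 * (1 - y + y ^ 2) - 1) := mul_le_mul_of_nonneg_left h1 h0
    have h3 : 0 ≤ (M - σ) * (1 - y + y ^ 2) :=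
      mul_nonneg (by linarith) (by nlinarith [sq_nonneg (2 * y - 1)])
    nlinarith [sq_nonneg (2 * y - 1)]

/-- Comparison principle for the transmission problem with free boundary `s`. -/
lemma nonneg_of_supersolution {b T M B : ℝ} {s σ : ℝ → ℝ} {v : ℝ → ℝ → ℝ} (hb : 0 < b)
    (hsc : Continuous s) (hsb : ∀ t, b ≤ s t) (hs : ∀ t ∈ Ioc 0 T, HasDerivAt s (σ t) t)
    (hσ : ∀ t ∈ Ioc 0 T, 0 ≤ σ t ∧ σ t ≤ M) (hM : 0 ≤ M)
    (hc : ContinuousOn (fun p : ℝ × ℝ => v p.1 p.2) (Ici 0 ×ˢ Icc 0 T))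
    (hB : ∀ x t, t ∈ Icc 0 T → -B ≤ v x t) (hinit : ∀ x, 0 ≤ x → 0 ≤ v x 0)
    (hflux : ∀ t ∈ Ioc 0 T, ∃ a < 0, HasDerivWithinAt (fun y => v y t) a (Ici 0) 0)
    (hheat : ∀ t ∈ Ioc 0 T, ∀ x, 0 < x → x ≠ s t → ∃ d ≥ 0, HasHeatDefect v d x t)
    (hjump : ∀ t ∈ Ioc 0 T, ∃ a c, HasDerivWithinAt (fun y => v y t) a (Iic (s t)) (s t) ∧
      HasDerivWithinAt (fun y => v y t) c (Ici (s t)) (s t) ∧ (0 < c → 0 < a))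
    {x t : ℝ} (hx : 0 ≤ x) (ht : t ∈ Icc 0 T) : 0 ≤ v x t := by
  set φ := barrier (2 * M + 3) s with hφ
  have hφpos : ∀ x t, 0 < φ x t := fun x t => mul_pos (exp_pos _) (barrierProfile_pos _)
  have key : ∀ ε > 0, 0 ≤ v x t + ε * φ x t := by
    intro ε hε
    obtain ⟨L, hL⟩ := isCompact_Icc.bddAbove_image (hsc.continuousOn (s := Icc 0 T))
    have hL' : ∀ τ ∈ Icc 0 T, s τ ≤ L := fun τ hτ => hL (mem_image_of_mem s hτ)
    set X := max x (L + B / ε) with hX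
    refine nonneg_of_strict_supersolution (X := X) (T := T) (s := s)
      (Z := fun x t => v x t + ε * φ x t) ?_ ?_ ?_ ?_ ?_ ?_ x ⟨hx, le_max_left _ _⟩ t ht
    · refine (hc.mono (prod_mono_left fun y hy => hy.1)).add ?_
      exact ((continuous_barrier _ hsc).const_mul ε |>.continuousOn)
    · exact fun y hy => add_nonneg (hinit y hy.1) (mul_pos hε (hφpos _ _)).le
    · intro τ hτ
      have h1 := hB X τ hτ
      have h2 : B / ε ≤ barrierProfile (X - s τ) := by
        refine le_trans ?_ (le_barrierProfile _)
        linarith [hL' τ hτ, le_max_right x (L + B / ε)]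
      have h3 : barrierProfile (X - s τ) ≤ φ X τ := by
        refine le_mul_of_one_le_left (barrierProfile_pos _).le (Real.one_le_exp ?_)
        exact mul_nonneg (by linarith) hτ.1
      have h4 : B ≤ ε * φ X τ := by
        have := (div_le_iff₀ hε).mp (h2.trans h3)
        linarith
      linarith
    · intro τ hτ
      obtain ⟨a, ha, hd⟩ := hflux τ hτ
      refine ⟨a + ε * 0, by linarith, hd.add (HasDerivWithinAt.const_mul ε ?_)⟩
      have h0 : (0 : ℝ) < s τ := hb.trans_le (hsb τ)
      obtain ⟨p, _, _, h1, _⟩ := hasHeatDefect_barrier_of_lt (C := 2 * M + 3) (hs τ hτ) h0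
      refine (hasDerivAt_const (0 : ℝ) (exp ((2 * M + 3) * τ) * 1)).congr_of_eventuallyEq ?_
        |>.hasDerivWithinAt
      filter_upwards [Iio_mem_nhds h0] with z hz
      rw [hφ, barrier, barrierProfile_of_nonpos (sub_nonpos.mpr (le_of_lt hz))]
    · intro τ hτ y hy hys
      obtain ⟨d₁, hd₁, h1⟩ := hheat τ hτ y hy.1 hys
      obtain ⟨d₂, hd₂, h2⟩ := exists_hasHeatDefect_barrier (hs τ hτ) (hσ τ hτ).1 (hσ τ hτ).2 hys
      exact ⟨_, add_pos_of_nonneg_of_pos hd₁ (mul_pos hε hd₂), h1.add (h2.const_mul ε)⟩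
    · intro τ hτ
      obtain ⟨a, c, hda, hdc, hac⟩ := hjump τ hτ
      refine ⟨_, _, hda.add ((hasDerivWithinAt_barrier_left _ s τ).const_mul ε),
        hdc.add ((hasDerivWithinAt_barrier_right _ s τ).const_mul ε), fun h => ?_⟩
      have : 0 < ε * exp ((2 * M + 3) * τ) := mul_pos hε (exp_pos _)
      rw [mul_zero, add_zero]
      exact hac (by linarith)
  by_contra! hneg
  have := key (-v x t / (2 * φ x t)) (div_pos (by linarith) (by linarith [hφpos x t]))
  have h2 : -v x t / (2 * φ x t) * φ x t = -v x t / 2 := by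
    have := (hφpos x t).ne'
    field_simp
  rw [h2] at this
  linarith

lemma hasDerivWithinAt_Ici_of_tendsto {f f' : ℝ → ℝ} {a c d : ℝ} (hf : Continuous f) (hd : a < d)
    (hf' : ∀ x ∈ Ioo a d, HasDerivAt f (f' x) x)
    (hlim : Filter.Tendsto f' (nhdsWithin a (Ioi a)) (nhds c)) :
    HasDerivWithinAt f c (Ici a) a := by
  refine hasDerivWithinAt_Ici_of_tendsto_deriv (s := Ioo a d)
    (fun x hx => (hf' x hx).differentiableAt.differentiableWithinAt)
    hf.continuousWithinAt (Ioo_mem_nhdsGT hd) ?_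
  refine hlim.congr' ?_
  filter_upwards [Ioo_mem_nhdsGT hd] with x hx using (hf' x hx).deriv.symm

lemma hasDerivWithinAt_Iic_of_tendsto {f f' : ℝ → ℝ} {a c d : ℝ} (hf : Continuous f) (hd : d < a)
    (hf' : ∀ x ∈ Ioo d a, HasDerivAt f (f' x) x)
    (hlim : Filter.Tendsto f' (nhdsWithin a (Iio a)) (nhds c)) :
    HasDerivWithinAt f c (Iic a) a := by
  refine hasDerivWithinAt_Iic_of_tendsto_deriv (s := Ioo d a)
    (fun x hx => (hf' x hx).differentiableAt.differentiableWithinAt)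
    hf.continuousWithinAt (Ioo_mem_nhdsLT hd) ?_
  refine hlim.congr' ?_
  filter_upwards [Ioo_mem_nhdsLT hd] with x hx using (hf' x hx).deriv.symm

/-- The heat potential with (even) initial values `g`, influx layer `k` at `x = 0`, and sink
layers of density `w` on the front and on its mirror image. -/
def stefanPot (b : ℝ) (g k w : ℝ → ℝ) (x t : ℝ) : ℝ :=
  heatExt g x t + sourcePot heatK k (fun _ => 0) (fun τ => τ) x t -
    sourcePot heatK w (front b w) (fun τ => τ) x t -
    sourcePot heatK w (fun τ => -front b w τ) (fun τ => τ) x t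

/-- The combination of potentials in `stefanPot` with a general kernel. -/
def stefanPotKer (κ : ℝ → ℝ → ℝ) (b : ℝ) (g k w : ℝ → ℝ) (x t : ℝ) : ℝ :=
  sourcePot κ g (fun a => a) (fun _ => 0) x t + sourcePot κ k (fun _ => 0) (fun τ => τ) x t -
    sourcePot κ w (front b w) (fun τ => τ) x t -
    sourcePot κ w (fun τ => -front b w τ) (fun τ => τ) x t

section stefanPot

variable {b S M B G : ℝ} {g k w : ℝ → ℝ}

lemma stefanPot_eq_stefanPotKer {x t : ℝ} (ht : 0 < t) :
    stefanPot b g k w x t = stefanPotKer heatK b g k w x t := by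
  rw [stefanPot, stefanPotKer, heatExt_eq_sourcePot g x ht]

lemma stefanPot_zero_time (hk : IsDensity S B k) (hw : IsSpeed S M w) (x : ℝ) :
    stefanPot b g k w x 0 = g x := by
  rw [stefanPot, heatExt_of_nonpos g x le_rfl, sourcePot_heatK_zero_time _ hk,
    sourcePot_heatK_zero_time _ hw.density, sourcePot_heatK_zero_time _ hw.density]
  ring

lemma continuousOn_stefanPot (hgc : Continuous g) (hgB : ∀ x, |g x| ≤ G) (hk : IsDensity S B k)
    (hw : IsSpeed S M w) :
    ContinuousOn (fun p : ℝ × ℝ => stefanPot b g k w p.1 p.2) {p | p.2 ≤ S} :=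
  (((continuous_heatExt hgc hgB).continuousOn.add
    (continuousOn_sourcePot_heatK hk continuous_const)).sub
    (continuousOn_sourcePot_heatK hw.density (hw.continuous_front b))).sub
    (continuousOn_sourcePot_heatK hw.density (hw.continuous_front b).neg)

lemma continuous_stefanPot (hgc : Continuous g) (hgB : ∀ x, |g x| ≤ G) (hk : IsDensity S B k)
    (hw : IsSpeed S M w) {t : ℝ} (ht : t ≤ S) : Continuous fun x => stefanPot b g k w x t :=
  (continuousOn_stefanPot hgc hgB hk hw).comp_continuous (f := fun x : ℝ => (x, t))
    (by fun_prop) fun _ => ht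

lemma exists_abs_stefanPot_le (hgB : ∀ x, |g x| ≤ G) (hk : IsDensity S B k)
    (hw : IsSpeed S M w) : ∃ C, ∀ x t, t ≤ S → |stefanPot b g k w x t| ≤ C := by
  obtain ⟨C₁, h₁⟩ := exists_bound_sourcePot_heatK (fun _ => 0) hk
  obtain ⟨C₂, h₂⟩ := exists_bound_sourcePot_heatK (front b w) hw.density
  obtain ⟨C₃, h₃⟩ := exists_bound_sourcePot_heatK (fun τ => -front b w τ) hw.density
  refine ⟨G + C₁ + C₂ + C₃, fun x t ht => ?_⟩
  rw [stefanPot]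
  refine (abs_sub _ _).trans (add_le_add ((abs_sub _ _).trans (add_le_add
    ((abs_add_le _ _).trans (add_le_add (abs_heatExt_le hgB x t) (h₁ x t ht))) (h₂ x t ht)))
    (h₃ x t ht))

section deriv

variable (hb : 0 < b) (hgi : Integrable g) (hk : IsDensity S B k) (hw : IsSpeed S M w)

include hb hw in
lemma isAway_neg_front {x t : ℝ} (hx : 0 ≤ x) :
    IsAway (fun τ => -front b w τ) (fun τ => τ) x t :=
  isAway_curve (hw.continuous_front b).neg (by
    have := hw.le_front b t
    rw [Pi.neg_apply]
    linarith)

include hb hgi hk hw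

lemma hasDerivAt_stefanPot {x t : ℝ} (hx : 0 < x) (ht : 0 < t) (hxt : x ≠ front b w t) :
    HasDerivAt (fun y => stefanPot b g k w y t) (stefanPotKer heatKx b g k w x t) x := by
  have h0 : (fun y => stefanPot b g k w y t) = fun y => stefanPotKer heatK b g k w y t :=
    funext fun y => stefanPot_eq_stefanPotKer ht
  rw [h0]
  have hm := (hw.continuous_front b).measurable
  exact (((hasDerivAt_sourcePot_heatK hgi measurable_id measurable_const (isAway_pos ht)).add
    (hasDerivAt_sourcePot_heatK hk.integrable measurable_const measurable_id
      (isAway_curve continuous_const hx.ne'))).sub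
    (hasDerivAt_sourcePot_heatK hw.density.integrable hm measurable_id
      (isAway_curve (hw.continuous_front b) hxt))).sub
    (hasDerivAt_sourcePot_heatK hw.density.integrable hm.neg measurable_id
      (isAway_neg_front hb hw hx.le))

lemma hasDerivAt_stefanPotKer_heatKx {x t : ℝ} (hx : 0 < x) (ht : 0 < t)
    (hxt : x ≠ front b w t) : HasDerivAt (fun y => stefanPotKer heatKx b g k w y t)
      (stefanPotKer heatKxx b g k w x t) x := by
  have hm := (hw.continuous_front b).measurable
  exact (((hasDerivAt_sourcePot_heatKx hgi measurable_id measurable_const (isAway_pos ht)).add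
    (hasDerivAt_sourcePot_heatKx hk.integrable measurable_const measurable_id
      (isAway_curve continuous_const hx.ne'))).sub
    (hasDerivAt_sourcePot_heatKx hw.density.integrable hm measurable_id
      (isAway_curve (hw.continuous_front b) hxt))).sub
    (hasDerivAt_sourcePot_heatKx hw.density.integrable hm.neg measurable_id
      (isAway_neg_front hb hw hx.le))

lemma hasDerivAt_stefanPot_time {x t : ℝ} (hx : 0 < x) (ht : 0 < t)
    (hxt : x ≠ front b w t) : HasDerivAt (fun τ => stefanPot b g k w x τ)
      (stefanPotKer heatKxx b g k w x t) t := by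
  have hm := (hw.continuous_front b).measurable
  have h : HasDerivAt (fun τ => stefanPotKer heatK b g k w x τ)
      (stefanPotKer heatKxx b g k w x t) t :=
    (((hasDerivAt_sourcePot_time hgi measurable_id measurable_const (isAway_pos ht)).add
    (hasDerivAt_sourcePot_time hk.integrable measurable_const measurable_id
      (isAway_curve continuous_const hx.ne'))).sub
    (hasDerivAt_sourcePot_time hw.density.integrable hm measurable_id
      (isAway_curve (hw.continuous_front b) hxt))).sub
    (hasDerivAt_sourcePot_time hw.density.integrable hm.neg measurable_id
      (isAway_neg_front hb hw hx.le))
  refine h.congr_of_eventuallyEq ?_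
  filter_upwards [Ioi_mem_nhds ht] with τ hτ using stefanPot_eq_stefanPotKer hτ

lemma hasHeatDefect_stefanPot {x t : ℝ} (hx : 0 < x) (ht : 0 < t) (hxt : x ≠ front b w t) :
    HasHeatDefect (stefanPot b g k w) 0 x t := by
  refine ⟨_, _, _, ?_, hasDerivAt_stefanPotKer_heatKx hb hgi hk hw hx ht hxt,
    hasDerivAt_stefanPot_time hb hgi hk hw hx ht hxt, sub_self _⟩
  filter_upwards [Ioi_mem_nhds hx, isOpen_ne.mem_nhds hxt] with y hy hyt
  exact hasDerivAt_stefanPot hb hgi hk hw hy ht hyt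

lemma continuousAt_regular_part {t : ℝ} (ht : 0 < t) : ContinuousAt (fun x =>
    sourcePot heatKx g (fun a => a) (fun _ => 0) x t +
      sourcePot heatKx k (fun _ => 0) (fun τ => τ) x t -
      sourcePot heatKx w (fun τ => -front b w τ) (fun τ => τ) x t) (front b w t) := by
  have hm := (hw.continuous_front b).measurable
  have hpos : 0 < front b w t := hb.trans_le (hw.le_front b t)
  exact (((hasDerivAt_sourcePot_heatKx hgi measurable_id measurable_const (isAway_pos ht)).add
    (hasDerivAt_sourcePot_heatKx hk.integrable measurable_const measurable_id
      (isAway_curve continuous_const hpos.ne'))).sub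
    (hasDerivAt_sourcePot_heatKx hw.density.integrable hm.neg measurable_id
      (isAway_neg_front hb hw hpos.le))).continuousAt

lemma hasDerivWithinAt_stefanPot_right (hgc : Continuous g) (hgB : ∀ x, |g x| ≤ G) {t : ℝ}
    (ht : t ∈ Ioc 0 S) : HasDerivWithinAt (fun x => stefanPot b g k w x t)
      (w t / 2 - frontFlux b g k w t) (Ici (front b w t)) (front b w t) := by
  have hpos : 0 < front b w t := hb.trans_le (hw.le_front b t)
  refine hasDerivWithinAt_Ici_of_tendsto (continuous_stefanPot hgc hgB hk hw ht.2)
    (lt_add_one _) (fun x hx => hasDerivAt_stefanPot hb hgi hk hw (hpos.trans hx.1) ht.1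
      hx.1.ne') ?_
  have h1 := tendsto_sourcePot_heatKx_right hw.density (hw.front_lipschitz b) ht
  have h2 := (continuousAt_regular_part hb hgi hk hw ht.1).tendsto.mono_left
    (nhdsWithin_le_nhds (s := Ioi (front b w t)))
  convert h2.sub h1 using 2
  · rw [stefanPotKer]; ring
  · rw [frontFlux]; ring

lemma hasDerivWithinAt_stefanPot_left (hgc : Continuous g) (hgB : ∀ x, |g x| ≤ G) {t : ℝ}
    (ht : t ∈ Ioc 0 S) : HasDerivWithinAt (fun x => stefanPot b g k w x t)
      (-(w t / 2) - frontFlux b g k w t) (Iic (front b w t)) (front b w t) := by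
  have hpos : 0 < front b w t := hb.trans_le (hw.le_front b t)
  refine hasDerivWithinAt_Iic_of_tendsto (continuous_stefanPot hgc hgB hk hw ht.2)
    hpos (fun x hx => hasDerivAt_stefanPot hb hgi hk hw hx.1 ht.1 hx.2.ne) ?_
  have h1 := tendsto_sourcePot_heatKx_left hw.density (hw.front_lipschitz b) ht
  have h2 := (continuousAt_regular_part hb hgi hk hw ht.1).tendsto.mono_left
    (nhdsWithin_le_nhds (s := Iio (front b w t)))
  convert h2.sub h1 using 2
  · rw [stefanPotKer]; ring
  · rw [frontFlux]; ring

lemma hasDerivWithinAt_stefanPot_zero (hgc : Continuous g) (hgB : ∀ x, |g x| ≤ G)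
    (hge : ∀ x, g (-x) = g x) {t : ℝ} (ht : t ∈ Ioc 0 S) :
    HasDerivWithinAt (fun x => stefanPot b g k w x t) (-(k t / 2)) (Ici 0) 0 := by
  have hm := (hw.continuous_front b).measurable
  have hpos : 0 < front b w t := hb.trans_le (hw.le_front b t)
  refine hasDerivWithinAt_Ici_of_tendsto (continuous_stefanPot hgc hgB hk hw ht.2)
    hpos (fun x hx => hasDerivAt_stefanPot hb hgi hk hw hx.1 ht.1 hx.2.ne) ?_
  have h1 := tendsto_sourcePot_heatKx_right (γ := fun _ => (0 : ℝ)) (Λ := 0) hk (by simp) ht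
  have h2 : ContinuousAt (fun x => sourcePot heatKx g (fun a => a) (fun _ => 0) x t -
      sourcePot heatKx w (front b w) (fun τ => τ) x t -
      sourcePot heatKx w (fun τ => -front b w τ) (fun τ => τ) x t) 0 :=
    (((hasDerivAt_sourcePot_heatKx hgi measurable_id measurable_const (isAway_pos ht.1)).sub
    (hasDerivAt_sourcePot_heatKx hw.density.integrable hm measurable_id
      (isAway_curve (hw.continuous_front b) hpos.ne))).sub
    (hasDerivAt_sourcePot_heatKx hw.density.integrable hm.neg measurable_id
      (isAway_neg_front hb hw le_rfl))).continuousAt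
  have h3 := sourcePot_heatKx_neg w (front b w) (fun τ => τ) 0 t
  rw [neg_zero] at h3
  have h4 : sourcePot heatKx k (fun _ => 0) (fun τ => τ) 0 t = 0 := by
    simp [sourcePot, heatKx_zero_left]
  have h5 := sourcePot_heatKx_even hge t
  convert (h2.tendsto.mono_left (nhdsWithin_le_nhds (s := Ioi 0))).add h1 using 2
  · rw [stefanPotKer]; ring
  · rw [h3, h4, h5]; ring

end deriv

end stefanPot

lemma hasHeatDefect_wedge_of_lt {M x t σ : ℝ} {s : ℝ → ℝ} (hs : HasDerivAt s σ t) (hx : x < s t) :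
    HasHeatDefect (fun x t => M * max (s t - x) 0) (M * σ) x t := by
  refine ⟨fun _ => M * (-1), 0, M * σ, ?_, hasDerivAt_const _ _, ?_, sub_zero _⟩
  · filter_upwards [Iio_mem_nhds hx] with y hy
    refine (((hasDerivAt_id' y).const_sub (s t)).const_mul M).congr_of_eventuallyEq ?_
    filter_upwards [Iio_mem_nhds hy] with z hz
    rw [max_eq_left (sub_nonneg.mpr (le_of_lt hz))]
  · refine ((hs.sub_const x).const_mul M).congr_of_eventuallyEq ?_
    filter_upwards [hs.continuousAt.eventually (Ioi_mem_nhds hx)] with τ hτ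
    rw [max_eq_left (sub_nonneg.mpr (le_of_lt hτ))]

lemma hasHeatDefect_wedge_of_gt {M x t : ℝ} {s : ℝ → ℝ} (hs : ContinuousAt s t) (hx : s t < x) :
    HasHeatDefect (fun x t => M * max (s t - x) 0) 0 x t := by
  refine ⟨fun _ => 0, 0, 0, ?_, hasDerivAt_const _ _, ?_, sub_zero _⟩
  · filter_upwards [Ioi_mem_nhds hx] with y hy
    refine (hasDerivAt_const y 0).congr_of_eventuallyEq ?_
    filter_upwards [Ioi_mem_nhds hy] with z hz
    rw [max_eq_right (sub_nonpos.mpr (le_of_lt hz)), mul_zero]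
  · refine (hasDerivAt_const t 0).congr_of_eventuallyEq ?_
    filter_upwards [hs.eventually (Iio_mem_nhds hx)] with τ hτ
    rw [max_eq_right (sub_nonpos.mpr (le_of_lt hτ)), mul_zero]

lemma hasDerivWithinAt_wedge_Iic (M s : ℝ) {x : ℝ} (hx : x ≤ s) :
    HasDerivWithinAt (fun y => M * max (s - y) 0) (-M) (Iic s) x := by
  have h := (((hasDerivAt_id' x).const_sub s).const_mul M).hasDerivWithinAt (s := Iic s)
  rw [mul_neg, mul_one] at h
  exact h.congr (fun y hy => by rw [max_eq_left (sub_nonneg.mpr hy)])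
    (by rw [max_eq_left (sub_nonneg.mpr hx)])

lemma hasDerivWithinAt_wedge_Ici (M s : ℝ) :
    HasDerivWithinAt (fun y => M * max (s - y) 0) 0 (Ici s) s := by
  refine (hasDerivWithinAt_const s (Ici s) (0 : ℝ)).congr (fun y hy => ?_) (by simp)
  rw [max_eq_right (sub_nonpos.mpr hy), mul_zero]

section stefanPot

variable {b S T M B G : ℝ} {g k w : ℝ → ℝ} (hb : 0 < b) (hgc : Continuous g)
  (hgB : ∀ x, |g x| ≤ G) (hgi : Integrable g) (hge : ∀ x, g (-x) = g x) (hk : IsDensity S B k)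
  (hw : IsSpeed S M w) (hfix : speedMap b S M g k w = w) (hTS : T < S)

include hb hgc hgB hgi hge hk hw hfix hTS

omit hb hgc hgB hgi hge hk hw hTS in
lemma speedMap_fixedPoint_apply {t : ℝ} (ht : t ∈ Ioc 0 S) :
    w t = max 0 (min M (2 * frontFlux b g k w t)) := by
  conv_lhs => rw [← hfix]
  rw [speedMap, indicator_of_mem ht]

lemma stefanPot_nonneg (hk0 : ∀ t ∈ Ioc 0 T, 0 < k t) (hg0 : ∀ x, 0 ≤ g x) {x t : ℝ}
    (hx : 0 ≤ x) (ht : t ∈ Icc 0 T) : 0 ≤ stefanPot b g k w x t := by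
  obtain ⟨C, hC⟩ := exists_abs_stefanPot_le (b := b) hgB hk hw
  have hS : ∀ t ∈ Ioc 0 T, t ∈ Ioc 0 S := fun t ht => ⟨ht.1, ht.2.trans hTS.le⟩
  refine nonneg_of_supersolution (σ := w) (B := C) hb (hw.continuous_front b) (hw.le_front b)
    (fun t ht => hw.hasDerivAt_front b ⟨ht.1, ht.2.trans_lt hTS⟩)
    (fun t _ => ⟨hw.nonneg t, (le_abs_self _).trans (hw.density.bound t)⟩) hw.density.nonneg
    ((continuousOn_stefanPot hgc hgB hk hw).mono fun p hp => hp.2.2.trans hTS.le)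
    (fun x t ht => (abs_le.mp (hC x t (ht.2.trans hTS.le))).1)
    (fun x _ => by rw [stefanPot_zero_time hk hw]; exact hg0 x)
    (fun t ht => ⟨_, by linarith [hk0 t ht],
      hasDerivWithinAt_stefanPot_zero hb hgi hk hw hgc hgB hge (hS t ht)⟩)
    (fun t ht x hx hxt => ⟨0, le_rfl, hasHeatDefect_stefanPot hb hgi hk hw hx ht.1 hxt⟩)
    (fun t ht => ⟨_, _, hasDerivWithinAt_stefanPot_left hb hgi hk hw hgc hgB (hS t ht),
      hasDerivWithinAt_stefanPot_right hb hgi hk hw hgc hgB (hS t ht), fun hc => ?_⟩) hx ht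
  have h1 := speedMap_fixedPoint_apply hfix (hS t ht)
  have h2 : w t = 0 := by
    rcases le_total 0 (min M (2 * frontFlux b g k w t)) with h | h
    · rw [max_eq_right h] at h1
      linarith [min_le_right M (2 * frontFlux b g k w t)]
    · rwa [max_eq_left h] at h1
  linarith

lemma stefanPot_le_wedge (hk0 : ∀ t ∈ Ioc 0 T, k t < 2 * M)
    (hgM : ∀ x, 0 ≤ x → g x ≤ M * max (b - x) 0) {x t : ℝ}
    (hx : 0 ≤ x) (ht : t ∈ Icc 0 T) :
    stefanPot b g k w x t ≤ M * max (front b w t - x) 0 := by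
  obtain ⟨C, hC⟩ := exists_abs_stefanPot_le (b := b) hgB hk hw
  have hS : ∀ t ∈ Ioc 0 T, t ∈ Ioc 0 S := fun t ht => ⟨ht.1, ht.2.trans hTS.le⟩
  have hM := hw.density.nonneg
  have hs := fun t (ht : t ∈ Ioc 0 T) => hw.hasDerivAt_front b ⟨ht.1, ht.2.trans_lt hTS⟩
  have hsc := hw.continuous_front b
  suffices h : 0 ≤ M * max (front b w t - x) 0 + -1 * stefanPot b g k w x t by linarith
  refine nonneg_of_supersolution (s := front b w) (σ := w) (B := C)
    (v := fun x t => M * max (front b w t - x) 0 + -1 * stefanPot b g k w x t)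
    hb hsc (hw.le_front b) hs
    (fun t _ => ⟨hw.nonneg t, (le_abs_self _).trans (hw.density.bound t)⟩) hM
    ?_ ?_ ?_ (fun t ht => ⟨-M + -1 * (-(k t / 2)), by linarith [hk0 t ht], ?_⟩) ?_
    (fun t ht => ⟨_, _, (hasDerivWithinAt_wedge_Iic M _ le_rfl).add
      ((hasDerivWithinAt_stefanPot_left hb hgi hk hw hgc hgB (hS t ht)).const_mul (-1)),
      (hasDerivWithinAt_wedge_Ici M _).add
      ((hasDerivWithinAt_stefanPot_right hb hgi hk hw hgc hgB (hS t ht)).const_mul (-1)),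
      fun hc => ?_⟩) hx ht
  · have h1 : Continuous fun p : ℝ × ℝ => M * max (front b w p.2 - p.1) 0 := by fun_prop
    exact h1.continuousOn.add (continuousOn_const.mul
      ((continuousOn_stefanPot hgc hgB hk hw).mono fun p hp => hp.2.2.trans hTS.le))
  · intro x t ht
    have h1 := (abs_le.mp (hC x t (ht.2.trans hTS.le))).2
    have h2 : 0 ≤ M * max (front b w t - x) 0 := mul_nonneg hM (le_max_right _ _)
    linarith
  · intro x hx
    rw [stefanPot_zero_time hk hw, front_zero]
    linarith [hgM x hx]
  · have hpos : 0 < front b w t := hb.trans_le (hw.le_front b t)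
    have h1 := ((hasDerivWithinAt_wedge_Iic M _ hpos.le).hasDerivAt
      (Iic_mem_nhds hpos)).hasDerivWithinAt (s := Ici 0)
    exact h1.add ((hasDerivWithinAt_stefanPot_zero hb hgi hk hw hgc hgB hge (hS t ht)).const_mul _)
  · intro t ht x hx hxt
    have hv := (hasHeatDefect_stefanPot hb hgi hk hw hx ht.1 hxt).const_mul (-1)
    rcases lt_or_gt_of_ne hxt with h | h
    · exact ⟨M * w t + -1 * 0, by have := mul_nonneg hM (hw.nonneg t); linarith,
        (hasHeatDefect_wedge_of_lt (hs t ht) h).add hv⟩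
    · exact ⟨0 + -1 * 0, by norm_num, (hasHeatDefect_wedge_of_gt hsc.continuousAt h).add hv⟩
  · have h1 := speedMap_fixedPoint_apply hfix (hS t ht)
    have h2 : w t = M := by
      refine le_antisymm ((le_abs_self _).trans (hw.density.bound t)) ?_
      rcases le_total M (2 * frontFlux b g k w t) with h | h
      · rw [min_eq_left h] at h1
        exact h1 ▸ le_max_right _ _
      · rw [min_eq_right h] at h1
        linarith [le_max_right 0 (2 * frontFlux b g k w t)]
    linarith

variable (hk0 : ∀ t ∈ Ioc 0 T, 0 < k t) (hg0 : ∀ x, 0 ≤ g x) (hk1 : ∀ t ∈ Ioc 0 T, k t < 2 * M)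
    (hgM : ∀ x, 0 ≤ x → g x ≤ M * max (b - x) 0)

include hk0 hg0 hk1 hgM

lemma stefanPot_eq_zero {x t : ℝ} (ht : t ∈ Icc 0 T) (hx : front b w t ≤ x) :
    stefanPot b g k w x t = 0 := by
  have hx0 : 0 ≤ x := (hb.trans_le ((hw.le_front b t).trans hx)).le
  refine le_antisymm ?_ (stefanPot_nonneg hb hgc hgB hgi hge hk hw hfix hTS hk0 hg0 hx0 ht)
  have := stefanPot_le_wedge hb hgc hgB hgi hge hk hw hfix hTS hk1 hgM hx0 ht
  rwa [max_eq_right (sub_nonpos.mpr hx), mul_zero] at this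

lemma hasDerivWithinAt_stefanPot_front {t : ℝ} (ht : t ∈ Ioc 0 T) :
    HasDerivWithinAt (fun x => stefanPot b g k w x t) (-w t) (Iic (front b w t))
      (front b w t) := by
  have hS : t ∈ Ioc 0 S := ⟨ht.1, ht.2.trans hTS.le⟩
  have hz : ∀ x, front b w t ≤ x → stefanPot b g k w x t = 0 := fun x hx =>
    stefanPot_eq_zero hb hgc hgB hgi hge hk hw hfix hTS hk0 hg0 hk1 hgM ⟨ht.1.le, ht.2⟩ hx
  have h1 := hasDerivWithinAt_stefanPot_right hb hgi hk hw hgc hgB hS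
  have h2 : HasDerivWithinAt (fun x => stefanPot b g k w x t) 0 (Ici (front b w t))
      (front b w t) :=
    (hasDerivWithinAt_const _ _ (0 : ℝ)).congr (fun x hx => hz x hx) (hz _ le_rfl)
  have h3 := (uniqueDiffWithinAt_Ici (front b w t)).eq_deriv _ h1 h2
  convert hasDerivWithinAt_stefanPot_left hb hgi hk hw hgc hgB hS using 1
  linarith

/-- The potential, continued linearly through the fixed boundary and through the front. -/
def stefanSol (b : ℝ) (g k w : ℝ → ℝ) (x t : ℝ) : ℝ :=
  if x < 0 then stefanPot b g k w 0 t - k t / 2 * x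
  else if front b w t < x then -w t * (x - front b w t)
  else stefanPot b g k w x t

omit hb hgc hgB hgi hge hk hw hfix hTS hk0 hg0 hk1 hgM in
lemma stefanSol_of_mem {x t : ℝ} (hx : x ∈ Icc 0 (front b w t)) :
    stefanSol b g k w x t = stefanPot b g k w x t := by
  rw [stefanSol, if_neg hx.1.not_gt, if_neg hx.2.not_gt]

lemma hasDerivAt_stefanSol_front {t : ℝ} (ht : t ∈ Ioc 0 T) :
    HasDerivAt (fun x => stefanSol b g k w x t) (-w t) (front b w t) := by
  have hpos : 0 < front b w t := hb.trans_le (hw.le_front b t)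
  have hz : stefanPot b g k w (front b w t) t = 0 :=
    stefanPot_eq_zero hb hgc hgB hgi hge hk hw hfix hTS hk0 hg0 hk1 hgM ⟨ht.1.le, ht.2⟩ le_rfl
  have hl : HasDerivWithinAt (fun x => stefanSol b g k w x t) (-w t) (Iic (front b w t))
      (front b w t) := by
    refine (hasDerivWithinAt_stefanPot_front hb hgc hgB hgi hge hk hw hfix hTS hk0 hg0 hk1 hgM
      ht).congr_of_eventuallyEq ?_ (stefanSol_of_mem ⟨hpos.le, le_rfl⟩)
    filter_upwards [self_mem_nhdsWithin, nhdsWithin_le_nhds (Ioi_mem_nhds hpos)] with x h1 h2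
    exact stefanSol_of_mem ⟨le_of_lt h2, h1⟩
  have hr : HasDerivWithinAt (fun x => stefanSol b g k w x t) (-w t) (Ici (front b w t))
      (front b w t) := by
    have h1 := (((hasDerivAt_id' (front b w t)).sub_const (front b w t)).const_mul
      (-w t)).hasDerivWithinAt (s := Ici (front b w t))
    rw [mul_one] at h1
    have h2 : stefanSol b g k w (front b w t) t = 0 := by
      rw [stefanSol_of_mem ⟨hpos.le, le_rfl⟩, hz]
    refine h1.congr (fun x hx => ?_) (by rw [h2]; simp)
    rcases eq_or_lt_of_le (mem_Ici.mp hx) with h | h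
    · rw [← h, h2]; simp
    · rw [stefanSol, if_neg (hpos.trans h).not_gt, if_pos h]
  have := hl.union hr
  rwa [Iic_union_Ici, hasDerivWithinAt_univ] at this

omit hfix hk0 hg0 hk1 hgM in
lemma hasDerivAt_stefanSol_zero {t : ℝ} (ht : t ∈ Ioc 0 T) :
    HasDerivAt (fun x => stefanSol b g k w x t) (-(k t / 2)) 0 := by
  have hpos : 0 < front b w t := hb.trans_le (hw.le_front b t)
  have hr : HasDerivWithinAt (fun x => stefanSol b g k w x t) (-(k t / 2)) (Ici 0) 0 := by
    refine (hasDerivWithinAt_stefanPot_zero hb hgi hk hw hgc hgB hge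
      ⟨ht.1, ht.2.trans hTS.le⟩).congr_of_eventuallyEq ?_ (stefanSol_of_mem ⟨le_rfl, hpos.le⟩)
    filter_upwards [self_mem_nhdsWithin, nhdsWithin_le_nhds (Iio_mem_nhds hpos)] with x h1 h2
    exact stefanSol_of_mem ⟨h1, le_of_lt h2⟩
  have hl : HasDerivWithinAt (fun x => stefanSol b g k w x t) (-(k t / 2)) (Iic 0) 0 := by
    have h1 := (((hasDerivAt_id' (0 : ℝ)).const_mul (k t / 2)).const_sub
      (stefanPot b g k w 0 t)).hasDerivWithinAt (s := Iic 0)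
    rw [mul_one] at h1
    have h2 := stefanSol_of_mem (g := g) (k := k) (x := 0) ⟨le_rfl, hpos.le⟩
    refine h1.congr (fun x hx => ?_) (by rw [h2]; simp)
    rcases eq_or_lt_of_le (mem_Iic.mp hx) with h | h
    · rw [h, h2]; simp
    · rw [stefanSol, if_pos h]
  have := hl.union hr
  rwa [Iic_union_Ici, hasDerivWithinAt_univ] at this

end stefanPot

section stefanPot

variable {b S T M B G : ℝ} {g k w : ℝ → ℝ} (hb : 0 < b) (hgc : Continuous g)
  (hgB : ∀ x, |g x| ≤ G) (hgi : Integrable g) (hge : ∀ x, g (-x) = g x) (hk : IsDensity S B k)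
  (hw : IsSpeed S M w) (hfix : speedMap b S M g k w = w) (hTS : T < S)

include hb hgi hk hw

lemma hasDerivAt_stefanSol {x t : ℝ} (ht : 0 < t) (hx : x ∈ Ioo 0 (front b w t)) :
    HasDerivAt (fun y => stefanSol b g k w y t) (stefanPotKer heatKx b g k w x t) x := by
  refine (hasDerivAt_stefanPot hb hgi hk hw hx.1 ht hx.2.ne).congr_of_eventuallyEq ?_
  filter_upwards [Ioo_mem_nhds hx.1 hx.2] with y hy
  exact stefanSol_of_mem (Ioo_subset_Icc_self hy)

lemma hasDerivAt_deriv_stefanSol {x t : ℝ} (ht : 0 < t) (hx : x ∈ Ioo 0 (front b w t)) :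
    HasDerivAt (fun y => deriv (fun z => stefanSol b g k w z t) y)
      (stefanPotKer heatKxx b g k w x t) x := by
  refine (hasDerivAt_stefanPotKer_heatKx hb hgi hk hw hx.1 ht hx.2.ne).congr_of_eventuallyEq ?_
  filter_upwards [Ioo_mem_nhds hx.1 hx.2] with y hy
  exact (hasDerivAt_stefanSol hb hgi hk hw ht hy).deriv

lemma hasDerivAt_stefanSol_time {x t : ℝ} (ht : 0 < t) (hx : x ∈ Ioo 0 (front b w t)) :
    HasDerivAt (fun τ => stefanSol b g k w x τ) (stefanPotKer heatKxx b g k w x t) t := by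
  refine (hasDerivAt_stefanPot_time hb hgi hk hw hx.1 ht hx.2.ne).congr_of_eventuallyEq ?_
  filter_upwards [(hw.continuous_front b).continuousAt.eventually (Ioi_mem_nhds hx.2)] with τ hτ
  exact stefanSol_of_mem ⟨hx.1.le, le_of_lt hτ⟩

include hgc hgB hge hfix hTS

lemma isStefanSolution_stefanSol (hk0 : ∀ t ∈ Ioc 0 T, 0 < k t) (hg0 : ∀ x, 0 ≤ g x)
    (hk1 : ∀ t ∈ Ioc 0 T, k t < 2 * M) (hgM : ∀ x, 0 ≤ x → g x ≤ M * max (b - x) 0)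
    {u₀ h : ℝ → ℝ} (hu₀ : ∀ x ∈ Ioo 0 b, g x = u₀ x) (hh : ∀ t ∈ Ioo 0 T, k t = 2 * h t) :
    IsStefanSolution b T u₀ h (front b w) (stefanSol b g k w) := by
  have hd : ∀ t ∈ Ioc 0 T, HasDerivAt (front b w) (w t) t := fun t ht =>
    hw.hasDerivAt_front b ⟨ht.1, ht.2.trans_lt hTS⟩
  have hpos : ∀ t, 0 < front b w t := fun t => hb.trans_le (hw.le_front b t)
  refine ⟨fun t _ => hpos t, front_zero b w,
    ⟨M.toNNReal, (LipschitzWith.of_dist_le' (hw.front_lipschitz b)).lipschitzOnWith⟩,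
    fun t ht => (hd t ht).differentiableAt.hasDerivAt,
    (hw.density.cont.mono (Ioc_subset_Ioc_right hTS.le)).congr fun t ht => (hd t ht).deriv,
    ?_, fun x t hx => ?_, fun x t hx => ?_, fun x t hx => ?_, fun t ht => ?_, fun x hx => ?_,
    fun t ht => ?_, fun t ht => ?_⟩
  · have hcl : closure (stefanQ T (front b w)) ⊆
        {p : ℝ × ℝ | 0 ≤ p.1 ∧ p.1 ≤ front b w p.2 ∧ p.2 ≤ T} := by
      refine closure_minimal (fun p hp => ⟨hp.1.le, hp.2.1.le, hp.2.2.2.le⟩) ?_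
      have hc := hw.continuous_front b
      have h1 : IsClosed {p : ℝ × ℝ | 0 ≤ p.1} := isClosed_le (by fun_prop) (by fun_prop)
      have h2 : IsClosed {p : ℝ × ℝ | p.1 ≤ front b w p.2} :=
        isClosed_le (by fun_prop) (by fun_prop)
      have h3 : IsClosed {p : ℝ × ℝ | p.2 ≤ T} := isClosed_le (by fun_prop) (by fun_prop)
      exact h1.inter (h2.inter h3)
    exact ((continuousOn_stefanPot hgc hgB hk hw).mono
      fun p hp => (hcl hp).2.2.trans hTS.le).congr
      fun p hp => stefanSol_of_mem ⟨(hcl hp).1, (hcl hp).2.1⟩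
  · exact (hasDerivAt_stefanSol hb hgi hk hw hx.2.2.1
      ⟨hx.1, hx.2.1⟩).differentiableAt.hasDerivAt
  · exact (hasDerivAt_deriv_stefanSol hb hgi hk hw hx.2.2.1
      ⟨hx.1, hx.2.1⟩).differentiableAt.hasDerivAt
  · rw [(hasDerivAt_deriv_stefanSol hb hgi hk hw hx.2.2.1 ⟨hx.1, hx.2.1⟩).deriv]
    exact hasDerivAt_stefanSol_time hb hgi hk hw hx.2.2.1 ⟨hx.1, hx.2.1⟩
  · rw [(hasDerivAt_stefanSol_zero hb hgc hgB hgi hge hk hw hTS ⟨ht.1, ht.2.le⟩).deriv, hh t ht]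
    ring
  · rw [stefanSol_of_mem ⟨hx.1.le, by rw [front_zero]; exact hx.2.le⟩, stefanPot_zero_time hk hw,
      hu₀ x hx]
  · rw [(hasDerivAt_stefanSol_front hb hgc hgB hgi hge hk hw hfix hTS hk0 hg0 hk1 hgM
      ⟨ht.1, ht.2.le⟩).deriv, (hd t ⟨ht.1, ht.2.le⟩).deriv]
  · rw [stefanSol_of_mem ⟨(hpos t).le, le_rfl⟩]
    exact stefanPot_eq_zero hb hgc hgB hgi hge hk hw hfix hTS hk0 hg0 hk1 hgM
      (Ioo_subset_Icc_self ht) le_rfl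

end stefanPot

lemma exists_influx_density {T : ℝ} (hT : 0 < T) {h : ℝ → ℝ} (hhc : ContinuousOn h (Icc 0 T))
    (hhpos : ∀ t ∈ Icc (0:ℝ) T, 0 < h t) :
    ∃ (k : ℝ → ℝ) (C : ℝ), IsDensity (T + 1) C k ∧ ∀ t ∈ Ioc 0 T, 0 < k t ∧ k t = 2 * h t := by
  obtain ⟨C, hC⟩ := isCompact_Icc.exists_bound_of_continuousOn hhc
  have hmem : ∀ t : ℝ, max 0 (min t T) ∈ Icc 0 T := fun t =>
    ⟨le_max_left _ _, max_le hT.le (min_le_right _ _)⟩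
  have hc : Continuous fun t => 2 * h (max 0 (min t T)) :=
    continuous_const.mul (hhc.comp_continuous (by fun_prop) hmem)
  have hC0 : 0 ≤ C := (norm_nonneg _).trans (hC 0 ⟨le_rfl, hT.le⟩)
  refine ⟨(Ioc 0 (T + 1)).indicator fun t => 2 * h (max 0 (min t T)), 2 * C,
    ⟨hc.measurable.indicator measurableSet_Ioc, fun t => ?_, fun t ht => indicator_of_notMem ht _,
      hc.continuousOn.congr fun t ht => indicator_of_mem ht _⟩, fun t ht => ?_⟩
  · by_cases ht : t ∈ Ioc 0 (T + 1)
    · rw [indicator_of_mem ht, abs_mul, abs_two]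
      exact mul_le_mul_of_nonneg_left (hC _ (hmem t)) zero_le_two
    · rw [indicator_of_notMem ht, abs_zero]
      positivity
  · have h1 := hhpos t (Ioc_subset_Icc_self ht)
    have h2 : t ∈ Ioc 0 (T + 1) := ⟨ht.1, by linarith [ht.2]⟩
    rw [indicator_of_mem h2, min_eq_left ht.2, max_eq_right ht.1.le]
    exact ⟨by positivity, rfl⟩

lemma exists_even_extension {b H : ℝ} (hb : 0 < b) (hH : 0 < H) {u₀ : ℝ → ℝ}
    (hu₀c : ContinuousOn u₀ (Icc 0 b))
    (hu₀ : ∀ x ∈ Icc (0:ℝ) b, 0 ≤ u₀ x ∧ u₀ x ≤ H * (b - x)) :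
    ∃ g : ℝ → ℝ, Continuous g ∧ Integrable g ∧ (∀ x, g (-x) = g x) ∧ (∀ x, 0 ≤ g x) ∧
      (∀ x, g x ≤ H * max (b - |x|) 0) ∧ ∀ x ∈ Icc 0 b, g x = u₀ x := by
  have hmem : ∀ x : ℝ, min |x| b ∈ Icc 0 b := fun x =>
    ⟨le_min (abs_nonneg x) hb.le, min_le_right _ _⟩
  have hc : Continuous fun x : ℝ => u₀ (min |x| b) :=
    hu₀c.comp_continuous (by fun_prop) hmem
  have hle : ∀ x, u₀ (min |x| b) ≤ H * max (b - |x|) 0 := by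
    intro x
    refine (hu₀ _ (hmem x)).2.trans (mul_le_mul_of_nonneg_left ?_ hH.le)
    rcases le_total |x| b with h | h
    · rw [min_eq_left h]; exact le_max_left _ _
    · rw [min_eq_right h, sub_self]; exact le_max_right _ _
  refine ⟨fun x => u₀ (min |x| b), hc, hc.integrable_of_hasCompactSupport ?_,
    fun x => by simp only [abs_neg], fun x => (hu₀ _ (hmem x)).1, hle, fun x hx => ?_⟩
  · refine HasCompactSupport.intro (isCompact_Icc (a := -b) (b := b)) fun x hx => ?_
    have h1 : b ≤ |x| := by
      by_contra! h
      exact hx ⟨(abs_lt.mp h).1.le, (abs_lt.mp h).2.le⟩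
    refine le_antisymm ?_ (hu₀ _ (hmem x)).1
    have := hle x
    rwa [max_eq_right (sub_nonpos.mpr h1), mul_zero] at this
  · simp only [abs_of_nonneg hx.1, min_eq_left hx.2]

/-- existence of a classical solution of the one-phase Stefan problem. -/
theorem stefan_existence (b T H : ℝ) (hb : 0 < b) (hT : 0 < T) (hH : 0 < H)
    (h u₀ : ℝ → ℝ)
    (hhc : ContinuousOn h (Icc 0 T)) (hhpos : ∀ t ∈ Icc (0:ℝ) T, 0 < h t)
    (hu₀c : ContinuousOn u₀ (Icc 0 b))
    (hu₀ : ∀ x ∈ Icc (0:ℝ) b, 0 ≤ u₀ x ∧ u₀ x ≤ H * (b - x)) :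
    ∃ (s : ℝ → ℝ) (u : ℝ → ℝ → ℝ), IsStefanSolution b T u₀ h s u := by
  obtain ⟨k, B, hk, hkh⟩ := exists_influx_density hT hhc hhpos
  obtain ⟨g, hgc, hgi, hge, hg0, hgH, hgu⟩ := exists_even_extension hb hH hu₀c hu₀
  have hB := hk.nonneg
  have hgabs : ∀ x, |g x| ≤ H * |x - b| := fun x => by
    rw [abs_of_nonneg (hg0 x)]
    refine (hgH x).trans (mul_le_mul_of_nonneg_left (max_le ?_ (abs_nonneg _)) hH.le)
    linarith [le_abs_self x, neg_le_abs (x - b)]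
  have hgB : ∀ x, |g x| ≤ H * b := fun x => by
    rw [abs_of_nonneg (hg0 x)]
    refine (hgH x).trans (mul_le_mul_of_nonneg_left (max_le ?_ hb.le) hH.le)
    linarith [abs_nonneg x]
  obtain ⟨w, hw, hfix⟩ := exists_speedMap_fixedPoint (M := H + B + 1) hb hgi hgabs hk
    (by positivity)
  refine ⟨front b w, stefanSol b g k w, isStefanSolution_stefanSol hb hgc hgB hgi hge hk hw hfix
    (lt_add_one T) (fun t ht => (hkh t ht).1) hg0 (fun t _ => ?_) (fun x hx => ?_)
    (fun x hx => hgu x (Ioo_subset_Icc_self hx)) fun t ht => (hkh t (Ioo_subset_Ioc_self ht)).2⟩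
  · linarith [le_abs_self (k t), hk.bound t]
  · refine (hgH x).trans ?_
    rw [abs_of_nonneg hx]
    exact mul_le_mul_of_nonneg_right (by linarith) (le_max_right _ _)
end
end

section
/- Fix b > 0, T > 0, H > 0, a boundary influx h ∈ C([0,T]) with h > 0 on [0,T], and an initial state u₀ ∈ C([0,b]) with 0 ≤ u₀(x) ≤ H(b−x) on [0,b]; set M = max(sup_{[0,T]} h, H). If (s, u) is a classical solution of the one-phase Stefan problem with data (b, u₀, h) on [0,T], then 0 ≤ ṡ(t) ≤ M for all t ∈ (0,T]. -/
open Set MeasureTheory Real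

noncomputable section

open Filter Topology

/-- Second-order necessary condition at a local minimum. -/
theorem IsLocalMin.second_deriv_nonneg {f g : ℝ → ℝ} {x c : ℝ} (hf : IsLocalMin f x)
    (hg : ∀ᶠ y in 𝓝 x, HasDerivAt f (g y) y) (hc : HasDerivAt g c x) : 0 ≤ c := by
  by_contra! hneg
  have hderiv : deriv f =ᶠ[𝓝 x] g := hg.mono fun y hy => hy.deriv
  have hfx : HasDerivAt f (g x) x := hg.self_of_nhds
  have hmax : IsLocalMax f x := by
    refine isLocalMax_of_deriv_deriv_neg ?_ hf.deriv_eq_zero hfx.continuousAt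
    rw [hderiv.deriv_eq, hc.deriv]
    exact hneg
  have hconst : f =ᶠ[𝓝 x] fun _ => f x := by
    filter_upwards [hf, hmax] with y h1 h2 using le_antisymm h2 h1
  have hzero : g =ᶠ[𝓝 x] fun _ => 0 := by
    filter_upwards [hderiv, hconst.eventuallyEq_nhds] with y h1 h2
    rw [← h1, h2.deriv_eq, deriv_const]
  have := hzero.deriv_eq
  rw [hc.deriv, deriv_const] at this
  exact hneg.ne this

/-- A derivative is nonpositive at a point which minimizes the function among nearby points
to its left. -/
theorem HasDerivAt.nonpos_of_le_left {f : ℝ → ℝ} {x a : ℝ} (hf : HasDerivAt f a x)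
    (hmin : ∀ᶠ y in 𝓝[<] x, f x ≤ f y) : a ≤ 0 := by
  have hlim : Tendsto (slope f x) (𝓝[<] x) (𝓝 a) :=
    (hasDerivAt_iff_tendsto_slope.1 hf).mono_left
      (nhdsWithin_mono x fun y (hy : y < x) => hy.ne)
  refine le_of_tendsto hlim ?_
  filter_upwards [hmin, self_mem_nhdsWithin] with y h1 h2
  rw [slope_def_field]
  exact div_nonpos_of_nonneg_of_nonpos (sub_nonneg.2 h1) (sub_nonpos.2 (le_of_lt h2))

/-- A derivative is nonnegative at a point which minimizes the function among nearby points
to its right. -/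
theorem HasDerivAt.nonneg_of_le_right {f : ℝ → ℝ} {x a : ℝ} (hf : HasDerivAt f a x)
    (hmin : ∀ᶠ y in 𝓝[>] x, f x ≤ f y) : 0 ≤ a := by
  have hlim : Tendsto (slope f x) (𝓝[>] x) (𝓝 a) :=
    (hasDerivAt_iff_tendsto_slope.1 hf).mono_left
      (nhdsWithin_mono x fun y (hy : x < y) => hy.ne')
  refine ge_of_tendsto hlim ?_
  filter_upwards [hmin, self_mem_nhdsWithin] with y h1 h2
  rw [slope_def_field]
  exact div_nonneg (sub_nonneg.2 h1) (sub_nonneg.2 (le_of_lt h2))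

/-- The closed space-time region `{(x,t) : 0 ≤ x ≤ s(t), 0 ≤ t ≤ T}`. -/
def stefanClosedRegion (T : ℝ) (s : ℝ → ℝ) : Set (ℝ × ℝ) :=
  {p : ℝ × ℝ | 0 ≤ p.2 ∧ p.2 ≤ T ∧ 0 ≤ p.1 ∧ p.1 ≤ s p.2}

theorem isCompact_stefanClosedRegion {T : ℝ} {s : ℝ → ℝ} (hs : ContinuousOn s (Icc 0 T))
    (hpos : ∀ t ∈ Icc (0:ℝ) T, 0 < s t) : IsCompact (stefanClosedRegion T s) := by
  have himage : stefanClosedRegion T s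
      = (fun q : ℝ × ℝ => (q.1 * s q.2, q.2)) '' (Icc (0:ℝ) 1 ×ˢ Icc (0:ℝ) T) := by
    ext ⟨x, t⟩
    constructor
    · rintro ⟨h0, hT, hx0, hxs⟩
      have hst := hpos t ⟨h0, hT⟩
      refine ⟨(x / s t, t), ⟨⟨div_nonneg hx0 hst.le, (div_le_one hst).2 hxs⟩, h0, hT⟩, ?_⟩
      simp only [Prod.mk.injEq, and_true]
      field_simp
    · rintro ⟨⟨r, τ⟩, ⟨⟨hr0, hr1⟩, hτ⟩, heq⟩
      simp only [Prod.mk.injEq] at heq hr0 hr1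
      obtain ⟨rfl, rfl⟩ := heq
      have hst := hpos _ hτ
      exact ⟨hτ.1, hτ.2, mul_nonneg hr0 hst.le, mul_le_of_le_one_left hst.le hr1⟩
  rw [himage]
  refine (isCompact_Icc.prod isCompact_Icc).image_of_continuousOn ?_
  refine (continuousOn_fst.mul (hs.comp continuousOn_snd ?_)).prodMk continuousOn_snd
  exact fun q hq => hq.2

theorem stefanClosedRegion_subset_closure {T T' : ℝ} {s : ℝ → ℝ} (hT : 0 < T) (hT' : T' < T)
    (hs : ContinuousOn s (Icc 0 T)) (hpos : ∀ t ∈ Icc (0:ℝ) T, 0 < s t) :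
    stefanClosedRegion T' s ⊆ closure (stefanQ T s) := by
  rintro ⟨x, t⟩ ⟨h0, ht, hx0, hxs⟩
  simp only at h0 ht hx0 hxs
  have hst := hpos t ⟨h0, by linarith⟩
  have hx : x / s t ∈ closure (Ioo (0:ℝ) 1) := by
    rw [closure_Ioo zero_ne_one]
    exact ⟨div_nonneg hx0 hst.le, (div_le_one hst).2 hxs⟩
  have ht' : t ∈ closure (Ioo (0:ℝ) T) := by
    rw [closure_Ioo hT.ne]
    exact ⟨h0, by linarith⟩
  have hq : (x / s t, t) ∈ closure (Ioo (0:ℝ) 1 ×ˢ Ioo (0:ℝ) T) := by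
    rw [closure_prod_eq]
    exact ⟨hx, ht'⟩
  have hcont : ContinuousWithinAt (fun q : ℝ × ℝ => (q.1 * s q.2, q.2))
      (Ioo (0:ℝ) 1 ×ˢ Ioo (0:ℝ) T) (x / s t, t) := by
    have hsc : ContinuousWithinAt (fun q : ℝ × ℝ => s q.2)
        (Ioo (0:ℝ) 1 ×ˢ Ioo (0:ℝ) T) (x / s t, t) :=
      ContinuousWithinAt.comp (g := s) (t := Icc 0 T) (hs t ⟨h0, by linarith⟩)
        continuousWithinAt_snd fun q hq => Ioo_subset_Icc_self hq.2
    exact (continuousWithinAt_fst.mul hsc).prodMk continuousWithinAt_snd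
  have hmem := hcont.mem_closure (t := stefanQ T s) hq (by
    rintro ⟨r, τ⟩ ⟨hr, hτ⟩
    have hsτ := hpos τ (Ioo_subset_Icc_self hτ)
    exact ⟨mul_pos hr.1 hsτ, mul_lt_of_lt_one_left hsτ hr.2, hτ.1, hτ.2⟩)
  simpa [div_mul_cancel₀ x hst.ne'] using hmem

/-- Weak minimum principle for strict supersolutions of the heat equation below a moving
front, with strictly negative spatial derivative at `x = 0`. -/
theorem nonneg_of_strict_supersolution_s3 {T : ℝ} {s : ℝ → ℝ} {v : ℝ → ℝ → ℝ}
    (hs : ContinuousOn s (Icc 0 T)) (hpos : ∀ t ∈ Icc (0:ℝ) T, 0 < s t)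
    (hv : ContinuousOn (fun p : ℝ × ℝ => v p.1 p.2) (stefanClosedRegion T s))
    (hint : ∀ x t, 0 < x → x < s t → 0 < t → t ≤ T → ∃ (a c : ℝ) (g : ℝ → ℝ),
      (∀ᶠ y in 𝓝 x, HasDerivAt (fun z => v z t) (g y) y) ∧ HasDerivAt g c x ∧
        HasDerivAt (fun τ => v x τ) a t ∧ c < a)
    (hleft : ∀ t, 0 < t → t ≤ T → ∃ a < 0, HasDerivAt (fun y => v y t) a 0)
    (hinit : ∀ x ∈ Icc 0 (s 0), 0 ≤ v x 0)
    (hfront : ∀ t, 0 < t → t ≤ T → 0 ≤ v (s t) t) :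
    ∀ p ∈ stefanClosedRegion T s, 0 ≤ v p.1 p.2 := by
  intro p hp
  obtain ⟨⟨x, t⟩, ⟨ht0, htT, hx0, hxs⟩, hmin⟩ :=
    (isCompact_stefanClosedRegion hs hpos).exists_isMinOn ⟨p, hp⟩ hv
  simp only at ht0 htT hx0 hxs
  have hmin' : ∀ y τ, (y, τ) ∈ stefanClosedRegion T s → v x t ≤ v y τ :=
    fun y τ hy => hmin hy
  refine le_trans ?_ (hmin' p.1 p.2 hp)
  rcases ht0.eq_or_lt with rfl | ht0
  · exact hinit x ⟨hx0, hxs⟩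
  rcases hxs.eq_or_lt with rfl | hxs
  · exact hfront t ht0 htT
  exfalso
  rcases hx0.eq_or_lt with rfl | hx0
  · obtain ⟨a, ha, hda⟩ := hleft t ht0 htT
    refine ha.not_ge (hda.nonneg_of_le_right ?_)
    filter_upwards [Ioo_mem_nhdsGT hxs] with y hy
    exact hmin' y t ⟨ht0.le, htT, hy.1.le, hy.2.le⟩
  · obtain ⟨a, c, g, hg, hgc, ha, hca⟩ := hint x t hx0 hxs ht0 htT
    have hc : 0 ≤ c := by
      refine IsLocalMin.second_deriv_nonneg (f := fun z => v z t) ?_ hg hgc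
      filter_upwards [Ioo_mem_nhds hx0 hxs] with y hy
      exact hmin' y t ⟨ht0.le, htT, hy.1.le, hy.2.le⟩
    have ha0 : a ≤ 0 := by
      refine ha.nonpos_of_le_left ?_
      have hsub : 𝓝[<] t ≤ 𝓝[Icc 0 T] t := by
        rw [← nhdsWithin_Ioo_eq_nhdsLT ht0]
        exact nhdsWithin_mono t fun τ hτ => ⟨hτ.1.le, hτ.2.le.trans htT⟩
      have hlim : Tendsto s (𝓝[<] t) (𝓝 (s t)) := (hs t ⟨ht0.le, htT⟩).mono_left hsub
      filter_upwards [hlim.eventually (lt_mem_nhds hxs), Ioo_mem_nhdsLT ht0] with τ h1 h2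
      exact hmin' x τ ⟨h2.1.le, h2.2.le.trans htT, hx0.le, h1.le⟩
    linarith

namespace IsStefanSolution

variable {b T : ℝ} {u₀ h s : ℝ → ℝ} {u : ℝ → ℝ → ℝ}

theorem s_cont (hsol : IsStefanSolution b T u₀ h s u) : ContinuousOn s (Icc 0 T) :=
  hsol.s_lipschitz.choose_spec.continuousOn

theorem u_cont_closedRegion (hsol : IsStefanSolution b T u₀ h s u) (hT : 0 < T) {T' : ℝ}
    (hT' : T' < T) :
    ContinuousOn (fun p : ℝ × ℝ => u p.1 p.2) (stefanClosedRegion T' s) :=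
  hsol.u_cont.mono (stefanClosedRegion_subset_closure hT hT' hsol.s_cont hsol.s_pos)

/-- The initial condition extends to the closed interval by continuity. -/
theorem init_Icc (hsol : IsStefanSolution b T u₀ h s u) (hb : 0 < b) (hT : 0 < T)
    (hu₀c : ContinuousOn u₀ (Icc 0 b)) : ∀ x ∈ Icc (0:ℝ) b, u x 0 = u₀ x := by
  have hu : ContinuousOn (fun x => u x 0) (Icc 0 b) := by
    refine (hsol.u_cont_closedRegion hT hT).comp
      (f := fun x : ℝ => (x, (0:ℝ))) (by fun_prop) ?_
    intro x hx
    exact ⟨le_rfl, le_rfl, hx.1, by simpa [hsol.s_init] using hx.2⟩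
  have heq : EqOn (fun x => u x 0) u₀ (Ioo 0 b) := hsol.init
  exact heq.of_subset_closure hu hu₀c Ioo_subset_Icc_self (closure_Ioo hb.ne).symm.subset

theorem hasDerivAt_zero (hsol : IsStefanSolution b T u₀ h s u)
    (hhpos : ∀ t ∈ Icc (0:ℝ) T, 0 < h t) {t : ℝ} (ht : t ∈ Ioo 0 T) :
    HasDerivAt (fun y => u y t) (-(h t)) 0 := by
  have hne : deriv (fun y => u y t) 0 ≠ 0 := by
    rw [hsol.flux t ht]
    exact neg_ne_zero.2 (hhpos t (Ioo_subset_Icc_self ht)).ne'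
  rw [← hsol.flux t ht]
  exact (differentiableAt_of_deriv_ne_zero hne).hasDerivAt

/-- Minimum principle for the affine perturbations `α(t) + βx + σ u(x,t)` of a solution. -/
theorem affine_nonneg (hsol : IsStefanSolution b T u₀ h s u)
    (hhpos : ∀ t ∈ Icc (0:ℝ) T, 0 < h t) {T' β σ : ℝ} {α α' : ℝ → ℝ} (hT : 0 < T) (hT' : T' < T)
    (hαc : ContinuousOn α (Icc 0 T'))
    (hα : ∀ t, 0 < t → t ≤ T' → HasDerivAt α (α' t) t)
    (hα' : ∀ t, 0 < t → t ≤ T' → 0 < α' t)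
    (hleft : ∀ t, 0 < t → t ≤ T' → β - σ * h t < 0)
    (hinit : ∀ x ∈ Icc 0 (s 0), 0 ≤ α 0 + β * x + σ * u x 0)
    (hfront : ∀ t, 0 < t → t ≤ T' → 0 ≤ α t + β * s t) :
    ∀ x t, 0 ≤ t → t ≤ T' → 0 ≤ x → x ≤ s t → 0 ≤ α t + β * x + σ * u x t := by
  intro x t ht0 htT hx0 hxs
  refine nonneg_of_strict_supersolution_s3 (T := T') (s := s)
    (v := fun x t => α t + β * x + σ * u x t)
    (hsol.s_cont.mono (Icc_subset_Icc_right hT'.le))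
    (fun t ht => hsol.s_pos t ⟨ht.1, ht.2.trans hT'.le⟩) ?_ ?_ ?_ hinit ?_
    (x, t) ⟨ht0, htT, hx0, hxs⟩
  · have hα2 : ContinuousOn (fun p : ℝ × ℝ => α p.2) (stefanClosedRegion T' s) :=
      hαc.comp continuousOn_snd fun p hp => ⟨hp.1, hp.2.1⟩
    exact (hα2.add (continuousOn_const.mul continuousOn_fst)).add
      (continuousOn_const.mul (hsol.u_cont_closedRegion hT hT'))
  · intro x t hx0 hxs ht0 htT
    have hmem : ∀ y, 0 < y → y < s t → (y, t) ∈ stefanQ T s :=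
      fun y hy0 hys => ⟨hy0, hys, ht0, htT.trans_lt hT'⟩
    refine ⟨α' t + σ * deriv (fun y => deriv (fun z => u z t) y) x,
      σ * deriv (fun y => deriv (fun z => u z t) y) x,
      fun y => β + σ * deriv (fun z => u z t) y, ?_, ?_, ?_, ?_⟩
    · filter_upwards [Ioo_mem_nhds hx0 hxs] with y hy
      have h1 := (((hasDerivAt_id y).const_mul β).const_add (α t)).fun_add
        ((hsol.u_x y t (hmem y hy.1 hy.2)).const_mul σ)
      simpa using h1
    · exact ((hsol.u_xx x t (hmem x hx0 hxs)).const_mul σ).const_add β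
    · exact ((hα t ht0 htT).add_const (β * x)).add
        ((hsol.heat x t (hmem x hx0 hxs)).const_mul σ)
    · linarith [hα' t ht0 htT]
  · intro t ht0 htT
    refine ⟨β - σ * h t, hleft t ht0 htT, ?_⟩
    have h1 := (((hasDerivAt_id (0:ℝ)).const_mul β).const_add (α t)).fun_add
      ((hsol.hasDerivAt_zero hhpos ⟨ht0, htT.trans_lt hT'⟩).const_mul σ)
    simpa [sub_eq_add_neg] using h1
  · intro t ht0 htT
    simpa [hsol.front_zero t ⟨ht0, htT.trans_lt hT'⟩] using hfront t ht0 htT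

theorem u_nonneg (hsol : IsStefanSolution b T u₀ h s u) (hb : 0 < b)
    (hhpos : ∀ t ∈ Icc (0:ℝ) T, 0 < h t) (hu₀c : ContinuousOn u₀ (Icc 0 b))
    (hu₀ : ∀ x ∈ Icc (0:ℝ) b, 0 ≤ u₀ x) {x t : ℝ} (ht : t ∈ Ioo 0 T) (hx0 : 0 ≤ x)
    (hxs : x ≤ s t) : 0 ≤ u x t := by
  have hT : 0 < T := ht.1.trans ht.2
  refine le_of_forall_pos_le_add fun ε hε => ?_
  have hδ : 0 < ε / t := div_pos hε ht.1
  have key := hsol.affine_nonneg hhpos (T' := t) (β := 0) (σ := 1) (α := fun τ => ε / t * τ)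
    (α' := fun _ => ε / t) hT ht.2 (by fun_prop)
    (fun τ _ _ => by simpa using (hasDerivAt_id τ).const_mul (ε / t)) (fun _ _ _ => hδ)
    (fun τ h0 h1 => by linarith [hhpos τ ⟨h0.le, h1.trans ht.2.le⟩])
    (fun y hy => by
      rw [hsol.s_init] at hy
      simpa [hsol.init_Icc hb hT hu₀c y hy] using hu₀ y hy)
    (fun τ h0 _ => by simpa using mul_nonneg hδ.le h0.le)
    x t ht.1.le le_rfl hx0 hxs
  have hcancel : ε / t * t = ε := div_mul_cancel₀ ε ht.1.ne'
  simp only [hcancel] at key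
  linarith

/-- A lower barrier at the front bounds the front velocity from below. -/
theorem deriv_s_nonneg (hsol : IsStefanSolution b T u₀ h s u) {t : ℝ} (ht : t ∈ Ioo 0 T)
    (hu : ∀ x, 0 ≤ x → x ≤ s t → 0 ≤ u x t) : 0 ≤ deriv s t := by
  by_cases hd : DifferentiableAt ℝ (fun y => u y t) (s t)
  · have hda := hd.hasDerivAt
    rw [hsol.stefan_cond t ht] at hda
    have := hda.nonpos_of_le_left (by
      filter_upwards [Ioo_mem_nhdsLT (hsol.s_pos t (Ioo_subset_Icc_self ht))] with y hy
      rw [hsol.front_zero t ht]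
      exact hu y hy.1.le hy.2.le)
    linarith
  · have := hsol.stefan_cond t ht
    rw [deriv_zero_of_not_differentiableAt hd] at this
    linarith

/-- A linear upper barrier at the front bounds the front velocity from above. -/
theorem deriv_s_le (hsol : IsStefanSolution b T u₀ h s u) {t M : ℝ} (ht : t ∈ Ioo 0 T)
    (hM : 0 ≤ M) (hu : ∀ x, 0 ≤ x → x ≤ s t → u x t ≤ M * (s t - x)) : deriv s t ≤ M := by
  by_cases hd : DifferentiableAt ℝ (fun y => u y t) (s t)
  · have hda := hd.hasDerivAt
    rw [hsol.stefan_cond t ht] at hda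
    have hdw : HasDerivAt (fun y => M * (s t - y) - u y t) (-M + deriv s t) (s t) := by
      have h1 := (((hasDerivAt_id (s t)).const_sub (s t)).const_mul M).fun_sub hda
      simpa using h1
    have := hdw.nonpos_of_le_left (by
      filter_upwards [Ioo_mem_nhdsLT (hsol.s_pos t (Ioo_subset_Icc_self ht))] with y hy
      rw [hsol.front_zero t ht]
      linarith [hu y hy.1.le hy.2.le])
    linarith
  · have := hsol.stefan_cond t ht
    rw [deriv_zero_of_not_differentiableAt hd] at this
    linarith

theorem u_le (hsol : IsStefanSolution b T u₀ h s u) (hb : 0 < b)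
    (hhpos : ∀ t ∈ Icc (0:ℝ) T, 0 < h t) (hu₀c : ContinuousOn u₀ (Icc 0 b)) {M : ℝ}
    (hM : 0 ≤ M) (hhM : ∀ t ∈ Icc (0:ℝ) T, h t ≤ M)
    (hu₀ : ∀ x ∈ Icc (0:ℝ) b, u₀ x ≤ M * (b - x)) (hs' : ∀ t ∈ Ioo (0:ℝ) T, 0 ≤ deriv s t)
    {x t : ℝ} (ht : t ∈ Ioo 0 T) (hx0 : 0 ≤ x) (hxs : x ≤ s t) :
    u x t ≤ M * (s t - x) := by
  have hT : 0 < T := ht.1.trans ht.2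
  obtain ⟨C, hC⟩ := (isCompact_Icc.image_of_continuousOn hsol.s_cont).bddAbove
  have hsC : ∀ τ ∈ Icc (0:ℝ) T, s τ ≤ C := fun τ hτ => hC (mem_image_of_mem s hτ)
  have hCpos : 0 < C := (hsol.s_pos t (Ioo_subset_Icc_self ht)).trans_le
    (hsC t (Ioo_subset_Icc_self ht))
  refine le_of_forall_pos_le_add fun ε hε => ?_
  have hCt : 0 < C + t := add_pos hCpos ht.1
  obtain ⟨δ, hδ, hδε⟩ : ∃ δ, 0 < δ ∧ δ * (C + t) = ε :=
    ⟨ε / (C + t), div_pos hε hCt, div_mul_cancel₀ ε hCt.ne'⟩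
  have key := hsol.affine_nonneg hhpos (T' := t) (β := -M - δ) (σ := -1)
    (α := fun τ => M * s τ + δ * (C + τ)) (α' := fun τ => M * deriv s τ + δ) hT ht.2
    ((continuousOn_const.mul (hsol.s_cont.mono (Icc_subset_Icc_right ht.2.le))).add
      (by fun_prop))
    (fun τ h0 h1 => by
      have h2 := ((hsol.s_diff τ ⟨h0, h1.trans ht.2.le⟩).const_mul M).fun_add
        (((hasDerivAt_id τ).const_add C).const_mul δ)
      simpa using h2)
    (fun τ h0 h1 => by
      have := mul_nonneg hM (hs' τ ⟨h0, h1.trans_lt ht.2⟩)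
      linarith)
    (fun τ h0 h1 => by linarith [hhM τ ⟨h0.le, h1.trans ht.2.le⟩])
    (fun y hy => by
      have hyC : y ≤ C := hy.2.trans (hsC 0 ⟨le_rfl, hT.le⟩)
      rw [hsol.s_init] at hy
      rw [hsol.init_Icc hb hT hu₀c y hy, hsol.s_init]
      nlinarith [hu₀ y hy, mul_nonneg hδ.le (sub_nonneg.2 hyC)])
    (fun τ h0 h1 => by
      have h2 := hsC τ ⟨h0.le, h1.trans ht.2.le⟩
      nlinarith [mul_nonneg hδ.le (sub_nonneg.2 h2), mul_pos hδ h0])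
    x t ht.1.le le_rfl hx0 hxs
  simp only [hδε] at key
  nlinarith [mul_nonneg hδ.le hx0]

end IsStefanSolution

/-- the free boundary velocity satisfies `0 ≤ ṡ(t) ≤ M` on `(0,T]`,
where `M = max(sup_{[0,T]} h, H)`. -/
theorem stefan_front_velocity_bounds (b T H : ℝ) (hb : 0 < b) (hT : 0 < T) (hH : 0 < H)
    (h u₀ : ℝ → ℝ)
    (hhc : ContinuousOn h (Icc 0 T)) (hhpos : ∀ t ∈ Icc (0:ℝ) T, 0 < h t)
    (hu₀c : ContinuousOn u₀ (Icc 0 b))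
    (hu₀ : ∀ x ∈ Icc (0:ℝ) b, 0 ≤ u₀ x ∧ u₀ x ≤ H * (b - x))
    (M : ℝ) (hM : M = max (sSup (h '' Icc 0 T)) H)
    (s : ℝ → ℝ) (u : ℝ → ℝ → ℝ)
    (hsol : IsStefanSolution b T u₀ h s u) :
    ∀ t ∈ Ioc (0:ℝ) T, 0 ≤ deriv s t ∧ deriv s t ≤ M := by
  have hMle : ∀ t ∈ Icc (0:ℝ) T, h t ≤ M := by
    intro t ht
    rw [hM]
    exact (le_csSup (isCompact_Icc.image_of_continuousOn hhc).bddAbove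
      (mem_image_of_mem h ht)).trans (le_max_left _ _)
  have hHM : H ≤ M := hM ▸ le_max_right _ _
  have hM0 : 0 ≤ M := hH.le.trans hHM
  have hlower : ∀ t ∈ Ioo (0:ℝ) T, 0 ≤ deriv s t := fun t ht =>
    hsol.deriv_s_nonneg ht fun x hx0 hxs =>
      hsol.u_nonneg hb hhpos hu₀c (fun y hy => (hu₀ y hy).1) ht hx0 hxs
  have hupper : ∀ t ∈ Ioo (0:ℝ) T, deriv s t ≤ M := fun t ht =>
    hsol.deriv_s_le ht hM0 fun x hx0 hxs =>
      hsol.u_le hb hhpos hu₀c hM0 hMle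
        (fun y hy => (hu₀ y hy).2.trans
          (mul_le_mul_of_nonneg_right hHM (sub_nonneg.2 hy.2)))
        hlower ht hx0 hxs
  intro t ht
  have hmem : t ∈ closure (Ioo (0:ℝ) T) := by
    rw [closure_Ioo hT.ne]
    exact Ioc_subset_Icc_self ht
  have hcont : ContinuousWithinAt (deriv s) (Ioo 0 T) t :=
    (hsol.s_deriv_cont t ht).mono Ioo_subset_Ioc_self
  have hIcc : deriv s t ∈ closure (Icc 0 M) :=
    hcont.mem_closure hmem fun τ hτ => ⟨hlower τ hτ, hupper τ hτ⟩
  rwa [isClosed_Icc.closure_eq] at hIcc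
end
end
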